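/- arXiv:0908.2282 — 5 statements merged into one kernel-verified Lean document; each statement's English description precedes it below -/
import Mathlib

section
/- Let m ≥ 1 be an integer and let ψ : ℕ → ℝ≥0 be a function such that the series ∑_{q=1}^∞ q^{m-1} ψ(q) converges. Then the set A_m(ψ) of vectors v ∈ ℝ^m for which the inequality |p + v₁q₁ + ⋯ + v_m q_m| < ψ(max_i |q_i|) has infinitely many solutions (p, q) ∈ ℤ × ℤ^m has Lebesgue measure zero. -/
open MeasureTheory
open scoped NNReal

/-- The number of integer vectors of supremum norm `n` is at most `2m(2n+1)^(m-1)`. -/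
theorem encard_natAbs_sup_eq_le {m : ℕ} (hm : 1 ≤ m) (n : ℕ) :
    ((fun q : Fin m → ℤ => Finset.univ.sup fun i => (q i).natAbs) ⁻¹' {n}).encard ≤
      ((m * (2 * (2 * n + 1) ^ (m - 1)) : ℕ) : ℕ∞) := by
  classical
  let B : Fin m → Finset (Fin m → ℤ) := fun j =>
    Fintype.piFinset (Function.update (fun _ => Finset.Icc (-(n : ℤ)) n) j {(n : ℤ), -(n : ℤ)})
  have hB : ∀ j, (B j).card ≤ 2 * (2 * n + 1) ^ (m - 1) := by
    intro j
    have hprod : (B j).card =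
        ∏ i, Function.update (fun _ : Fin m => 2 * n + 1) j
          (({(n : ℤ), -(n : ℤ)} : Finset ℤ).card) i := by
      rw [Fintype.card_piFinset]
      refine Finset.prod_congr rfl fun i _ => ?_
      by_cases h : i = j
      · subst h; simp
      · simp only [Function.update_of_ne h, Int.card_Icc]
        omega
    rw [hprod, Finset.prod_update_of_mem (Finset.mem_univ j), Finset.prod_const,
      Finset.card_sdiff_of_subset (Finset.subset_univ _), Finset.card_univ, Fintype.card_fin,
      Finset.card_singleton]
    exact Nat.mul_le_mul_right _ Finset.card_le_two
  have hsub : ((fun q : Fin m → ℤ => Finset.univ.sup fun i => (q i).natAbs) ⁻¹' {n}) ⊆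
      (Finset.univ.biUnion B : Finset (Fin m → ℤ)) := by
    intro q hq
    simp only [Set.mem_preimage, Set.mem_singleton_iff] at hq
    have : Nonempty (Fin m) := ⟨⟨0, hm⟩⟩
    obtain ⟨j, -, hj⟩ := Finset.exists_mem_eq_sup Finset.univ Finset.univ_nonempty
      (fun i => (q i).natAbs)
    simp only [Finset.coe_biUnion, Set.mem_iUnion, Finset.mem_coe, Finset.mem_univ]
    refine ⟨j, trivial, Fintype.mem_piFinset.2 fun i => ?_⟩
    have hi : (q i).natAbs ≤ n :=
      hq ▸ Finset.le_sup (f := fun i => (q i).natAbs) (Finset.mem_univ i)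
    by_cases h : i = j
    · subst h
      simp only [Function.update_self, Finset.mem_insert, Finset.mem_singleton]
      omega
    · simp only [Function.update_of_ne h, Finset.mem_Icc]
      omega
  refine (Set.encard_le_encard hsub).trans ?_
  rw [Set.encard_coe_eq_coe_finsetCard]
  have := Finset.card_biUnion_le_card_mul Finset.univ B _ fun j _ => hB j
  rw [Finset.card_univ, Fintype.card_fin] at this
  exact_mod_cast this

/-- If `∑ n^(m-1) ψ(n)` converges, then so does the sum of `ψ(‖q‖_∞)` over `q ∈ ℤ^m`. -/
theorem tsum_natAbs_sup_ne_top {m : ℕ} (hm : 1 ≤ m) {ψ : ℕ → ℝ≥0}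
    (hconv : Summable fun q : ℕ => (q : ℝ) ^ (m - 1) * (ψ q : ℝ)) :
    ∑' q : Fin m → ℤ, (ψ (Finset.univ.sup fun i => (q i).natAbs) : ENNReal) ≠ ⊤ := by
  have hsum : Summable fun n : ℕ => ((m * (2 * (2 * n + 1) ^ (m - 1)) : ℕ) : ℝ≥0) * ψ n := by
    rw [← NNReal.summable_coe]
    refine (hconv.mul_left (m * 2 * 3 ^ (m - 1) : ℝ)).of_norm_bounded_eventually_nat ?_
    filter_upwards [Filter.eventually_ge_atTop 1] with n hn
    have hn' : (1 : ℝ) ≤ n := by exact_mod_cast hn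
    have hpow : (2 * (n : ℝ) + 1) ^ (m - 1) ≤ 3 ^ (m - 1) * (n : ℝ) ^ (m - 1) := by
      rw [← mul_pow]
      gcongr
      linarith
    rw [Real.norm_of_nonneg (by positivity)]
    push_cast
    calc (m : ℝ) * (2 * (2 * n + 1) ^ (m - 1)) * ψ n
        ≤ m * (2 * (3 ^ (m - 1) * (n : ℝ) ^ (m - 1))) * ψ n := by gcongr
      _ = _ := by ring
  rw [← ENNReal.tsum_fiberwise _ fun q : Fin m → ℤ => Finset.univ.sup fun i => (q i).natAbs]
  refine ne_top_of_le_ne_top (ENNReal.tsum_coe_ne_top_iff_summable.2 hsum)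
    (ENNReal.tsum_le_tsum fun n => ?_)
  have hfib : ∀ q : (fun q : Fin m → ℤ => Finset.univ.sup fun i => (q i).natAbs) ⁻¹' {n},
      (ψ (Finset.univ.sup fun i => (q.1 i).natAbs) : ENNReal) = ψ n :=
    fun q => by rw [show (Finset.univ.sup fun i => (q.1 i).natAbs) = n from q.2]
  rw [tsum_congr hfib, ENNReal.tsum_set_const, ENNReal.coe_mul, ENNReal.coe_natCast]
  gcongr
  exact_mod_cast ENat.toENNReal_le.2 (encard_natAbs_sup_eq_le hm n)

/-- A nonzero integral linear form preserves the Haar measure of the torus. -/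
theorem measurePreserving_sum_zsmul {m : ℕ} {q : Fin m → ℤ} (hq : q ≠ 0) :
    MeasurePreserving (fun x : Fin m → UnitAddCircle => ∑ i, q i • x i) := by
  classical
  let f : (Fin m → UnitAddCircle) →+ UnitAddCircle :=
    { toFun := fun x => ∑ i, q i • x i
      map_zero' := by simp
      map_add' := fun x y => by simp [Finset.sum_add_distrib] }
  have hcont : Continuous f := by
    change Continuous fun x : Fin m → UnitAddCircle => ∑ i, q i • x i
    fun_prop
  have hsurj : Function.Surjective f := by
    intro y
    obtain ⟨t, rfl⟩ := QuotientAddGroup.mk_surjective y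
    obtain ⟨j, hj⟩ := Function.ne_iff.1 hq
    have hj' : (q j : ℝ) ≠ 0 := by exact_mod_cast hj
    refine ⟨Pi.single j ((t / q j : ℝ) : UnitAddCircle), ?_⟩
    change ∑ i, q i • (Pi.single j ((t / q j : ℝ) : UnitAddCircle) : Fin m → UnitAddCircle) i = _
    rw [Finset.sum_eq_single j (fun i _ hi => by simp [hi]) (by simp), Pi.single_eq_same,
      ← AddCircle.coe_zsmul, zsmul_eq_mul, mul_div_cancel₀ _ hj']
  exact AddMonoidHom.measurePreserving hcont hsurj (by
    rw [volume_pi, Measure.pi_univ]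
    simp)

/-- The Khintchine–Groshev convergence theorem on the torus. -/
theorem ae_finite_norm_sum_zsmul_lt {m : ℕ} (hm : 1 ≤ m) {ψ : ℕ → ℝ≥0}
    (hconv : Summable fun q : ℕ => (q : ℝ) ^ (m - 1) * (ψ q : ℝ)) :
    ∀ᵐ x : Fin m → UnitAddCircle, {q : Fin m → ℤ | q ≠ 0 ∧
      ‖∑ i, q i • x i‖ < ψ (Finset.univ.sup fun i => (q i).natAbs)}.Finite := by
  refine ae_finite_setOfPred_mem (s := fun q : Fin m → ℤ => {x : Fin m → UnitAddCircle | q ≠ 0 ∧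
    ‖∑ i, q i • x i‖ < ψ (Finset.univ.sup fun i => (q i).natAbs)}) ?_
  refine ne_top_of_le_ne_top
    (ENNReal.mul_ne_top (a := 2) (by simp) (tsum_natAbs_sup_ne_top hm hconv)) ?_
  rw [← ENNReal.tsum_mul_left]
  refine ENNReal.tsum_le_tsum fun q => ?_
  by_cases hq : q = 0
  · simp [hq]
  set r := ψ (Finset.univ.sup fun i => (q i).natAbs)
  calc volume {x : Fin m → UnitAddCircle | q ≠ 0 ∧ ‖∑ i, q i • x i‖ < r}
      ≤ volume ((fun x : Fin m → UnitAddCircle => ∑ i, q i • x i) ⁻¹'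
          Metric.closedBall 0 (r : ℝ)) :=
        measure_mono fun x hx => by simpa using hx.2.le
    _ = ENNReal.ofReal (min 1 (2 * r)) := by
        rw [(measurePreserving_sum_zsmul hq).measure_preimage
          Metric.isClosed_closedBall.measurableSet.nullMeasurableSet, AddCircle.volume_closedBall]
    _ ≤ ENNReal.ofReal (2 * r) := ENNReal.ofReal_le_ofReal (min_le_right _ _)
    _ = 2 * (r : ENNReal) := by
        rw [ENNReal.ofReal_mul zero_le_two, ENNReal.ofReal_coe_nnreal, ENNReal.ofReal_ofNat]

/-- A property holding almost everywhere on the torus holds for almost every real vector. -/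
theorem ae_coe_unitAddCircle {m : ℕ} {p : (Fin m → UnitAddCircle) → Prop} (hp : ∀ᵐ x, p x) :
    ∀ᵐ v : Fin m → ℝ, p fun i => (v i : UnitAddCircle) := by
  have hcover : ⋃ a : Fin m → ℤ, Set.univ.pi (fun i => Set.Ioc (a i : ℝ) (a i + 1)) =
      Set.univ := by
    refine Set.eq_univ_of_forall fun v => Set.mem_iUnion.2 ⟨fun i => ⌈v i⌉ - 1, fun i _ => ?_⟩
    have h₁ := Int.ceil_lt_add_one (v i)
    have h₂ := Int.le_ceil (v i)
    constructor <;> push_cast <;> linarith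
  rw [← Measure.restrict_univ (μ := (volume : Measure (Fin m → ℝ))), ← hcover,
    ae_restrict_iUnion_iff]
  intro a
  rw [volume_pi, Measure.restrict_pi_pi]
  exact (measurePreserving_pi _ _ fun i =>
    UnitAddCircle.measurePreserving_mk (a i : ℝ)).quasiMeasurePreserving.ae hp

/-- Convergence part of the Khintchine–Groshev theorem: if
`∑ q^(m-1) ψ(q) < ∞`, then the set of `v ∈ ℝ^m` for which
`|p + v·q| < ψ(‖q‖_∞)` has infinitely many integer solutions `(p, q)`
has Lebesgue measure zero. -/
theorem khintchine_groshev_convergence (m : ℕ) (hm : 1 ≤ m) (ψ : ℕ → ℝ≥0)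
    (hconv : Summable fun q : ℕ => (q : ℝ) ^ (m - 1) * (ψ q : ℝ)) :
    volume {v : Fin m → ℝ |
      {pq : ℤ × (Fin m → ℤ) |
        |(pq.1 : ℝ) + ∑ i, v i * (pq.2 i : ℝ)| <
          (ψ (Finset.univ.sup fun i => (pq.2 i).natAbs) : ℝ)}.Infinite} = 0 := by
  have hae := ae_coe_unitAddCircle (ae_finite_norm_sum_zsmul_lt hm hconv)
  refine measure_mono_null ?_ (ae_iff.1 hae)
  intro v hv hfin
  refine hv ?_
  refine Set.Finite.of_finite_fibers Prod.snd ((hfin.insert 0).subset ?_) fun q _ => ?_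
  · rintro _ ⟨⟨p, q⟩, hpq, rfl⟩
    rw [Set.mem_insert_iff, or_iff_not_imp_left]
    refine fun hq => ⟨hq, lt_of_le_of_lt ?_ hpq⟩
    have hsum : ∑ i, q i • (v i : UnitAddCircle) =
        ((∑ i, v i * (q i : ℝ) : ℝ) : UnitAddCircle) := by
      rw [← QuotientAddGroup.coe_mk', map_sum]
      refine Finset.sum_congr rfl fun i _ => ?_
      rw [QuotientAddGroup.coe_mk', ← AddCircle.coe_zsmul, zsmul_eq_mul, mul_comm]
    rw [hsum, UnitAddCircle.norm_eq]
    refine (round_le _ (-p)).trans_eq ?_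
    push_cast
    rw [sub_neg_eq_add, add_comm]
  · let r : ℝ := NNReal.toReal (ψ (Finset.univ.sup fun i => (q i).natAbs))
    let c : ℝ := ∑ i, v i * (q i : ℝ)
    refine ((Set.finite_Icc ⌊-r - c⌋ ⌈r - c⌉).image fun p => (p, q)).subset ?_
    rintro ⟨p, q'⟩ ⟨hp, rfl : q' = q⟩
    have hp' := abs_lt.1 (show |(p : ℝ) + c| < r from hp)
    refine ⟨p, ⟨?_, ?_⟩, rfl⟩
    · have := Int.floor_le (-r - c)
      have : ((⌊-r - c⌋ : ℤ) : ℝ) ≤ p := by linarith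
      exact_mod_cast this
    · have := Int.le_ceil (r - c)
      have : (p : ℝ) ≤ (⌈r - c⌉ : ℤ) := by linarith
      exact_mod_cast this
end

section
/- Let m ≥ 1 be an integer and let ψ : ℕ → ℝ≥0 be a monotonically decreasing function such that the series ∑_{q=1}^∞ q^{m-1} ψ(q) diverges. Then the set A_m(ψ) has full Lebesgue measure in ℝ^m, i.e. the complement ℝ^m \ A_m(ψ) has Lebesgue measure zero. -/
open MeasureTheory
open scoped NNReal

section

open Filter Topology

/-- A form of the Paley–Zygmund inequality for a finite family of events. -/
theorem paley_zygmund_finset {Ω ι : Type*} [MeasurableSpace Ω] (μ : Measure Ω)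
    [IsProbabilityMeasure μ] {E : ι → Set Ω} (hE : ∀ i, MeasurableSet (E i)) (S : Finset ι)
    {D t M : ℝ} (hM : M = ∑ i ∈ S, μ.real (E i)) (hM0 : 0 < M) (hD : 0 < D) (ht0 : 0 ≤ t)
    (ht : t < M) (hsum : ∑ i ∈ S, ∑ j ∈ S, μ.real (E i ∩ E j) ≤ D * M ^ 2) :
    (1 - t / M) ^ 2 / D ≤
      μ.real {x | t ≤ ∑ i ∈ S, (E i).indicator (fun _ => (1 : ℝ)) x} := by
  set Z : Ω → ℝ := fun x => ∑ i ∈ S, (E i).indicator (fun _ => (1 : ℝ)) x with hZ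
  set B : Set Ω := {x | t ≤ Z x} with hB
  have hind (A : Set Ω) (hA : MeasurableSet A) :
      Integrable (A.indicator fun _ => (1 : ℝ)) μ := (integrable_const 1).indicator hA
  have hZmeas : Measurable Z :=
    Finset.measurable_sum _ fun i _ => measurable_const.indicator (hE i)
  have hBmeas : MeasurableSet B := measurableSet_le measurable_const hZmeas
  have hZ2 : (fun x => Z x ^ 2) =
      fun x => ∑ i ∈ S, ∑ j ∈ S, (E i ∩ E j).indicator (fun _ => (1 : ℝ)) x := by
    funext x
    simp only [hZ, sq, Finset.sum_mul_sum]
    refine Finset.sum_congr rfl fun i _ => Finset.sum_congr rfl fun j _ => ?_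
    by_cases hi : x ∈ E i <;> by_cases hj : x ∈ E j <;> simp [hi, hj]
  have hZint : Integrable Z μ := integrable_finsetSum _ fun i _ => hind _ (hE i)
  have hZ2int : Integrable (fun x => Z x ^ 2) μ := by
    rw [hZ2]
    exact integrable_finsetSum _ fun i _ =>
      integrable_finsetSum _ fun j _ => hind _ ((hE i).inter (hE j))
  have hEZ : ∫ x, Z x ∂μ = M := by
    rw [hM, integral_finsetSum _ fun i _ => hind _ (hE i)]
    exact Finset.sum_congr rfl fun i _ => integral_indicator_one (hE i)
  have hEZ2 : ∫ x, Z x ^ 2 ∂μ ≤ D * M ^ 2 := by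
    refine le_trans (le_of_eq ?_) hsum
    rw [hZ2, integral_finsetSum _ fun i _ => integrable_finsetSum _ fun j _ =>
      hind _ ((hE i).inter (hE j))]
    refine Finset.sum_congr rfl fun i _ => ?_
    rw [integral_finsetSum _ fun j _ => hind _ ((hE i).inter (hE j))]
    exact Finset.sum_congr rfl fun j _ => integral_indicator_one ((hE i).inter (hE j))
  set s : ℝ := (M - t) / (D * M ^ 2) with hs
  have hs0 : 0 < s := by have := sub_pos.2 ht; positivity
  have hpt (x : Ω) : Z x ≤ t + s / 2 * Z x ^ 2 + (2 * s)⁻¹ * B.indicator (fun _ => (1 : ℝ)) x := by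
    by_cases hx : x ∈ B
    · rw [Set.indicator_of_mem hx]
      have : Z x ≤ s / 2 * Z x ^ 2 + (2 * s)⁻¹ * 1 := by
        have h : s / 2 * Z x ^ 2 + (2 * s)⁻¹ * 1 - Z x = (s * Z x - 1) ^ 2 / (2 * s) := by
          field_simp
          ring
        have : 0 ≤ (s * Z x - 1) ^ 2 / (2 * s) := by positivity
        linarith
      linarith
    · rw [Set.indicator_of_notMem hx]
      have : Z x < t := not_le.1 hx
      have : 0 ≤ s / 2 * Z x ^ 2 := by positivity
      linarith
  have hBint : Integrable (B.indicator fun _ => (1 : ℝ)) μ := hind B hBmeas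
  have hfint : Integrable (fun x => t + s / 2 * Z x ^ 2) μ :=
    (integrable_const t).add (hZ2int.const_mul (s / 2))
  have hM_le : M ≤ t + s / 2 * ∫ x, Z x ^ 2 ∂μ + (2 * s)⁻¹ * μ.real B := by
    rw [← hEZ]
    refine (integral_mono hZint (hfint.add (hBint.const_mul (2 * s)⁻¹)) hpt).trans (le_of_eq ?_)
    simp only [Pi.add_apply]
    rw [integral_add hfint (hBint.const_mul (2 * s)⁻¹),
      integral_add (integrable_const t) (hZ2int.const_mul (s / 2)),
      integral_const_mul, integral_const_mul, integral_const]
    have : ∫ x, B.indicator (fun _ => (1 : ℝ)) x ∂μ = μ.real B := integral_indicator_one hBmeas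
    rw [this]
    simp
  have h1 : s / 2 * ∫ x, Z x ^ 2 ∂μ ≤ s / 2 * (D * M ^ 2) := by gcongr
  have h2 : s / 2 * (D * M ^ 2) = (M - t) / 2 := by rw [hs]; field_simp
  have h3 : (M - t) / 2 ≤ (2 * s)⁻¹ * μ.real B := by linarith
  have h4 : (M - t) * s ≤ μ.real B := by
    rw [inv_mul_eq_div, le_div_iff₀ (by positivity)] at h3
    linarith
  refine le_trans (le_of_eq ?_) h4
  rw [hs]
  field_simp

/-- A quantitative form of the divergence Borel–Cantelli lemma, for events which are pairwise
quasi-independent. -/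
theorem exists_measurableSet_subset_infinite {Ω ι : Type*} [MeasurableSpace Ω] (μ : Measure Ω)
    [IsProbabilityMeasure μ] {E : ι → Set Ω} (hE : ∀ i, MeasurableSet (E i)) {S : ℕ → Finset ι}
    {a : ι → ℝ} (ha : ∀ i, 0 ≤ a i) {C : ℝ} (hC : 0 < C)
    (hdiv : Tendsto (fun N => ∑ i ∈ S N, μ.real (E i)) atTop atTop)
    (hpair : ∀ i j, i ≠ j → μ.real (E i ∩ E j) ≤ a i * a j)
    (hsum : ∀ N, ∑ i ∈ S N, a i ≤ C * ∑ i ∈ S N, μ.real (E i)) :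
    ∃ A, MeasurableSet A ∧ A ⊆ {x | {i | x ∈ E i}.Infinite} ∧ (C ^ 2)⁻¹ ≤ μ.real A := by
  classical
  set M : ℕ → ℝ := fun N => ∑ i ∈ S N, μ.real (E i) with hM
  set B : ℕ → Set Ω := fun N =>
    {x | √(M N) ≤ ∑ i ∈ S N, (E i).indicator (fun _ => (1 : ℝ)) x} with hB
  have hBmeas (N : ℕ) : MeasurableSet (B N) :=
    measurableSet_le measurable_const
      (Finset.measurable_sum _ fun i _ => measurable_const.indicator (hE i))
  have hsub : ⋂ n, ⋃ N ≥ n, B N ⊆ {x | {i | x ∈ E i}.Infinite} := by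
    intro x hx hfin
    obtain ⟨n, hn⟩ := eventually_atTop.1
      ((Real.tendsto_sqrt_atTop.comp hdiv).eventually_gt_atTop (hfin.toFinset.card : ℝ))
    obtain ⟨N, hN, hxN⟩ := Set.mem_iUnion₂.1 (Set.mem_iInter.1 hx n)
    refine absurd (hn N hN) (not_lt.2 (le_trans hxN ?_))
    rw [Finset.sum_indicator_eq_sum_filter, Finset.sum_const, nsmul_eq_mul, mul_one, Nat.cast_le]
    exact Finset.card_le_card fun i hi => by simpa using (Finset.mem_filter.1 hi).2
  have hB_le : ∀ᶠ N in atTop, (1 - √(M N) / M N) ^ 2 / (C ^ 2 + (M N)⁻¹) ≤ μ.real (B N) := by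
    filter_upwards [hdiv.eventually_gt_atTop 1] with N hN
    have hN : 1 < M N := hN
    have hM0 : 0 < M N := by linarith
    refine paley_zygmund_finset μ hE (S N) rfl hM0 (by positivity) (Real.sqrt_nonneg _) ?_ ?_
    · rw [Real.sqrt_lt' hM0]; nlinarith
    · have h1 : ∑ i ∈ S N, ∑ j ∈ S N, μ.real (E i ∩ E j) ≤
          ∑ i ∈ S N, ∑ j ∈ S N, (a i * a j + if i = j then μ.real (E i) else 0) := by
        refine Finset.sum_le_sum fun i _ => Finset.sum_le_sum fun j _ => ?_
        by_cases hij : i = j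
        · subst hij
          simpa using mul_nonneg (ha i) (ha i)
        · simpa [hij] using hpair i j hij
      have h2 : ∑ i ∈ S N, ∑ j ∈ S N, (a i * a j + if i = j then μ.real (E i) else 0) =
          (∑ i ∈ S N, a i) ^ 2 + M N := by
        simp only [Finset.sum_add_distrib, sq, Finset.sum_mul_sum, hM]
        congr 1
        exact Finset.sum_congr rfl fun i hi => by simp [hi]
      have h3 : (∑ i ∈ S N, a i) ^ 2 ≤ (C * M N) ^ 2 :=
        pow_le_pow_left₀ (Finset.sum_nonneg fun i _ => ha i) (hsum N) 2
      have h4 : (C ^ 2 + (M N)⁻¹) * M N ^ 2 = (C * M N) ^ 2 + M N := by field_simp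
      linarith
  have hlim : Tendsto (fun N => (1 - √(M N) / M N) ^ 2 / (C ^ 2 + (M N)⁻¹)) atTop
      (𝓝 ((C ^ 2)⁻¹)) := by
    have h1 : Tendsto (fun N => √(M N) / M N) atTop (𝓝 0) := by
      have := (Real.tendsto_sqrt_atTop.comp hdiv).inv_tendsto_atTop
      refine this.congr fun N => ?_
      simp [Real.sqrt_div_self]
    have h2 := hdiv.inv_tendsto_atTop
    have h3 := ((tendsto_const_nhds (x := (1 : ℝ))).sub h1).pow 2
    have h4 := h3.div ((tendsto_const_nhds (x := C ^ 2)).add h2) (by positivity)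
    simpa [Pi.div_def] using h4
  have hUmeas (n : ℕ) : MeasurableSet (⋃ N ≥ n, B N) :=
    MeasurableSet.biUnion (Set.to_countable _) fun N _ => hBmeas N
  refine ⟨_, MeasurableSet.iInter hUmeas, hsub, ?_⟩
  have hmeas := tendsto_measure_iInter_atTop (μ := μ) (s := fun n => ⋃ N ≥ n, B N)
    (fun n => (hUmeas n).nullMeasurableSet)
    (fun n k hnk => Set.biUnion_subset_biUnion_left fun N hN => le_trans hnk hN)
    ⟨0, measure_ne_top _ _⟩
  have hmeas' := (ENNReal.tendsto_toReal (measure_ne_top _ _)).comp hmeas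
  refine le_of_tendsto_of_tendsto hlim hmeas' ?_
  filter_upwards [hB_le] with n hn
  exact hn.trans (measureReal_mono (Set.subset_biUnion_of_mem (u := B) (le_refl n))
    (measure_ne_top _ _))

/-- Summation by parts against an antitone weight. -/
theorem sum_mul_le_sum_mul_of_antitone {f a b : ℕ → ℝ} (hf : Antitone f) (hf0 : ∀ n, 0 ≤ f n)
    (hab : ∀ N, ∑ n ∈ Finset.range N, b n ≤ ∑ n ∈ Finset.range N, a n) (N : ℕ) :
    ∑ n ∈ Finset.range N, b n * f n ≤ ∑ n ∈ Finset.range N, a n * f n := by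
  suffices h : (∑ n ∈ Finset.range N, (a n - b n)) * f N ≤
      ∑ n ∈ Finset.range N, (a n - b n) * f n by
    have h0 : 0 ≤ (∑ n ∈ Finset.range N, (a n - b n)) * f N := by
      refine mul_nonneg ?_ (hf0 N)
      rw [Finset.sum_sub_distrib]
      exact sub_nonneg.2 (hab N)
    simp only [sub_mul, Finset.sum_sub_distrib] at h h0
    linarith
  induction N with
  | zero => simp
  | succ N ih =>
    have h0 : 0 ≤ ∑ n ∈ Finset.range (N + 1), (a n - b n) := by
      rw [Finset.sum_sub_distrib]
      exact sub_nonneg.2 (hab _)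
    refine (mul_le_mul_of_nonneg_left (hf N.le_succ) h0).trans ?_
    rw [Finset.sum_range_succ, Finset.sum_range_succ, add_mul]
    gcongr

theorem half_le_sum_totient_div (N : ℕ) :
    (N : ℝ) / 2 ≤ ∑ n ∈ Finset.range N, ((n + 1).totient : ℝ) / (n + 1 : ℕ) := by
  rcases N.eq_zero_or_pos with rfl | hN
  · simp
  have h1 : ∑ k ∈ Finset.range N, (k + 1) =
      ∑ d ∈ Finset.range N, (d + 1).totient * (N / (d + 1)) := by
    have h2 (k) (hk : k ∈ Finset.range N) : k + 1 =
        ∑ d ∈ Finset.range N, if d + 1 ∣ k + 1 then (d + 1).totient else 0 := by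
      conv_lhs => rw [← Nat.sum_totient (k + 1)]
      rw [← Finset.sum_filter]
      refine (Finset.sum_nbij (· + 1) ?_ (by simp) ?_ (by simp)).symm
      · intro d hd
        simpa using (Finset.mem_filter.1 hd).2
      · intro d hd
        simp only [Finset.mem_coe, Nat.mem_divisors] at hd
        have h3 := Nat.pos_of_dvd_of_pos hd.1 k.succ_pos
        have h4 := Nat.le_of_dvd k.succ_pos hd.1
        have h5 := Finset.mem_range.1 hk
        refine ⟨d - 1, ?_, by simp; omega⟩
        have h6 : d - 1 + 1 = d := by omega
        simp only [Finset.coe_filter, Finset.mem_range, Set.mem_ofPred_eq, h6]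
        exact ⟨by omega, hd.1⟩
    rw [Finset.sum_congr rfl h2, Finset.sum_comm]
    refine Finset.sum_congr rfl fun d _ => ?_
    rw [← Nat.card_multiples, ← Finset.sum_filter, Finset.sum_const, smul_eq_mul, mul_comm]
  have h2 : (N : ℝ) * (N + 1) / 2 = ∑ k ∈ Finset.range N, ((k : ℝ) + 1) := by
    clear h1 hN
    induction N with
    | zero => simp
    | succ N ih => rw [Finset.sum_range_succ, ← ih]; push_cast; ring
  have h3 : (N : ℝ) * (N + 1) / 2 ≤
      N * ∑ n ∈ Finset.range N, ((n + 1).totient : ℝ) / (n + 1 : ℕ) := by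
    have h4 : ∑ k ∈ Finset.range N, ((k : ℝ) + 1) =
        ∑ d ∈ Finset.range N, ((d + 1).totient : ℝ) * (N / (d + 1) : ℕ) := by
      exact_mod_cast h1
    rw [h2, h4, Finset.mul_sum]
    refine Finset.sum_le_sum fun d _ => ?_
    calc ((d + 1).totient : ℝ) * (N / (d + 1) : ℕ)
        ≤ (d + 1).totient * ((N : ℝ) / (d + 1 : ℕ)) := by gcongr; exact Nat.cast_div_le
      _ = _ := by ring
  have hN' : (0 : ℝ) < N := Nat.cast_pos.2 hN
  refine le_of_mul_le_mul_left ?_ hN'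
  linarith

theorem sum_pow_le_sum_totient (k N : ℕ) :
    ∑ n ∈ Finset.range N, (4⁻¹ : ℝ) ^ (k + 1) * ((n + 1 : ℕ) : ℝ) ^ k ≤
      ∑ n ∈ Finset.range N, ((n + 1).totient : ℝ) / (n + 1 : ℕ) * ((n + 1 : ℕ) : ℝ) ^ k := by
  have h1 : ∑ n ∈ Finset.range N, (4⁻¹ : ℝ) ^ (k + 1) * ((n + 1 : ℕ) : ℝ) ^ k ≤
      ∑ n ∈ Finset.range N, (4⁻¹ : ℝ) ^ (k + 1) * (N : ℝ) ^ k := by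
    refine Finset.sum_le_sum fun n hn => ?_
    have := Finset.mem_range.1 hn
    gcongr
    omega
  have h2 : ∑ n ∈ Finset.range N, ((((n + 1).totient : ℝ) / (n + 1 : ℕ)) -
      if n + 1 ≤ N / 4 then 1 else 0) * ((N : ℝ) / 4) ^ k ≤
      ∑ n ∈ Finset.range N, ((n + 1).totient : ℝ) / (n + 1 : ℕ) * ((n + 1 : ℕ) : ℝ) ^ k := by
    refine Finset.sum_le_sum fun n hn => ?_
    have h0 : (0 : ℝ) < (n + 1 : ℕ) := by positivity
    split_ifs with h
    · have : ((n + 1).totient : ℝ) / (n + 1 : ℕ) ≤ 1 := by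
        rw [div_le_one h0]
        exact_mod_cast Nat.totient_le _
      exact (mul_nonpos_of_nonpos_of_nonneg (by linarith) (by positivity)).trans (by positivity)
    · rw [sub_zero]
      have : (N : ℝ) / 4 ≤ (n + 1 : ℕ) := by
        rw [div_le_iff₀ (by norm_num)]
        exact_mod_cast (by omega : N ≤ (n + 1) * 4)
      gcongr
  have h3 : ∑ n ∈ Finset.range N, (if n + 1 ≤ N / 4 then (1 : ℝ) else 0) ≤ (N : ℝ) / 4 := by
    rw [← Finset.sum_filter, Finset.sum_const, nsmul_eq_mul, mul_one]
    refine le_trans ?_ (Nat.cast_div_le (m := N) (n := 4))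
    have : Finset.filter (fun n => n + 1 ≤ N / 4) (Finset.range N) ⊆ Finset.range (N / 4) := by
      intro n hn
      have := (Finset.mem_filter.1 hn).2
      exact Finset.mem_range.2 (by omega)
    exact_mod_cast (Finset.card_le_card this).trans (by simp)
  rw [← Finset.sum_mul, Finset.sum_sub_distrib] at h2
  refine h1.trans (le_trans ?_ h2)
  have h4 := half_le_sum_totient_div N
  calc ∑ n ∈ Finset.range N, (4⁻¹ : ℝ) ^ (k + 1) * (N : ℝ) ^ k
      = (N : ℝ) / 4 * ((N : ℝ) / 4) ^ k := by
        rw [Finset.sum_const, Finset.card_range, nsmul_eq_mul, div_eq_mul_inv, mul_pow]; ring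
    _ ≤ _ := by gcongr; linarith

/-- The divergence hypothesis survives truncation of `ψ` at `1`, and the insertion of the weights
`φ(n) / n`. -/
theorem tendsto_sum_totient_mul_atTop {k : ℕ} {ψ : ℕ → ℝ≥0} (hmono : Antitone ψ)
    (hdiv : ¬ Summable fun q : ℕ => (q : ℝ) ^ k * (ψ q : ℝ)) :
    Tendsto (fun N => ∑ n ∈ Finset.range N, ((n + 1).totient : ℝ) / (n + 1 : ℕ) *
      ((n + 1 : ℕ) : ℝ) ^ k * min 1 (ψ (n + 1) : ℝ)) atTop atTop := by
  have hmono' : Antitone fun n => min 1 (ψ (n + 1) : ℝ) := fun a b hab =>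
    min_le_min le_rfl (NNReal.coe_le_coe.2 (hmono (Nat.succ_le_succ hab)))
  have h0 (n : ℕ) : 0 ≤ min 1 (ψ (n + 1) : ℝ) := le_min zero_le_one (ψ (n + 1)).2
  refine tendsto_atTop_mono (sum_mul_le_sum_mul_of_antitone hmono' h0
    (sum_pow_le_sum_totient k)) ?_
  simp only [mul_assoc, ← Finset.mul_sum]
  refine Tendsto.const_mul_atTop (by positivity) ?_
  refine (not_summable_iff_tendsto_nat_atTop_of_nonneg
    fun n => mul_nonneg (by positivity) (h0 n)).1 fun hs => hdiv ?_
  refine (summable_nat_add_iff 1).1 ((summable_congr_atTop ?_).1 hs)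
  have hlim : Tendsto (fun n => min 1 (ψ (n + 1) : ℝ)) atTop (𝓝 0) :=
    squeeze_zero h0 (fun n => le_mul_of_one_le_left (h0 n)
      (one_le_pow₀ (by exact_mod_cast Nat.succ_pos n))) hs.tendsto_atTop_zero
  filter_upwards [hlim.eventually_lt_const zero_lt_one] with n hn
  rw [min_eq_right (by simpa using (min_lt_iff.1 hn).resolve_left (lt_irrefl _) |>.le)]

/-- The additive character `v ↦ ∑ i, x i • v i` of the torus. -/
noncomputable def torusChar {ι : Type*} [Fintype ι] (x : ι → ℤ) :
    (ι → UnitAddCircle) →+ UnitAddCircle :=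
  ∑ i, x i • Pi.evalAddMonoidHom (fun _ : ι => UnitAddCircle) i

theorem torusChar_apply {ι : Type*} [Fintype ι] (x : ι → ℤ) (v : ι → UnitAddCircle) :
    torusChar x v = ∑ i, x i • v i := by
  simp [torusChar]

theorem torusChar_coe {ι : Type*} [Fintype ι] (x : ι → ℤ) (v : ι → ℝ) :
    torusChar x (fun i => (v i : UnitAddCircle)) = ((∑ i, v i * x i : ℝ) : UnitAddCircle) := by
  rw [torusChar_apply, ← QuotientAddGroup.mk'_apply, map_sum]
  refine Finset.sum_congr rfl fun i _ => ?_
  rw [mul_comm, ← zsmul_eq_mul, map_zsmul]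
  rfl

theorem continuous_torusChar {ι : Type*} [Fintype ι] (x : ι → ℤ) : Continuous (torusChar x) := by
  simp only [funext (torusChar_apply x)]
  fun_prop

theorem measurePreserving_torusChar_prod {ι : Type*} [Fintype ι] {x y : ι → ℤ} {s t : ι}
    (h : x s * y t ≠ x t * y s) :
    MeasurePreserving (fun v => (torusChar x v, torusChar y v)) volume
      (volume.prod volume : Measure (UnitAddCircle × UnitAddCircle)) := by
  classical
  refine AddMonoidHom.measurePreserving (f := (torusChar x).prod (torusChar y))
    ((continuous_torusChar x).prodMk (continuous_torusChar y)) ?_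
    (by rw [volume_pi, Measure.pi_univ, ← Set.univ_prod_univ, Measure.prod_prod]; simp)
  rintro ⟨α, β⟩
  obtain ⟨α, rfl⟩ := QuotientAddGroup.mk_surjective α
  obtain ⟨β, rfl⟩ := QuotientAddGroup.mk_surjective β
  have hst : s ≠ t := by
    rintro rfl
    exact h rfl
  set D : ℝ := x s * y t - x t * y s with hD
  have hD0 : D ≠ 0 := sub_ne_zero.2 (by exact_mod_cast h)
  set v : ι → ℝ := Pi.single s ((α * y t - β * x t) / D) + Pi.single t ((β * x s - α * y s) / D)
    with hv
  have hsum (z : ι → ℤ) : ∑ i, v i * (z i : ℝ) =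
      (α * y t - β * x t) / D * z s + (β * x s - α * y s) / D * z t := by
    simp [hv, Pi.single_apply, add_mul, Finset.sum_add_distrib]
  refine ⟨fun i => (v i : UnitAddCircle), ?_⟩
  rw [AddMonoidHom.prod_apply, torusChar_coe, torusChar_coe, hsum, hsum]
  refine Prod.ext ?_ ?_
  · refine congrArg ((↑) : ℝ → UnitAddCircle) ?_
    rw [div_mul_eq_mul_div, div_mul_eq_mul_div, ← add_div, div_eq_iff hD0, hD]
    ring
  · refine congrArg ((↑) : ℝ → UnitAddCircle) ?_
    rw [div_mul_eq_mul_div, div_mul_eq_mul_div, ← add_div, div_eq_iff hD0, hD]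
    ring

theorem measurePreserving_torusChar {ι : Type*} [Fintype ι] {x : ι → ℤ} {s : ι} (h : x s ≠ 0) :
    MeasurePreserving (torusChar x) volume volume := by
  classical
  refine AddMonoidHom.measurePreserving (continuous_torusChar x) ?_
    (by rw [volume_pi, Measure.pi_univ]; simp)
  intro α
  obtain ⟨α, rfl⟩ := QuotientAddGroup.mk_surjective α
  have hx : (x s : ℝ) ≠ 0 := Int.cast_ne_zero.2 h
  refine ⟨fun i => ((Pi.single s (α / x s) : ι → ℝ) i : UnitAddCircle), ?_⟩
  rw [torusChar_coe]
  simp [Pi.single_apply, div_mul_cancel₀ _ hx]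

/-- A property holding almost everywhere on the torus holds almost everywhere on `ℝ^m`. -/
theorem ae_of_ae_torus {ι : Type*} [Fintype ι] {P : (ι → UnitAddCircle) → Prop}
    (hP : ∀ᵐ w, P w) : ∀ᵐ v : ι → ℝ, P fun i => (v i : UnitAddCircle) := by
  have hmp (c : ι → ℤ) : MeasurePreserving
      (fun (v : ι → ℝ) i => (v i : UnitAddCircle))
      (volume.restrict (Set.univ.pi fun i => Set.Ioc (c i : ℝ) (c i + 1))) volume := by
    rw [volume_pi, volume_pi, Measure.restrict_pi_pi]
    exact measurePreserving_pi _ _ fun i => UnitAddCircle.measurePreserving_mk (c i)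
  have hcover : (⋃ c : ι → ℤ, Set.univ.pi fun i => Set.Ioc (c i : ℝ) (c i + 1)) = Set.univ := by
    refine Set.eq_univ_of_forall fun v => Set.mem_iUnion.2 ⟨fun i => ⌈v i⌉ - 1, fun i _ => ?_⟩
    have h1 := Int.ceil_lt_add_one (v i)
    have h2 := Int.le_ceil (v i)
    simp only [Set.mem_Ioc]
    push_cast
    exact ⟨by linarith, by linarith⟩
  rw [← Measure.restrict_univ (μ := (volume : Measure (ι → ℝ))), ← hcover,
    ae_restrict_iUnion_iff]
  exact fun c => (hmp c).quasiMeasurePreserving.ae hP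

theorem infinite_solutions_of_torusChar {m : ℕ} {ι : Type*} {ψ : ℕ → ℝ≥0} {q : ι → Fin m → ℤ}
    (hq : Function.Injective q) {v : Fin m → ℝ} {I : Set ι} (hI : I.Infinite)
    (h : ∀ i ∈ I, ‖torusChar (q i) fun l => (v l : UnitAddCircle)‖ <
      ψ (Finset.univ.sup fun l => (q i l).natAbs)) :
    {pq : ℤ × (Fin m → ℤ) | |(pq.1 : ℝ) + ∑ l, v l * (pq.2 l : ℝ)| <
      (ψ (Finset.univ.sup fun l => (pq.2 l).natAbs) : ℝ)}.Infinite := by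
  refine (hI.image (f := fun i => (-round (∑ l, v l * (q i l : ℝ)), q i))
    fun i _ j _ hij => hq (Prod.ext_iff.1 hij).2).mono ?_
  rintro _ ⟨i, hi, rfl⟩
  have := h i hi
  rw [torusChar_coe, UnitAddCircle.norm_eq] at this
  simp only [Set.mem_ofPred_eq]
  push_cast
  rwa [neg_add_eq_sub]

instance : IsProbabilityMeasure (volume : Measure UnitAddCircle) :=
  ⟨UnitAddCircle.measure_univ⟩

theorem measureReal_closedBall_unitAddCircle {r : ℝ} (hr0 : 0 ≤ r) (hr1 : r ≤ 1)
    (x : UnitAddCircle) : volume.real (Metric.closedBall x (r / 2)) = r := by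
  rw [measureReal_def, AddCircle.volume_closedBall, mul_div_cancel₀ _ two_ne_zero, min_eq_right hr1,
    ENNReal.toReal_ofReal hr0]

/-- The integer vector with coordinates `n + 1`, `a` and `r`. -/
def coprimeVector {k : ℕ} (i : (_ : ℕ) × (ℕ × (Fin k → ℕ))) : Fin (k + 2) → ℤ :=
  Fin.cons ((i.1 + 1 : ℕ) : ℤ) (Fin.cons (i.2.1 : ℤ) fun l => (i.2.2 l : ℤ))

theorem coprimeVector_injective (k : ℕ) : Function.Injective (coprimeVector (k := k)) := by
  rintro ⟨n, a, r⟩ ⟨n', a', r'⟩ h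
  simp only [coprimeVector, Fin.cons_inj] at h
  obtain ⟨h1, h2, h3⟩ := h
  have h1 : n = n' := by omega
  have h2 : a = a' := by omega
  have h3 : r = r' := funext fun l => by exact_mod_cast congrFun h3 l
  subst h1 h2 h3
  rfl

theorem exists_minor_coprimeVector_ne {k : ℕ} {i j : (_ : ℕ) × (ℕ × (Fin k → ℕ))}
    (hi : (i.1 + 1).Coprime i.2.1) (hj : (j.1 + 1).Coprime j.2.1) (hij : i ≠ j) :
    ∃ t, coprimeVector i 0 * coprimeVector j t ≠ coprimeVector i t * coprimeVector j 0 := by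
  by_contra! h
  obtain ⟨n, a, r⟩ := i
  obtain ⟨n', a', r'⟩ := j
  simp only [coprimeVector, Fin.cons_zero] at h hi hj
  have h1 : (n + 1) * a' = a * (n' + 1) := by
    have := h 1
    rw [← Fin.succ_zero_eq_one, Fin.cons_succ, Fin.cons_succ, Fin.cons_zero, Fin.cons_zero] at this
    exact_mod_cast this
  have h2 : n + 1 ∣ n' + 1 := hi.dvd_of_dvd_mul_left (h1 ▸ Dvd.intro _ rfl)
  have h3 : n' + 1 ∣ n + 1 :=
    hj.dvd_of_dvd_mul_right (h1 ▸ Dvd.intro_left _ rfl)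
  obtain rfl : n = n' := by
    have := Nat.dvd_antisymm h2 h3
    omega
  obtain rfl : a = a' := by
    rw [mul_comm a] at h1
    exact (Nat.eq_of_mul_eq_mul_left n.succ_pos h1).symm
  refine hij ?_
  congr
  funext l
  have := h l.succ.succ
  rw [Fin.cons_succ, Fin.cons_succ, Fin.cons_succ, Fin.cons_succ, mul_comm] at this
  have h4 : r' l * (n + 1) = r l * (n + 1) := by exact_mod_cast this
  exact (Nat.eq_of_mul_eq_mul_right n.succ_pos h4).symm

theorem sup_natAbs_coprimeVector {k : ℕ} {i : (_ : ℕ) × (ℕ × (Fin k → ℕ))}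
    (ha : i.2.1 ≤ i.1) (hr : ∀ l, i.2.2 l ≤ i.1) :
    (Finset.univ.sup fun l => (coprimeVector i l).natAbs) = i.1 + 1 := by
  refine le_antisymm (Finset.sup_le fun l _ => ?_) ?_
  · refine Fin.cases ?_ (fun l => Fin.cases ?_ (fun l => ?_) l) l
    · simp only [coprimeVector, Fin.cons_zero, Int.natAbs_natCast, le_refl]
    · simp only [coprimeVector, Fin.cons_succ, Fin.cons_zero, Int.natAbs_natCast]
      omega
    · simp only [coprimeVector, Fin.cons_succ, Int.natAbs_natCast]
      have := hr l
      omega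
  · exact Finset.le_sup (f := fun l => (coprimeVector i l).natAbs) (Finset.mem_univ 0)

theorem ae_infinite_of_two_le (k : ℕ) {ψ : ℕ → ℝ≥0} (hψ : ∀ n, 0 < ψ n) (hmono : Antitone ψ)
    (hdiv : ¬ Summable fun q : ℕ => (q : ℝ) ^ (k + 1) * (ψ q : ℝ)) :
    ∀ᵐ v : Fin (k + 2) → ℝ, {pq : ℤ × (Fin (k + 2) → ℤ) |
      |(pq.1 : ℝ) + ∑ i, v i * (pq.2 i : ℝ)| <
        (ψ (Finset.univ.sup fun i => (pq.2 i).natAbs) : ℝ)}.Infinite := by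
  classical
  let G : (_ : ℕ) × (ℕ × (Fin k → ℕ)) → Prop := fun i =>
    (i.1 + 1).Coprime i.2.1 ∧ i.2.1 ≤ i.1 ∧ ∀ l, i.2.2 l ≤ i.1
  let T (N : ℕ) : Finset ((_ : ℕ) × (ℕ × (Fin k → ℕ))) := (Finset.range N).sigma fun n =>
    {a ∈ Finset.range (n + 1) | (n + 1).Coprime a} ×ˢ
      Fintype.piFinset fun _ : Fin k => Finset.range (n + 1)
  have hTG (N : ℕ) : ∀ i ∈ T N, G i := by
    intro i hi
    simp only [T, Finset.mem_sigma, Finset.mem_product, Finset.mem_filter, Finset.mem_range,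
      Fintype.mem_piFinset] at hi
    exact ⟨hi.2.1.2, Nat.lt_succ_iff.1 hi.2.1.1, fun l => Nat.lt_succ_iff.1 (hi.2.2 l)⟩
  let f (n : ℕ) : ℝ := min 1 (ψ (n + 1) : ℝ)
  have hf0 (n : ℕ) : 0 ≤ f n := le_min zero_le_one (ψ (n + 1)).2
  have hf1 (n : ℕ) : f n ≤ 1 := min_le_left _ _
  let E (i : Subtype G) : Set (Fin (k + 2) → UnitAddCircle) :=
    torusChar (coprimeVector i.1) ⁻¹' Metric.closedBall 0 (f i.1.1 / 2)
  have hE (i : Subtype G) : MeasurableSet (E i) :=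
    (continuous_torusChar _).measurable Metric.isClosed_closedBall.measurableSet
  have hE_vol (i : Subtype G) : volume.real (E i) = f i.1.1 := by
    have h0 : coprimeVector i.1 0 ≠ 0 := by
      simp only [coprimeVector, Fin.cons_zero]
      positivity
    rw [measureReal_def, (measurePreserving_torusChar h0).measure_preimage
      Metric.isClosed_closedBall.nullMeasurableSet, ← measureReal_def,
      measureReal_closedBall_unitAddCircle (hf0 _) (hf1 _)]
  have hE_pair (i j : Subtype G) (hij : i ≠ j) :
      volume.real (E i ∩ E j) ≤ volume.real (E i) * volume.real (E j) := by
    obtain ⟨t, ht⟩ := exists_minor_coprimeVector_ne i.2.1 j.2.1 fun h => hij (Subtype.ext h)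
    have h1 : E i ∩ E j = (fun v => (torusChar (coprimeVector i.1) v,
        torusChar (coprimeVector j.1) v)) ⁻¹'
        (Metric.closedBall 0 (f i.1.1 / 2) ×ˢ Metric.closedBall 0 (f j.1.1 / 2)) := rfl
    rw [hE_vol, hE_vol, h1, measureReal_def,
      (measurePreserving_torusChar_prod ht).measure_preimage
      (Metric.isClosed_closedBall.prod Metric.isClosed_closedBall).nullMeasurableSet,
      Measure.prod_prod, ENNReal.toReal_mul, ← measureReal_def, ← measureReal_def,
      measureReal_closedBall_unitAddCircle (hf0 _) (hf1 _),
      measureReal_closedBall_unitAddCircle (hf0 _) (hf1 _)]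
  have hsum (N : ℕ) : ∑ i ∈ (T N).subtype G, volume.real (E i) =
      ∑ n ∈ Finset.range N, ((n + 1).totient : ℝ) / (n + 1 : ℕ) *
        ((n + 1 : ℕ) : ℝ) ^ (k + 1) * f n := by
    simp only [hE_vol]
    rw [Finset.sum_subtype_of_mem (fun i => f i.1) (hTG N), Finset.sum_sigma]
    refine Finset.sum_congr rfl fun n _ => ?_
    have : ((n + 1 : ℕ) : ℝ) ≠ 0 := by positivity
    rw [Finset.sum_const (f n), Finset.card_product, Fintype.card_piFinset_const, Finset.card_range,
      ← Nat.totient_eq_card_coprime, nsmul_eq_mul, pow_succ']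
    push_cast at this ⊢
    field_simp
  have hdiv' : Tendsto (fun N => ∑ i ∈ (T N).subtype G, volume.real (E i)) atTop atTop := by
    simp only [hsum]
    exact tendsto_sum_totient_mul_atTop hmono hdiv
  obtain ⟨A, hA, hAE, hA1⟩ := exists_measurableSet_subset_infinite volume hE
    (fun _ => measureReal_nonneg) one_pos hdiv' hE_pair fun N => (one_mul _).ge
  have hae : ∀ᵐ w : Fin (k + 2) → UnitAddCircle, {i | w ∈ E i}.Infinite := by
    refine mem_of_superset ((mem_ae_iff_prob_eq_one hA).2 (le_antisymm prob_le_one ?_)) hAE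
    rw [one_pow, inv_one, measureReal_def] at hA1
    rw [← ENNReal.ofReal_one, ← ENNReal.ofReal_toReal (measure_ne_top volume A)]
    exact ENNReal.ofReal_le_ofReal hA1
  filter_upwards [ae_of_ae_torus hae] with v hv
  refine infinite_solutions_of_torusChar (q := fun i : Subtype G => coprimeVector i.1)
    ((coprimeVector_injective k).comp Subtype.val_injective) hv fun i hi => ?_
  rw [sup_natAbs_coprimeVector i.2.2.1 i.2.2.2]
  refine lt_of_le_of_lt (mem_closedBall_zero_iff.1 hi) ?_
  have h1 : f i.1.1 ≤ ψ (i.1.1 + 1) := min_le_right _ _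
  have h2 : 0 < (ψ (i.1.1 + 1) : ℝ) := hψ _
  linarith

/-- The points of exact order `n` in the circle. -/
noncomputable def pointsOfOrder (n : ℕ) : Finset UnitAddCircle :=
  if hn : 0 < n then (AddCircle.finite_setOfPred_addOrderOf_eq (1 : ℝ) hn).toFinset else ∅

theorem mem_pointsOfOrder {n : ℕ} (hn : 0 < n) {u : UnitAddCircle} :
    u ∈ pointsOfOrder n ↔ addOrderOf u = n := by
  simp [pointsOfOrder, hn]

theorem nsmul_eq_zero_of_mem_pointsOfOrder {n l : ℕ} (hn : 0 < n) (hl : n ∣ l) {u : UnitAddCircle}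
    (hu : u ∈ pointsOfOrder n) : l • u = 0 :=
  addOrderOf_dvd_iff_nsmul_eq_zero.1 ((mem_pointsOfOrder hn).1 hu ▸ hl)

theorem card_pointsOfOrder {n : ℕ} (hn : 0 < n) : (pointsOfOrder n).card = n.totient := by
  rw [← AddCircle.card_addOrderOf_eq_totient (1 : ℝ), pointsOfOrder, dif_pos hn]
  exact (Nat.card_eq_card_finite_toFinset _).symm

theorem card_le_of_forall_nsmul_eq_zero {d : ℕ} (hd : 0 < d) {C : Finset UnitAddCircle}
    (hC : ∀ c ∈ C, d • c = 0) : C.card ≤ d := by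
  have h := AddCircle.card_torsion_le_of_isSMulRegular (1 : ℝ) d hd.ne'
    (.of_right_eq_zero_of_smul fun _ ↦ by simp [hd.ne'])
  have h' := (Set.encard_le_encard (s := (C : Set UnitAddCircle)) hC).trans h
  rw [Set.encard_coe_eq_coe_finsetCard] at h'
  exact_mod_cast h'

theorem card_le_two_mul_of_norm_le {l : ℕ} (hl : 0 < l) {ρ : ℝ} (hρ : 0 ≤ ρ)
    {C : Finset UnitAddCircle} (hC : ∀ c ∈ C, l • c = 0 ∧ c ≠ 0 ∧ ‖c‖ ≤ ρ) :
    (C.card : ℝ) ≤ 2 * (l * ρ) := by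
  classical
  have hl' : (0 : ℝ) < l := by exact_mod_cast hl
  set K : ℤ := ⌊l * ρ⌋ with hK
  have hK0 : 0 ≤ K := Int.floor_nonneg.2 (by positivity)
  have hsub : C ⊆ ((Finset.Icc (-K) K).erase 0).image
      fun j : ℤ => ((j / l : ℝ) : UnitAddCircle) := by
    intro c hc
    obtain ⟨h1, h2, h3⟩ := hC c hc
    obtain ⟨y, rfl⟩ := QuotientAddGroup.mk_surjective c
    change l • (y : UnitAddCircle) = 0 at h1
    change ‖(y : UnitAddCircle)‖ ≤ ρ at h3
    rw [UnitAddCircle.norm_eq] at h3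
    rw [← AddCircle.coe_nsmul, AddCircle.coe_eq_zero_iff] at h1
    obtain ⟨j, hj⟩ := h1
    rw [zsmul_one, nsmul_eq_mul] at hj
    have hy : ((y - round y : ℝ) : UnitAddCircle) = y := by
      rw [AddCircle.coe_sub, sub_eq_self, AddCircle.coe_eq_zero_iff]
      exact ⟨round y, by simp⟩
    have hj' : ((j - l * round y : ℤ) : ℝ) = l * (y - round y) := by
      push_cast
      rw [hj]
      ring
    have hjy : ((j - l * round y : ℤ) : ℝ) / l = y - round y := by
      rw [hj', mul_div_cancel_left₀ _ hl'.ne']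
    refine Finset.mem_image.2 ⟨j - l * round y, Finset.mem_erase.2 ⟨fun h => h2 ?_, ?_⟩, ?_⟩
    · rw [h, Int.cast_zero, zero_div] at hjy
      change (y : UnitAddCircle) = 0
      rw [← hy, ← hjy, AddCircle.coe_zero]
    · rw [Finset.mem_Icc, ← abs_le, hK, Int.le_floor, Int.cast_abs, hj', abs_mul, abs_of_pos hl']
      gcongr
    · simp only [hjy]
      exact hy
  have h1 := (Finset.card_le_card hsub).trans Finset.card_image_le
  rw [Finset.card_erase_of_mem (Finset.mem_Icc.2 ⟨by omega, hK0⟩), Int.card_Icc] at h1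
  have h2 : (C.card : ℤ) ≤ 2 * K := by omega
  have h3 : (C.card : ℝ) ≤ 2 * K := by exact_mod_cast h2
  linarith [Int.floor_le (l * ρ)]

theorem card_close_pairs_le {n k : ℕ} (hn : 0 < n) (hk : 0 < k) (hnk : n ≠ k) {ρ : ℝ}
    (hρ : 0 ≤ ρ) :
    (((pointsOfOrder n ×ˢ pointsOfOrder k).filter fun p => dist p.1 p.2 ≤ ρ).card : ℝ) ≤
      2 * (n * k * ρ) := by
  classical
  set P := (pointsOfOrder n ×ˢ pointsOfOrder k).filter fun p => dist p.1 p.2 ≤ ρ with hP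
  have hPmem {p} (hp : p ∈ P) : (p.1 ∈ pointsOfOrder n ∧ p.2 ∈ pointsOfOrder k) ∧
      dist p.1 p.2 ≤ ρ := by
    simpa [hP] using hp
  have hgcd : 0 < n.gcd k := Nat.gcd_pos_of_pos_left _ hn
  have hfib : P.card ≤ n.gcd k * (P.image fun p => p.1 - p.2).card := by
    refine Finset.card_le_mul_card_image P _ fun c hc => ?_
    obtain ⟨p₀, hp₀, hc⟩ := Finset.mem_image.1 hc
    have hinj : Set.InjOn (fun p : UnitAddCircle × UnitAddCircle => p.1 - p₀.1)
        (P.filter fun p => p.1 - p.2 = c) := by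
      intro p hp q hq h
      have hp := (Finset.mem_filter.1 hp).2
      have hq := (Finset.mem_filter.1 hq).2
      have h1 : p.1 = q.1 := sub_left_injective h
      refine Prod.ext h1 ?_
      rw [h1, ← hq] at hp
      exact sub_right_injective hp
    rw [← Finset.card_image_of_injOn hinj]
    refine card_le_of_forall_nsmul_eq_zero hgcd fun x hx => ?_
    obtain ⟨p, hp, rfl⟩ := Finset.mem_image.1 hx
    obtain ⟨hp, hpc⟩ := Finset.mem_filter.1 hp
    have h1 : p.1 - p₀.1 = p.2 - p₀.2 := by
      rw [sub_eq_sub_iff_sub_eq_sub, hpc, hc]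
    refine addOrderOf_dvd_iff_nsmul_eq_zero.1 (Nat.dvd_gcd ?_ ?_)
    · rw [addOrderOf_dvd_iff_nsmul_eq_zero, smul_sub,
        nsmul_eq_zero_of_mem_pointsOfOrder hn dvd_rfl (hPmem hp).1.1,
        nsmul_eq_zero_of_mem_pointsOfOrder hn dvd_rfl (hPmem hp₀).1.1, sub_zero]
    · rw [h1, addOrderOf_dvd_iff_nsmul_eq_zero, smul_sub,
        nsmul_eq_zero_of_mem_pointsOfOrder hk dvd_rfl (hPmem hp).1.2,
        nsmul_eq_zero_of_mem_pointsOfOrder hk dvd_rfl (hPmem hp₀).1.2, sub_zero]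
  have himg : ((P.image fun p => p.1 - p.2).card : ℝ) ≤ 2 * (n.lcm k * ρ) := by
    refine card_le_two_mul_of_norm_le (Nat.lcm_pos hn hk) hρ fun c hc => ?_
    obtain ⟨p, hp, rfl⟩ := Finset.mem_image.1 hc
    obtain ⟨⟨h1, h2⟩, h3⟩ := hPmem hp
    refine ⟨?_, fun h => hnk ?_, by rwa [← dist_eq_norm]⟩
    · rw [smul_sub, nsmul_eq_zero_of_mem_pointsOfOrder hn (Nat.dvd_lcm_left n k) h1,
        nsmul_eq_zero_of_mem_pointsOfOrder hk (Nat.dvd_lcm_right n k) h2, sub_zero]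
    · rw [← (mem_pointsOfOrder hn).1 h1, ← (mem_pointsOfOrder hk).1 h2, sub_eq_zero.1 h]
  calc (P.card : ℝ) ≤ n.gcd k * (P.image fun p => p.1 - p.2).card := by exact_mod_cast hfib
    _ ≤ n.gcd k * (2 * (n.lcm k * ρ)) := by gcongr
    _ = 2 * ((n.gcd k * n.lcm k : ℕ) * ρ) := by push_cast; ring
    _ = 2 * (n * k * ρ) := by rw [Nat.gcd_mul_lcm]; push_cast; ring

/-- The `r`-neighbourhood of the points of order `n`. -/
def orderNhd (n : ℕ) (r : ℝ) : Set UnitAddCircle :=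
  ⋃ u ∈ pointsOfOrder n, Metric.closedBall u r

theorem measurableSet_orderNhd (n : ℕ) (r : ℝ) : MeasurableSet (orderNhd n r) :=
  Finset.measurableSet_biUnion _ fun _ _ => Metric.isClosed_closedBall.measurableSet

theorem measureReal_closedBall_unitAddCircle_le {r : ℝ} (hr : 0 ≤ r) (x : UnitAddCircle) :
    volume.real (Metric.closedBall x r) ≤ 2 * r := by
  rw [measureReal_def, AddCircle.volume_closedBall, ENNReal.toReal_ofReal (by positivity)]
  exact min_le_right _ _

theorem measureReal_orderNhd_inter_le {n k : ℕ} (hn : 0 < n) (hk : 0 < k) (hnk : n ≠ k) {r s : ℝ}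
    (hr : 0 ≤ r) (hs : 0 ≤ s) :
    volume.real (orderNhd n r ∩ orderNhd k s) ≤ 8 * (n * k * (r * s)) := by
  classical
  set P := (pointsOfOrder n ×ˢ pointsOfOrder k).filter fun p => dist p.1 p.2 ≤ r + s with hP
  have hsub : orderNhd n r ∩ orderNhd k s ⊆
      ⋃ p ∈ P, Metric.closedBall p.1 r ∩ Metric.closedBall p.2 s := by
    rintro x ⟨h1, h2⟩
    simp only [orderNhd, Set.mem_iUnion₂] at h1 h2
    obtain ⟨u, hu, hxu⟩ := h1
    obtain ⟨v, hv, hxv⟩ := h2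
    have : dist u v ≤ r + s := by
      have := dist_triangle_left u v x
      have := Metric.mem_closedBall.1 hxu
      have := Metric.mem_closedBall.1 hxv
      linarith
    exact Set.mem_iUnion₂.2 ⟨(u, v), by simp [hP, hu, hv, this], hxu, hxv⟩
  have hball (p : UnitAddCircle × UnitAddCircle) :
      volume.real (Metric.closedBall p.1 r ∩ Metric.closedBall p.2 s) ≤ 2 * min r s := by
    rw [mul_min_of_nonneg _ _ zero_le_two]
    exact le_min
      ((measureReal_mono Set.inter_subset_left).trans
        (measureReal_closedBall_unitAddCircle_le hr _))
      ((measureReal_mono Set.inter_subset_right).trans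
        (measureReal_closedBall_unitAddCircle_le hs _))
  have hmin : (r + s) * min r s ≤ 2 * (r * s) := by
    rcases le_total r s with h | h
    · rw [min_eq_left h]; nlinarith
    · rw [min_eq_right h]; nlinarith
  calc volume.real (orderNhd n r ∩ orderNhd k s)
      ≤ ∑ p ∈ P, volume.real (Metric.closedBall p.1 r ∩ Metric.closedBall p.2 s) :=
        (measureReal_mono hsub (measure_ne_top _ _)).trans (measureReal_biUnion_finset_le _ _)
    _ ≤ P.card * (2 * min r s) := by
        rw [← nsmul_eq_mul]
        exact Finset.sum_le_card_nsmul _ _ _ fun p _ => hball p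
    _ ≤ 2 * (n * k * (r + s)) * (2 * min r s) := by
        have := le_min hr hs
        gcongr
        exact card_close_pairs_le hn hk hnk (add_nonneg hr hs)
    _ = 4 * (n * k) * ((r + s) * min r s) := by ring
    _ ≤ 4 * (n * k) * (2 * (r * s)) := by gcongr
    _ = 8 * (n * k * (r * s)) := by ring

theorem measureReal_orderNhd {n : ℕ} (hn : 0 < n) {r : ℝ} (hr : 0 ≤ r) (hr' : 2 * (n * r) < 1) :
    volume.real (orderNhd n r) = n.totient * (2 * r) := by
  have hn' : (1 : ℝ) ≤ n := by exact_mod_cast hn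
  have hdisj : (pointsOfOrder n : Set UnitAddCircle).PairwiseDisjoint
      fun u => Metric.closedBall u r := by
    intro u hu v hv huv
    refine Metric.closedBall_disjoint_closedBall ?_
    have h0 : n • (u - v) = 0 := by
      rw [smul_sub, nsmul_eq_zero_of_mem_pointsOfOrder hn dvd_rfl hu,
        nsmul_eq_zero_of_mem_pointsOfOrder hn dvd_rfl hv, sub_zero]
    have h1 := AddCircle.le_add_order_smul_norm_of_isOfFinAddOrder
      (isOfFinAddOrder_iff_nsmul_eq_zero.2 ⟨n, hn, h0⟩) (sub_ne_zero.2 huv)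
    have h2 : (addOrderOf (u - v) : ℝ) ≤ n := by
      exact_mod_cast Nat.le_of_dvd hn (addOrderOf_dvd_of_nsmul_eq_zero h0)
    rw [nsmul_eq_mul, ← dist_eq_norm] at h1
    have h3 := h1.trans (mul_le_mul_of_nonneg_right h2 dist_nonneg)
    by_contra! h
    have := mul_le_mul_of_nonneg_left h (zero_le_one.trans hn')
    linarith
  have hr1 : 2 * r ≤ 1 := by nlinarith
  rw [orderNhd, measureReal_biUnion_finset hdisj
    fun _ _ => Metric.isClosed_closedBall.measurableSet]
  have (u : UnitAddCircle) : volume.real (Metric.closedBall u r) = 2 * r := by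
    rw [measureReal_def, AddCircle.volume_closedBall, min_eq_right hr1,
      ENNReal.toReal_ofReal (by positivity)]
  simp only [this]
  rw [Finset.sum_const, card_pointsOfOrder hn, nsmul_eq_mul]

theorem mem_addWellApproximable_iff_infinite {δ : ℕ → ℝ} {x : UnitAddCircle} :
    x ∈ addWellApproximable UnitAddCircle δ ↔
      {n | 0 < n ∧ x ∈ approxAddOrderOf UnitAddCircle n (δ n)}.Infinite := by
  simp only [mem_add_wellApproximable_iff, ← Nat.cofinite_eq_atTop, cofinite.blimsup_set_eq,
    Set.mem_ofPred_eq]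

theorem ae_mem_addWellApproximable {ψ : ℕ → ℝ≥0} (hψ : ∀ n, 0 < ψ n) (hmono : Antitone ψ)
    (hdiv : ¬ Summable fun q : ℕ => (ψ q : ℝ)) :
    ∀ᵐ x : UnitAddCircle, x ∈ addWellApproximable UnitAddCircle
      fun n => min 1 (ψ n : ℝ) / (2 * n) := by
  classical
  let f (n : ℕ) : ℝ := min 1 (ψ (n + 1) : ℝ)
  have hf0 (n : ℕ) : 0 < f n := lt_min zero_lt_one (hψ (n + 1))
  have hf1 (n : ℕ) : f n ≤ 1 := min_le_left _ _
  have hfmono : Antitone f := fun a b h =>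
    min_le_min_left _ (NNReal.coe_le_coe.2 (hmono (Nat.succ_le_succ h)))
  let E (n : ℕ) : Set UnitAddCircle := orderNhd (n + 1) (f n / (4 * (n + 1 : ℕ)))
  have hr (n : ℕ) : 0 ≤ f n / (4 * (n + 1 : ℕ)) := div_nonneg (hf0 n).le (by positivity)
  have hE_vol (n : ℕ) :
      volume.real (E n) = ((n + 1).totient : ℝ) / (n + 1 : ℕ) * f n / 2 := by
    have hn : ((n + 1 : ℕ) : ℝ) ≠ 0 := by positivity
    rw [measureReal_orderNhd n.succ_pos (hr n)]
    · field_simp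
      ring
    · have : 2 * ((n + 1 : ℕ) * (f n / (4 * (n + 1 : ℕ)))) = f n / 2 := by
        field_simp
        ring
      rw [this]
      linarith [hf1 n]
  have hE_pair (n k : ℕ) (hnk : n ≠ k) : volume.real (E n ∩ E k) ≤ f n * f k := by
    refine (measureReal_orderNhd_inter_le n.succ_pos k.succ_pos (by omega) (hr n) (hr k)).trans ?_
    have hn : ((n + 1 : ℕ) : ℝ) ≠ 0 := by positivity
    have hk : ((k + 1 : ℕ) : ℝ) ≠ 0 := by positivity
    have : 8 * (((n + 1 : ℕ) : ℝ) * (k + 1 : ℕ) *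
        (f n / (4 * (n + 1 : ℕ)) * (f k / (4 * (k + 1 : ℕ))))) = f n * f k / 2 := by
      field_simp
      ring
    rw [this]
    exact half_le_self (mul_pos (hf0 n) (hf0 k)).le
  have hdiv' : Tendsto (fun N => ∑ n ∈ Finset.range N, volume.real (E n)) atTop atTop := by
    have := tendsto_sum_totient_mul_atTop (k := 0) hmono (by simpa using hdiv)
    simp only [hE_vol, ← Finset.sum_div]
    simp only [pow_zero, mul_one] at this
    exact this.atTop_div_const two_pos
  have hsum (N : ℕ) : ∑ n ∈ Finset.range N, f n ≤ 4 * ∑ n ∈ Finset.range N, volume.real (E n) := by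
    have := sum_mul_le_sum_mul_of_antitone hfmono (fun n => (hf0 n).le) (b := fun _ => (1 / 2 : ℝ))
      (a := fun n => ((n + 1).totient : ℝ) / (n + 1 : ℕ))
      (fun N => by simpa [div_eq_mul_inv] using half_le_sum_totient_div N) N
    simp only [hE_vol, ← Finset.sum_div]
    rw [← Finset.mul_sum] at this
    linarith
  obtain ⟨A, -, hAE, hA1⟩ := exists_measurableSet_subset_infinite volume
    (fun n => measurableSet_orderNhd _ _) (fun n => (hf0 n).le) four_pos hdiv' hE_pair hsum
  have hδ : Tendsto (fun n : ℕ => min 1 (ψ n : ℝ) / (2 * n)) atTop (𝓝 0) := by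
    refine squeeze_zero (fun n => by positivity) (fun n => ?_)
      (tendsto_one_div_atTop_nhds_zero_nat (𝕜 := ℝ))
    rcases n.eq_zero_or_pos with rfl | hn
    · simp
    · have : (0 : ℝ) < n := by exact_mod_cast hn
      exact div_le_div₀ zero_le_one (min_le_left _ _) this (by linarith)
  refine (AddCircle.addWellApproximable_ae_empty_or_univ _ hδ).resolve_left fun h => ?_
  have hA0 : volume A = 0 := by
    refine measure_mono_null (fun x hx => ?_) (ae_iff.1 h)
    rw [Set.mem_ofPred_eq, not_not, mem_addWellApproximable_iff_infinite]
    refine ((hAE hx).image Nat.succ_injective.injOn).mono ?_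
    rintro _ ⟨n, hn, rfl⟩
    refine ⟨n.succ_pos, mem_approx_add_orderOf_iff.2 ?_⟩
    obtain ⟨u, hu, hxu⟩ := Set.mem_iUnion₂.1 hn
    refine ⟨u, (mem_pointsOfOrder n.succ_pos).1 hu, Metric.closedBall_subset_ball ?_ hxu⟩
    exact div_lt_div_of_pos_left (hf0 n) (by positivity) (by gcongr; norm_num)
  rw [measureReal_def, hA0] at hA1
  norm_num at hA1

theorem ae_infinite_one {ψ : ℕ → ℝ≥0} (hψ : ∀ n, 0 < ψ n) (hmono : Antitone ψ)
    (hdiv : ¬ Summable fun q : ℕ => (ψ q : ℝ)) :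
    ∀ᵐ v : Fin 1 → ℝ, {pq : ℤ × (Fin 1 → ℤ) |
      |(pq.1 : ℝ) + ∑ i, v i * (pq.2 i : ℝ)| <
        (ψ (Finset.univ.sup fun i => (pq.2 i).natAbs) : ℝ)}.Infinite := by
  have hae := (measurePreserving_eval (fun _ : Fin 1 => (volume : Measure UnitAddCircle))
    0).quasiMeasurePreserving.ae (ae_mem_addWellApproximable hψ hmono hdiv)
  filter_upwards [ae_of_ae_torus hae] with v hv
  have hq : Function.Injective fun (n : ℕ) (_ : Fin 1) => (n : ℤ) := fun a b h => by
    simpa using congrFun h 0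
  refine infinite_solutions_of_torusChar hq (mem_addWellApproximable_iff_infinite.1 hv) ?_
  rintro n ⟨hn, hx⟩
  obtain ⟨b, hb, hxb⟩ := mem_approx_add_orderOf_iff.1 hx
  have hn' : (0 : ℝ) < n := by exact_mod_cast hn
  have hnb : n • b = 0 := by rw [← hb, addOrderOf_nsmul_eq_zero]
  rw [Metric.mem_ball, dist_eq_norm, Function.eval] at hxb
  have h1 : torusChar (fun _ : Fin 1 => (n : ℤ)) (fun l => (v l : UnitAddCircle)) =
      n • ((v 0 : UnitAddCircle) - b) := by
    rw [torusChar_apply, Fin.sum_univ_one, natCast_zsmul, smul_sub, hnb, sub_zero]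
  have h2 : (Finset.univ.sup fun _ : Fin 1 => (n : ℤ).natAbs) = n := by simp
  rw [h1, h2]
  calc ‖n • ((v 0 : UnitAddCircle) - b)‖ ≤ n * ‖(v 0 : UnitAddCircle) - b‖ := norm_nsmul_le
    _ < n * (min 1 (ψ n : ℝ) / (2 * n)) := by gcongr
    _ = min 1 (ψ n : ℝ) / 2 := by field_simp
    _ ≤ ψ n / 2 := by gcongr; exact min_le_right _ _
    _ < ψ n := half_lt_self (hψ n)

theorem pos_of_antitone_of_not_summable {ψ : ℕ → ℝ≥0} (hmono : Antitone ψ) {k : ℕ}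
    (hdiv : ¬ Summable fun q : ℕ => (q : ℝ) ^ k * (ψ q : ℝ)) (n : ℕ) : 0 < ψ n := by
  by_contra h
  have h0 : ψ n = 0 := nonpos_iff_eq_zero.1 (not_lt.1 h)
  refine hdiv (summable_of_ne_finset_zero (s := Finset.range n) fun q hq => ?_)
  have : ψ q = 0 := nonpos_iff_eq_zero.1 (h0 ▸ hmono (not_lt.1 (mt Finset.mem_range.2 hq)))
  rw [this, NNReal.coe_zero, mul_zero]

end

/-- Divergence part of the Khintchine–Groshev theorem: if `ψ` is
monotonically decreasing and `∑ q^(m-1) ψ(q) = ∞`, then the set of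
`v ∈ ℝ^m` for which `|p + v·q| < ψ(‖q‖_∞)` has infinitely many integer
solutions `(p, q)` has full Lebesgue measure, i.e. its complement is null. -/
theorem khintchine_groshev_divergence (m : ℕ) (hm : 1 ≤ m) (ψ : ℕ → ℝ≥0)
    (hmono : Antitone ψ)
    (hdiv : ¬ Summable fun q : ℕ => (q : ℝ) ^ (m - 1) * (ψ q : ℝ)) :
    volume {v : Fin m → ℝ |
      {pq : ℤ × (Fin m → ℤ) |
        |(pq.1 : ℝ) + ∑ i, v i * (pq.2 i : ℝ)| <
          (ψ (Finset.univ.sup fun i => (pq.2 i).natAbs) : ℝ)}.Infinite}ᶜ = 0 := by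
  have hψ := pos_of_antitone_of_not_summable hmono hdiv
  rw [← mem_ae_iff]
  match m, hm with
  | 1, _ => exact ae_infinite_one hψ hmono (by simpa using hdiv)
  | k + 2, _ => exact ae_infinite_of_two_le k hψ hmono hdiv
end

section
/- Let m ≥ 1 be an integer and let ψ : ℕ → ℝ be a strictly positive function with ∑_{q=1}^∞ q^{m-1} ψ(q) < ∞. Then for Lebesgue-almost every v ∈ ℝ^m there exists a constant κ > 0 such that |p + v₁q₁ + ⋯ + v_m q_m| > κ ψ(max_i |q_i|) holds for every p ∈ ℤ and every nonzero q = (q₁,…,q_m) ∈ ℤ^m. -/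
open MeasureTheory

/-- The homomorphism `x ↦ ∑ i, q i • x i` from the torus to the circle. -/
def UnitAddTorus.zsmulSum {m : ℕ} (q : Fin m → ℤ) : UnitAddTorus (Fin m) →+ UnitAddCircle where
  toFun x := ∑ i, q i • x i
  map_zero' := by simp
  map_add' x y := by simp [Finset.sum_add_distrib]

theorem UnitAddTorus.zsmulSum_apply {m : ℕ} (q : Fin m → ℤ) (x : UnitAddTorus (Fin m)) :
    zsmulSum q x = ∑ i, q i • x i := rfl

theorem UnitAddTorus.zsmulSum_surjective {m : ℕ} {q : Fin m → ℤ} (hq : q ≠ 0) :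
    Function.Surjective (zsmulSum q) := by
  classical
  obtain ⟨j, hj⟩ := Function.ne_iff.mp hq
  intro y
  refine ⟨Pi.single j (DivisibleBy.div y (q j)), ?_⟩
  rw [zsmulSum_apply, Finset.sum_eq_single j]
  · rw [Pi.single_eq_same]
    exact DivisibleBy.div_cancel y hj
  · intro i _ hi
    rw [Pi.single_eq_of_ne hi, smul_zero]
  · simp

theorem UnitAddTorus.measurePreserving_zsmulSum {m : ℕ} {q : Fin m → ℤ} (hq : q ≠ 0) :
    MeasurePreserving (zsmulSum q) (volume : Measure (Fin m → UnitAddCircle)) volume := by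
  refine AddMonoidHom.measurePreserving (f := zsmulSum q) ?_ (zsmulSum_surjective hq) ?_
  · change Continuous fun x : Fin m → UnitAddCircle => ∑ i, q i • x i
    fun_prop
  · simp [volume_pi, Measure.pi_univ]

/-- A property holding almost everywhere on the torus pulls back to one holding almost everywhere
on the Euclidean space. -/
theorem UnitAddTorus.ae_coe {m : ℕ} {P : (Fin m → UnitAddCircle) → Prop}
    (h : ∀ᵐ x : Fin m → UnitAddCircle, P x) :
    ∀ᵐ v : Fin m → ℝ, P fun i => (v i : UnitAddCircle) := by
  have hcover : (⋃ a : Fin m → ℤ, Set.univ.pi fun i => Set.Ioc (a i : ℝ) (a i + 1)) =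
      Set.univ := by
    refine Set.eq_univ_of_forall fun v => Set.mem_iUnion.mpr ⟨fun i => ⌈v i⌉ - 1, ?_⟩
    intro i _
    have h1 := Int.ceil_lt_add_one (v i)
    have h2 := Int.le_ceil (v i)
    push_cast
    constructor <;> linarith
  rw [← Measure.restrict_univ (μ := (volume : Measure (Fin m → ℝ))), ← hcover,
    ae_restrict_iUnion_iff]
  intro a
  rw [volume_pi, Measure.restrict_pi_pi]
  exact (measurePreserving_pi _ _ fun i =>
    UnitAddCircle.measurePreserving_mk (a i : ℝ)).quasiMeasurePreserving.ae h

/-- A bound for the number of integer vectors of sup norm `h`. -/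
theorem encard_natAbs_sup_fiber_le (m h : ℕ) (hm : 1 ≤ m) :
    ((fun q : Fin m → ℤ => Finset.univ.sup fun i => (q i).natAbs) ⁻¹' {h}).encard ≤
      ((m * (2 * (2 * h + 1) ^ (m - 1)) : ℕ) : ℕ∞) := by
  classical
  let F : Fin m → Finset (Fin m → ℤ) := fun j =>
    Fintype.piFinset (Function.update (fun _ => Finset.Icc (-h : ℤ) h) j {(h : ℤ), -(h : ℤ)})
  have hF : ∀ j ∈ Finset.univ, (F j).card ≤ 2 * (2 * h + 1) ^ (m - 1) := by
    intro j _
    have hIcc : (Finset.Icc (-h : ℤ) h).card = 2 * h + 1 := by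
      rw [Int.card_Icc]; omega
    have hupd : ∀ i, (Function.update (fun _ => Finset.Icc (-h : ℤ) h) j {(h : ℤ), -(h : ℤ)} i).card =
        Function.update (fun _ : Fin m => 2 * h + 1) j (Finset.card {(h : ℤ), -(h : ℤ)}) i := by
      intro i
      obtain rfl | hi := eq_or_ne i j
      · simp
      · simp only [Function.update_of_ne hi, hIcc]
    rw [Fintype.card_piFinset, Finset.prod_congr rfl fun i _ => hupd i,
      Finset.prod_update_of_mem (Finset.mem_univ j), Finset.prod_const,
      Finset.card_sdiff_of_subset (Finset.subset_univ _), Finset.card_univ, Fintype.card_fin,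
      Finset.card_singleton]
    exact Nat.mul_le_mul_right _ Finset.card_le_two
  have hsub : ((fun q : Fin m → ℤ => Finset.univ.sup fun i => (q i).natAbs) ⁻¹' {h}) ⊆
      ((Finset.univ.biUnion F : Finset _) : Set (Fin m → ℤ)) := by
    intro q hq
    have hq : (Finset.univ.sup fun i => (q i).natAbs) = h := hq
    have hle : ∀ i, (q i).natAbs ≤ h := fun i =>
      hq ▸ Finset.le_sup (f := fun i => (q i).natAbs) (Finset.mem_univ i)
    obtain ⟨j, -, hj⟩ := Finset.exists_mem_eq_sup Finset.univ
      ⟨⟨0, hm⟩, Finset.mem_univ _⟩ fun i => (q i).natAbs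
    rw [hq] at hj
    simp only [Finset.coe_biUnion, Set.mem_iUnion, Finset.mem_coe, Finset.mem_univ, F,
      Fintype.mem_piFinset]
    refine ⟨j, trivial, fun i => ?_⟩
    obtain rfl | hi := eq_or_ne i j
    · simp only [Function.update_self, Finset.mem_insert, Finset.mem_singleton]
      omega
    · have := hle i
      simp only [Function.update_of_ne hi, Finset.mem_Icc]
      omega
  refine (Set.encard_le_encard hsub).trans ?_
  rw [Set.encard_coe_eq_coe_finsetCard]
  have := Finset.card_biUnion_le_card_mul Finset.univ F _ hF
  rw [Finset.card_univ, Fintype.card_fin] at this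
  exact_mod_cast this

theorem summable_two_mul_add_one_pow_mul {k : ℕ} {ψ : ℕ → ℝ} (hpos : ∀ q, 0 < ψ q)
    (hconv : Summable fun q : ℕ => (q : ℝ) ^ k * ψ q) :
    Summable fun q : ℕ => (2 * (q : ℝ) + 1) ^ k * ψ q := by
  refine (hconv.mul_left (3 ^ k)).of_norm_bounded_eventually_nat ?_
  filter_upwards [Filter.eventually_ge_atTop 1] with q hq
  have hq : (1 : ℝ) ≤ q := by exact_mod_cast hq
  have := (hpos q).le
  rw [Real.norm_of_nonneg (by positivity), ← mul_assoc, ← mul_pow]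
  gcongr
  linarith

theorem tsum_ofReal_natAbs_sup_ne_top (m : ℕ) (hm : 1 ≤ m) {ψ : ℕ → ℝ} (hpos : ∀ q, 0 < ψ q)
    (hconv : Summable fun q : ℕ => (q : ℝ) ^ (m - 1) * ψ q) :
    ∑' q : Fin m → ℤ, ENNReal.ofReal (2 * ψ (Finset.univ.sup fun i => (q i).natAbs)) ≠ ⊤ := by
  have hsum := (summable_two_mul_add_one_pow_mul hpos hconv).mul_left (4 * (m : ℝ))
  rw [← ENNReal.tsum_fiberwise _
    fun q : Fin m → ℤ => Finset.univ.sup fun i => (q i).natAbs]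
  refine ne_top_of_le_ne_top hsum.tsum_ofReal_ne_top (ENNReal.tsum_le_tsum fun h => ?_)
  calc _ = ∑' _ : ((fun q : Fin m → ℤ => Finset.univ.sup fun i => (q i).natAbs) ⁻¹' {h}),
        ENNReal.ofReal (2 * ψ h) :=
        tsum_congr fun b => by
          rw [show (Finset.univ.sup fun i => (b.1 i).natAbs) = h from b.2]
    _ ≤ ((m * (2 * (2 * h + 1) ^ (m - 1)) : ℕ) : ENNReal) * ENNReal.ofReal (2 * ψ h) := by
        rw [ENNReal.tsum_const]
        gcongr
        exact_mod_cast ENat.toENNReal_mono (encard_natAbs_sup_fiber_le m h hm)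
    _ = _ := by
        rw [← ENNReal.ofReal_natCast, ← ENNReal.ofReal_mul (by positivity)]
        congr 1
        push_cast
        ring

theorem khintchine_groshev_constant_form (m : ℕ) (hm : 1 ≤ m) (ψ : ℕ → ℝ)
    (hpos : ∀ q, 0 < ψ q)
    (hconv : Summable fun q : ℕ => (q : ℝ) ^ (m - 1) * ψ q) :
    ∀ᵐ v : Fin m → ℝ, ∃ κ : ℝ, 0 < κ ∧
      ∀ (p : ℤ) (q : Fin m → ℤ), q ≠ 0 →
        κ * ψ (Finset.univ.sup fun i => (q i).natAbs) <
          |(p : ℝ) + ∑ i, v i * (q i : ℝ)| := by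
  have hball : ∀ (r : ℝ) (q : Fin m → ℤ), q ≠ 0 →
      volume {x : Fin m → UnitAddCircle | ‖UnitAddTorus.zsmulSum q x‖ ≤ r} ≤
        ENNReal.ofReal (2 * r) := by
    intro r q hq
    have hset : {x : Fin m → UnitAddCircle | ‖UnitAddTorus.zsmulSum q x‖ ≤ r} =
        UnitAddTorus.zsmulSum q ⁻¹' Metric.closedBall 0 r := by
      ext x
      simp
    rw [hset, (UnitAddTorus.measurePreserving_zsmulSum hq).measure_preimage
      Metric.isClosed_closedBall.measurableSet.nullMeasurableSet, AddCircle.volume_closedBall]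
    exact ENNReal.ofReal_le_ofReal (min_le_right _ _)
  have hfin : ∀ᵐ x : Fin m → UnitAddCircle, {q : Fin m → ℤ | q ≠ 0 ∧
      ‖UnitAddTorus.zsmulSum q x‖ ≤ ψ (Finset.univ.sup fun i => (q i).natAbs)}.Finite := by
    refine ae_finite_setOfPred_mem (s := fun q : Fin m → ℤ => {x : Fin m → UnitAddCircle | q ≠ 0 ∧
      ‖UnitAddTorus.zsmulSum q x‖ ≤ ψ (Finset.univ.sup fun i => (q i).natAbs)})
      (ne_top_of_le_ne_top (tsum_ofReal_natAbs_sup_ne_top m hm hpos hconv)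
        (ENNReal.tsum_le_tsum fun q => ?_))
    by_cases hq : q = 0
    · simp [hq]
    · simpa [hq] using hball _ q hq
  have hne : ∀ᵐ x : Fin m → UnitAddCircle, ∀ q : Fin m → ℤ, q ≠ 0 →
      0 < ‖UnitAddTorus.zsmulSum q x‖ := by
    refine ae_all_iff.mpr fun q => ?_
    by_cases hq : q = 0
    · simp [hq]
    · have := hball 0 q hq
      rw [mul_zero, ENNReal.ofReal_zero, nonpos_iff_eq_zero] at this
      rw [ae_iff]
      simpa only [hq, not_false_eq_true, ne_eq, forall_const, not_lt] using this
  filter_upwards [UnitAddTorus.ae_coe (hfin.and hne)] with v hv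
  obtain ⟨hfin, hne⟩ := hv
  set x : Fin m → UnitAddCircle := fun i => (v i : UnitAddCircle)
  have hsmall : ∀ᶠ κ in nhdsWithin (0 : ℝ) (Set.Ioi 0), ∀ q ∈ {q : Fin m → ℤ | q ≠ 0 ∧
      ‖UnitAddTorus.zsmulSum q x‖ ≤ ψ (Finset.univ.sup fun i => (q i).natAbs)},
      κ * ψ (Finset.univ.sup fun i => (q i).natAbs) < ‖UnitAddTorus.zsmulSum q x‖ := by
    refine hfin.eventually_all.mpr fun q hq => ?_
    have hcont : Filter.Tendsto (fun κ : ℝ => κ * ψ (Finset.univ.sup fun i => (q i).natAbs))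
        (nhds 0) (nhds 0) := by
      simpa using (continuous_mul_const (ψ (Finset.univ.sup fun i => (q i).natAbs))).tendsto 0
    exact (hcont.mono_left nhdsWithin_le_nhds).eventually_lt_const (hne q hq.1)
  obtain ⟨κ, hκ, hκ1, hκ0⟩ := (hsmall.and ((eventually_nhdsWithin_of_eventually_nhds
    (eventually_le_nhds (zero_lt_one (α := ℝ)))).and self_mem_nhdsWithin)).exists
  refine ⟨κ, hκ0, fun p q hq => ?_⟩
  have hle : ‖UnitAddTorus.zsmulSum q x‖ ≤ |(p : ℝ) + ∑ i, v i * (q i : ℝ)| := by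
    have hcoe : UnitAddTorus.zsmulSum q x =
        (((p : ℝ) + ∑ i, v i * (q i : ℝ) : ℝ) : UnitAddCircle) := by
      have hp : ((p : ℝ) : UnitAddCircle) = 0 :=
        (AddCircle.coe_eq_zero_iff 1).mpr ⟨p, by simp⟩
      rw [AddCircle.coe_add, hp, zero_add, UnitAddTorus.zsmulSum_apply,
        ← QuotientAddGroup.mk'_apply, map_sum]
      refine Finset.sum_congr rfl fun i _ => ?_
      rw [mul_comm, ← zsmul_eq_mul, map_zsmul]
      rfl
    rw [hcoe, ← Real.norm_eq_abs]
    exact QuotientAddGroup.norm_mk_le_norm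
  refine lt_of_lt_of_le ?_ hle
  by_cases hb : ‖UnitAddTorus.zsmulSum q x‖ ≤ ψ (Finset.univ.sup fun i => (q i).natAbs)
  · exact hκ q ⟨hq, hb⟩
  · exact (mul_le_of_le_one_left (hpos _).le hκ1).trans_lt (not_le.mp hb)
end

section
/- Let m ≥ 1 be an integer and ε > 0. Then for Lebesgue-almost every v ∈ ℝ^m there exists a constant κ > 0 such that |p + v₁q₁ + ⋯ + v_m q_m| > κ / (max_i |q_i|)^{m+ε} holds for every p ∈ ℤ and every nonzero q = (q₁,…,q_m) ∈ ℤ^m. -/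
open MeasureTheory

/-- Integer points of `ℝ^κ` are summable against `‖·‖ ^ r` for `r < -|κ|`. -/
lemma summable_norm_rpow_int_pi {κ : Type*} [Fintype κ] (r : ℝ) (hr : r < -(Fintype.card κ : ℝ)) :
    Summable fun z : κ → ℤ ↦ ‖z‖ ^ r := by
  classical
  let L : Submodule ℤ (κ → ℝ) := Submodule.span ℤ (Set.range (Pi.basisFun ℝ κ))
  have hmem (z : κ → ℤ) : (fun i ↦ (z i : ℝ)) ∈ L := by
    rw [Module.Basis.mem_span_iff_repr_mem]
    intro i
    exact ⟨z i, by simp⟩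
  have hrank : Module.finrank ℤ L = Fintype.card κ := by
    rw [ZLattice.rank ℝ L, Module.finrank_fintype_fun_eq_card]
  have h := ZLattice.summable_norm_rpow L r (by rwa [hrank])
  have hinj : Function.Injective fun z : κ → ℤ ↦ (⟨fun i ↦ (z i : ℝ), hmem z⟩ : L) := by
    intro a b hab
    funext i
    simpa using congrFun (congrArg Subtype.val hab) i
  refine (h.comp_injective hinj).congr fun z ↦ ?_
  simp only [Function.comp_apply, Submodule.coe_norm]
  congr 1

/-- The volume of the intersection of a cube with a slab. -/
lemma volume_cube_inter_slab_le {ι : Type*} [Fintype ι] {R δ : ℝ} (hR : 0 ≤ R) (hδ : 0 ≤ δ)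
    (p : ℝ) (q : ι → ℝ) (i : ι) (hi : q i ≠ 0) :
    volume {v : ι → ℝ | (∀ j, |v j| ≤ R) ∧ |p + ∑ j, v j * q j| ≤ δ} ≤
      ENNReal.ofReal (|q i|⁻¹ * (2 * δ * (2 * R) ^ (Fintype.card ι - 1))) := by
  classical
  let A : Matrix ι ι ℝ := (1 : Matrix ι ι ℝ).updateRow i q
  have hdet : LinearMap.det (Matrix.toLin' A) = q i := by
    rw [LinearMap.det_toLin', ← Matrix.cramer_transpose_apply]
    simp
  let B : Set (ι → ℝ) := Set.univ.pi
    (Function.update (fun _ ↦ Set.Icc (-R) R) i (Set.Icc (-p - δ) (-p + δ)))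
  have hB : volume B = ENNReal.ofReal (2 * δ * (2 * R) ^ (Fintype.card ι - 1)) := by
    rw [volume_pi_pi, ← Finset.mul_prod_erase _ _ (Finset.mem_univ i),
      Finset.prod_congr rfl (g := fun _ ↦ ENNReal.ofReal (2 * R)), Finset.prod_const,
      Finset.card_erase_of_mem (Finset.mem_univ i), Finset.card_univ,
      ENNReal.ofReal_mul (p := 2 * δ) (by positivity), ENNReal.ofReal_pow (by positivity)]
    · simp only [Function.update_self, Real.volume_Icc]
      ring_nf
    · intro j hj
      rw [Function.update_of_ne (Finset.ne_of_mem_erase hj), Real.volume_Icc]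
      ring_nf
  have hsub : {v : ι → ℝ | (∀ j, |v j| ≤ R) ∧ |p + ∑ j, v j * q j| ≤ δ} ⊆
      Matrix.toLin' A ⁻¹' B := by
    rintro v ⟨hv, hs⟩ j -
    rw [Matrix.toLin'_apply]
    by_cases hj : j = i
    · subst hj
      have hrow : (A.mulVec v) j = ∑ k, v k * q k := by
        simp [A, Matrix.mulVec, dotProduct, mul_comm]
      rw [Function.update_self, hrow, Set.mem_Icc]
      rw [abs_le] at hs
      constructor <;> linarith
    · have hrow : (A.mulVec v) j = v j := by
        simp [A, Matrix.mulVec, Matrix.updateRow_ne hj, dotProduct, Matrix.one_apply]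
      rw [Function.update_of_ne hj, hrow, Set.mem_Icc]
      exact abs_le.mp (hv j)
  refine (measure_mono hsub).trans_eq ?_
  rw [Measure.addHaar_preimage_linearMap _ (by rwa [hdet]), hdet, hB,
    ← ENNReal.ofReal_mul (abs_nonneg _), abs_inv]

lemma exists_abs_eq_norm_int_pi {ι : Type*} [Fintype ι] {q : ι → ℤ} (hq : q ≠ 0) :
    ∃ i, |(q i : ℝ)| = ‖q‖ := by
  have : Nonempty ι := by
    by_contra h
    rw [not_nonempty_iff] at h
    exact hq (Subsingleton.elim _ _)
  obtain ⟨i, hi⟩ := Finite.exists_max fun i ↦ ‖q i‖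
  rw [← pi_norm_le_iff_of_nonneg (norm_nonneg _)] at hi
  exact ⟨i, by rw [← Int.norm_eq_abs]; exact le_antisymm (norm_le_pi_norm q i) hi⟩

lemma one_le_norm_int_pi {ι : Type*} [Fintype ι] {q : ι → ℤ} (hq : q ≠ 0) : 1 ≤ ‖q‖ := by
  obtain ⟨i, hi⟩ := Function.ne_iff.mp hq
  refine le_trans ?_ (norm_le_pi_norm q i)
  rw [Int.norm_eq_abs]
  exact_mod_cast Int.one_le_abs hi

lemma norm_int_pi_eq_sup_natAbs {ι : Type*} [Fintype ι] (q : ι → ℤ) :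
    ‖q‖ = ((Finset.univ.sup fun i ↦ (q i).natAbs : ℕ) : ℝ) := by
  apply le_antisymm
  · refine (pi_norm_le_iff_of_nonneg (by positivity)).mpr fun i ↦ ?_
    rw [Int.norm_eq_abs, ← Int.cast_abs, Int.abs_eq_natAbs, Int.cast_natCast]
    exact_mod_cast Finset.le_sup (f := fun i ↦ (q i).natAbs) (Finset.mem_univ i)
  · rw [← Nat.le_floor_iff (norm_nonneg _)]
    refine Finset.sup_le fun i _ ↦ (Nat.le_floor_iff (norm_nonneg _)).mpr ?_
    refine le_trans (le_of_eq ?_) (norm_le_pi_norm q i)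
    rw [Int.norm_eq_abs, ← Int.cast_abs, Int.abs_eq_natAbs, Int.cast_natCast]

/-- Almost every `v` satisfies no nontrivial rational affine relation. -/
lemma ae_int_affine_ne_zero {ι : Type*} [Fintype ι] :
    ∀ᵐ v : ι → ℝ, ∀ (p : ℤ) (q : ι → ℤ), q ≠ 0 → (p : ℝ) + ∑ i, v i * (q i : ℝ) ≠ 0 := by
  rw [ae_all_iff]
  intro p
  rw [ae_all_iff]
  intro q
  by_cases hq : q = 0
  · simp [hq]
  obtain ⟨i, hi⟩ := Function.ne_iff.mp hq
  have hbox (N : ℕ) : ∀ᵐ v : ι → ℝ,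
      ¬((∀ j, |v j| ≤ (N : ℝ)) ∧ |(p : ℝ) + ∑ j, v j * (q j : ℝ)| ≤ 0) := by
    rw [ae_iff]
    simp only [not_not]
    refine le_antisymm ((volume_cube_inter_slab_le N.cast_nonneg le_rfl p (fun j ↦ (q j : ℝ)) i
      (by exact_mod_cast hi)).trans (by simp)) zero_le
  filter_upwards [ae_all_iff.mpr hbox] with v hv _ h0
  obtain ⟨N, hN⟩ := exists_nat_ge ‖v‖
  exact hv N ⟨fun j ↦ (norm_le_pi_norm v j).trans hN, by simp [h0]⟩

/-- The volume of the points of a cube that are well approximated by `z = (p, q)`,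
in terms of the norm of `z`. -/
lemma volume_well_approximable_le {m : ℕ} {R s : ℝ} (hR : 0 ≤ R) (hs : 0 ≤ s)
    (z : Fin (m + 1) → ℤ) (hz : Fin.tail z ≠ 0) :
    volume {v : Fin m → ℝ | (∀ j, |v j| ≤ R) ∧
        |(z 0 : ℝ) + ∑ j, v j * (Fin.tail z j : ℝ)| ≤ ‖Fin.tail z‖ ^ (-s)} ≤
      ENNReal.ofReal
        (2 * (2 * R) ^ (m - 1) * (m * R + 1) ^ (s + 1) * ‖z‖ ^ (-(s + 1))) := by
  set q := Fin.tail z with hqdef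
  have hQ : 1 ≤ ‖q‖ := one_le_norm_int_pi hz
  have hQ0 : 0 < ‖q‖ := by linarith
  rcases Set.eq_empty_or_nonempty {v : Fin m → ℝ | (∀ j, |v j| ≤ R) ∧
      |(z 0 : ℝ) + ∑ j, v j * (q j : ℝ)| ≤ ‖q‖ ^ (-s)} with he | ⟨v, hvR, hv⟩
  · simp [he]
  obtain ⟨i, hi⟩ := exists_abs_eq_norm_int_pi hz
  have hδ : ‖q‖ ^ (-s) ≤ 1 := Real.rpow_le_one_of_one_le_of_nonpos hQ (by linarith)
  have hsum : |∑ j, v j * (q j : ℝ)| ≤ m * R * ‖q‖ := by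
    calc |∑ j, v j * (q j : ℝ)| ≤ ∑ j : Fin m, R * ‖q‖ := by
          refine (Finset.abs_sum_le_sum_abs _ _).trans (Finset.sum_le_sum fun j _ ↦ ?_)
          rw [abs_mul, ← Int.norm_eq_abs]
          gcongr
          · exact hvR j
          · exact norm_le_pi_norm q j
      _ = m * R * ‖q‖ := by simp [mul_assoc]
  have hz0 : |(z 0 : ℝ)| ≤ (m * R + 1) * ‖q‖ := by
    have := abs_sub ((z 0 : ℝ) + ∑ j, v j * (q j : ℝ)) (∑ j, v j * (q j : ℝ))
    rw [add_sub_cancel_right] at this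
    linarith
  have hznorm : ‖z‖ ≤ (m * R + 1) * ‖q‖ := by
    refine (pi_norm_le_iff_of_nonneg (by positivity)).mpr (Fin.cases ?_ fun j ↦ ?_)
    · rwa [Int.norm_eq_abs]
    · refine (norm_le_pi_norm q j).trans (le_mul_of_one_le_left hQ0.le ?_)
      have : 0 ≤ m * R := by positivity
      linarith
  have hzpos : 0 < ‖z‖ := hQ0.trans_le <| (pi_norm_le_iff_of_nonneg (norm_nonneg _)).mpr
    fun j ↦ norm_le_pi_norm z j.succ
  refine (volume_cube_inter_slab_le hR (by positivity) (z 0) (fun j ↦ (q j : ℝ)) i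
    (abs_pos.mp (hi ▸ hQ0))).trans (ENNReal.ofReal_le_ofReal ?_)
  rw [hi, Fintype.card_fin]
  have hpow : ‖q‖ ^ (-(s + 1)) ≤ (m * R + 1) ^ (s + 1) * ‖z‖ ^ (-(s + 1)) := by
    have h := Real.rpow_le_rpow hzpos.le hznorm (by linarith : 0 ≤ s + 1)
    rw [Real.mul_rpow (by positivity) hQ0.le] at h
    rw [Real.rpow_neg hQ0.le, Real.rpow_neg hzpos.le, ← div_eq_mul_inv,
      le_div_iff₀ (by positivity), inv_mul_le_iff₀ (by positivity)]
    linarith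
  calc ‖q‖⁻¹ * (2 * ‖q‖ ^ (-s) * (2 * R) ^ (m - 1))
      = 2 * (2 * R) ^ (m - 1) * ‖q‖ ^ (-(s + 1)) := by
        rw [neg_add, Real.rpow_add hQ0, Real.rpow_neg_one]
        ring
    _ ≤ 2 * (2 * R) ^ (m - 1) * ((m * R + 1) ^ (s + 1) * ‖z‖ ^ (-(s + 1))) := by gcongr
    _ = _ := by ring

/-- In a cube, almost every point is well approximated by finitely many integer vectors only. -/
lemma ae_finite_well_approximable {m : ℕ} {R s : ℝ} (hR : 0 ≤ R) (hs : (m : ℝ) < s) :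
    ∀ᵐ v : Fin m → ℝ, {z : Fin (m + 1) → ℤ | Fin.tail z ≠ 0 ∧ (∀ j, |v j| ≤ R) ∧
      |(z 0 : ℝ) + ∑ j, v j * (Fin.tail z j : ℝ)| ≤ ‖Fin.tail z‖ ^ (-s)}.Finite := by
  have hs0 : 0 ≤ s := (Nat.cast_nonneg m).trans hs.le
  refine ae_finite_setOfPred_mem (μ := volume) (s := fun z : Fin (m + 1) → ℤ ↦
    {v : Fin m → ℝ | Fin.tail z ≠ 0 ∧ (∀ j, |v j| ≤ R) ∧
      |(z 0 : ℝ) + ∑ j, v j * (Fin.tail z j : ℝ)| ≤ ‖Fin.tail z‖ ^ (-s)}) ?_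
  have hsum : Summable fun z : Fin (m + 1) → ℤ ↦
      2 * (2 * R) ^ (m - 1) * (m * R + 1) ^ (s + 1) * ‖z‖ ^ (-(s + 1)) :=
    (summable_norm_rpow_int_pi _ (by simp; linarith)).mul_left _
  refine ne_top_of_le_ne_top hsum.tsum_ofReal_ne_top (ENNReal.tsum_le_tsum fun z ↦ ?_)
  by_cases hz : Fin.tail z = 0
  · simp [hz]
  · simpa only [ne_eq, hz, not_false_eq_true, true_and] using
      volume_well_approximable_le hR hs0 z hz

/-- Khintchine–Groshev bound for `ψ(q) = 1/q^(m+ε)`: for every `ε > 0` and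
almost every `v ∈ ℝ^m` there is a constant `κ > 0` such that
`|p + v·q| > κ / (‖q‖_∞)^(m+ε)` for all `p ∈ ℤ` and all nonzero `q ∈ ℤ^m`. -/
theorem khintchine_groshev_power_form (m : ℕ) (hm : 1 ≤ m) (ε : ℝ) (hε : 0 < ε) :
    ∀ᵐ v : Fin m → ℝ, ∃ κ : ℝ, 0 < κ ∧
      ∀ (p : ℤ) (q : Fin m → ℤ), q ≠ 0 →
        κ / ((Finset.univ.sup fun i => (q i).natAbs : ℕ) : ℝ) ^ ((m : ℝ) + ε) <
          |(p : ℝ) + ∑ i, v i * (q i : ℝ)| := by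
  have hfin := ae_all_iff.mpr fun N : ℕ ↦
    ae_finite_well_approximable (m := m) (s := m + ε) N.cast_nonneg (by linarith)
  filter_upwards [hfin, ae_int_affine_ne_zero] with v hfin hne
  obtain ⟨N, hN⟩ := exists_nat_ge ‖v‖
  have hlt : ∀ᶠ κ : ℝ in nhdsWithin 0 (Set.Ioi 0), ∀ z ∈ {z : Fin (m + 1) → ℤ |
      Fin.tail z ≠ 0 ∧ (∀ j, |v j| ≤ (N : ℝ)) ∧
      |(z 0 : ℝ) + ∑ j, v j * (Fin.tail z j : ℝ)| ≤ ‖Fin.tail z‖ ^ (-((m : ℝ) + ε))},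
      κ < |(z 0 : ℝ) + ∑ j, v j * (Fin.tail z j : ℝ)| * ‖Fin.tail z‖ ^ ((m : ℝ) + ε) := by
    rw [Filter.eventually_all_finite (hfin N)]
    rintro z ⟨hz, -⟩
    refine nhdsWithin_le_nhds (eventually_lt_nhds (mul_pos (abs_pos.mpr (hne _ _ hz)) ?_))
    exact Real.rpow_pos_of_pos (norm_pos_iff.mpr hz) _
  obtain ⟨κ, hκ, hκ1, hκ0⟩ := (hlt.and
    ((eventually_nhdsWithin_of_eventually_nhds (eventually_lt_nhds one_pos)).and
      self_mem_nhdsWithin)).exists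
  refine ⟨κ, hκ0, fun p q hq ↦ ?_⟩
  have hQ : 0 < ‖q‖ ^ ((m : ℝ) + ε) := Real.rpow_pos_of_pos (norm_pos_iff.mpr hq) _
  rw [← norm_int_pi_eq_sup_natAbs, div_lt_iff₀ hQ]
  by_cases h : |(p : ℝ) + ∑ i, v i * (q i : ℝ)| ≤ ‖q‖ ^ (-((m : ℝ) + ε))
  · have := hκ (Fin.cons p q)
    simp only [Set.mem_ofPred_eq, Fin.tail_cons, Fin.cons_zero] at this
    exact this ⟨hq, fun j ↦ (norm_le_pi_norm v j).trans hN, h⟩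
  · rw [not_le, Real.rpow_neg (norm_nonneg _), inv_lt_iff_one_lt_mul₀ hQ] at h
    linarith
end

section
/- Let n ≤ m be positive integers, let ε > 0, and let g₁, …, g_m : ℝ^n → ℝ be real-analytic functions such that 1, g₁, …, g_m are linearly independent over ℝ. Then for Lebesgue-almost every v ∈ ℝ^n there exists a constant κ > 0 such that |p + q₁g₁(v) + ⋯ + q_m g_m(v)| > κ / (max_i |q_i|)^{m+ε} holds for every p ∈ ℤ and every nonzero q = (q₁,…,q_m) ∈ ℤ^m. -/
open MeasureTheory

/-- A point `x` is marked when some finite clique `F ⊆ A` of the relation `rel` has all its values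
`ψ s x` in `[ε, ρ)`, while every element of `A` related to all of `F` has value at least `ρ`. -/
def IsMarked {S : Type*} (rel : S → S → Prop) (ψ : S → ℝ → ℝ) (ε ρ : ℝ) (A : Set S) (x : ℝ) :
    Prop :=
  ∃ F : Finset S, (∀ s ∈ F, s ∈ A) ∧ (∀ s ∈ F, ∀ s' ∈ F, s ≠ s' → rel s s') ∧
    (∀ s ∈ F, ε ≤ ψ s x ∧ ψ s x < ρ) ∧ ∀ s ∈ A, (∀ f ∈ F, rel s f) → ρ ≤ ψ s x

theorem exists_pos_and_not_two_mul {P : ℝ → Prop} {r₀ R : ℝ} (hr₀ : 0 < r₀) (h₀ : P r₀)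
    (hR : ∀ r, P r → r < R) : ∃ r, 0 < r ∧ P r ∧ ¬ P (2 * r) := by
  by_contra! h
  have key : ∀ n : ℕ, P (2 ^ n * r₀) := by
    intro n
    induction n with
    | zero => simpa using h₀
    | succ n ih =>
      have := h _ (by positivity) ih
      rwa [← mul_assoc, ← pow_succ'] at this
  obtain ⟨n, hn⟩ := pow_unbounded_of_one_lt (R / r₀) (one_lt_two)
  have := hR _ (key n)
  rw [div_lt_iff₀ hr₀] at hn
  linarith

/-- The Kleinbock–Margulis covering argument: on an interval on which each `ψ s` reaches `ρ`, the
points that are not marked form a set of small measure. -/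
theorem volume_not_isMarked_le {S : Type*} {rel : S → S → Prop} (hsymm : ∀ s s', rel s s' → rel s' s)
    {dim : S → ℕ} (hdim : ∀ s s', rel s s' → dim s ≠ dim s') {ψ : S → ℝ → ℝ}
    (hψ : ∀ s, Continuous (ψ s)) {ε ρ c a₀ b₀ : ℝ} (hc : 0 ≤ c) (n : ℕ) :
    ∀ (D : Finset ℕ) (_ : D.card = n) (A : Set S) (_ : ∀ s ∈ A, dim s ∈ D)
      (_ : ∀ s ∈ A, ∀ a b, a₀ ≤ a → a < b → b ≤ b₀ → (∃ x ∈ Set.Icc a b, ρ ≤ ψ s x) →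
        volume {x ∈ Set.Icc a b | ψ s x < ε} ≤ ENNReal.ofReal (c * (b - a)))
      (a b : ℝ) (_ : a₀ ≤ a) (_ : a < b) (_ : b ≤ b₀)
      (_ : ∀ s ∈ A, ∃ x ∈ Set.Icc a b, ρ ≤ ψ s x),
      volume {x ∈ Set.Icc a b | ¬ IsMarked rel ψ ε ρ A x} ≤
        ENNReal.ofReal (60 ^ n * c * (b - a)) := by
  classical
  induction n with
  | zero =>
    intro D hD A hAD _ a b _ _ _ _
    have hA : ∀ s, s ∉ A := fun s hs => by
      rw [Finset.card_eq_zero] at hD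
      simpa [hD] using hAD s hs
    have : {x ∈ Set.Icc a b | ¬ IsMarked rel ψ ε ρ A x} = ∅ := by
      ext x
      simp only [Set.mem_ofPred_eq, Set.mem_empty_iff_false, iff_false, not_and, not_not]
      exact fun _ => ⟨∅, by simp, by simp, by simp, fun s hs => absurd hs (hA s)⟩
    rw [this, measure_empty]
    exact zero_le
  | succ n ih =>
    intro D hD A hAD hgood a b ha hab hb hsup
    set Y := {x ∈ Set.Icc a b | ¬ IsMarked rel ψ ε ρ A x} with hY
    have step : ∀ y ∈ Y, ∃ r : ℝ, 0 < r ∧ r < b - a ∧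
        (∃ s ∈ A, ∀ x ∈ Set.Icc a b, |x - y| ≤ r → ψ s x < ρ) ∧
        ∀ s ∈ A, ∃ x ∈ Set.Icc a b, |x - y| ≤ 2 * r ∧ ρ ≤ ψ s x := by
      intro y hy
      have h1 : ∃ s ∈ A, ψ s y < ρ := by
        by_contra! h
        exact hy.2 ⟨∅, by simp, by simp, by simp, fun s hs _ => h s hs⟩
      obtain ⟨s, hs, hsy⟩ := h1
      obtain ⟨δ, hδ, hδ'⟩ := Metric.eventually_nhds_iff.1
        ((hψ s).continuousAt.eventually_lt continuousAt_const hsy)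
      have hR : ∀ r, (∃ s ∈ A, ∀ x ∈ Set.Icc a b, |x - y| ≤ r → ψ s x < ρ) → r < b - a := by
        rintro r ⟨s, hs, h⟩
        obtain ⟨x, hx, hxρ⟩ := hsup s hs
        by_contra! hr
        refine absurd (h x hx ?_) (not_lt.2 hxρ)
        have := hy.1
        rw [abs_le]
        constructor <;> linarith [hx.1, hx.2, this.1, this.2]
      obtain ⟨r, hr, hr1, hr2⟩ := exists_pos_and_not_two_mul
        (P := fun r => ∃ s ∈ A, ∀ x ∈ Set.Icc a b, |x - y| ≤ r → ψ s x < ρ)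
        (half_pos hδ) ⟨s, hs, fun x _ hxy => hδ' (by rw [Real.dist_eq]; linarith)⟩ hR
      refine ⟨r, hr, hR r hr1, hr1, ?_⟩
      push Not at hr2
      exact hr2
    rcases Y.eq_empty_or_nonempty with hY0 | ⟨y₀, hy₀⟩
    · rw [hY0, measure_empty]
      exact zero_le
    have : Nonempty S := by
      obtain ⟨_, _, _, ⟨s, _⟩, _⟩ := step y₀ hy₀
      exact ⟨s⟩
    choose! r hr0 hrR hrs hr2 using step
    choose! s hsA hsρ using hrs
    obtain ⟨u, huY, hudisj, hucov⟩ := Vitali.exists_disjoint_subfamily_covering_enlargement_closedBall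
      Y (fun y => y) (fun y => r y / 5) (b - a)
      (fun y hy => by linarith [hr0 y hy, hrR y hy]) 5 (by norm_num)
    have hucount : u.Countable := by
      refine hudisj.countable_of_nonempty_interior fun y hy => ?_
      refine ⟨y, mem_interior_iff_mem_nhds.2 (Metric.closedBall_mem_nhds _ ?_)⟩
      linarith [hr0 y (huY hy)]
    set Z : ℝ → Set ℝ := fun y =>
      {x ∈ Set.Icc (max a (y - 2 * r y)) (min b (y + 2 * r y)) |
        ¬ IsMarked rel ψ ε ρ {s' ∈ A | rel s' (s y)} x} ∪
      {x ∈ Set.Icc (max a (y - 2 * r y)) (min b (y + 2 * r y)) | ψ (s y) x < ε} with hZ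
    have hcover : Y ⊆ ⋃ y ∈ u, Z y := by
      intro x hx
      obtain ⟨y, hyu, hxy⟩ := hucov x hx
      have hyY := huY hyu
      have hd : |x - y| ≤ r y := by
        have := hxy (Metric.mem_closedBall_self (by linarith [hr0 x hx]))
        rw [Metric.mem_closedBall, Real.dist_eq] at this
        linarith
      have hr := hr0 y hyY
      have hxI : x ∈ Set.Icc (max a (y - 2 * r y)) (min b (y + 2 * r y)) := by
        rw [abs_le] at hd
        exact ⟨max_le hx.1.1 (by linarith), le_min hx.1.2 (by linarith)⟩
      refine Set.mem_biUnion hyu ?_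
      by_contra hxZ
      simp only [hZ, Set.mem_union, Set.mem_ofPred_eq, not_or, not_and, not_not, not_lt] at hxZ
      obtain ⟨F, hFA, hFrel, hFψ, hFmax⟩ := hxZ.1 hxI
      refine hx.2 ⟨insert (s y) F, ?_, ?_, ?_, ?_⟩
      · intro t ht
        rcases Finset.mem_insert.1 ht with rfl | ht
        · exact hsA y hyY
        · exact (hFA t ht).1
      · intro t ht t' ht' hne
        rcases Finset.mem_insert.1 ht with rfl | h1 <;> rcases Finset.mem_insert.1 ht' with rfl | h2
        · exact absurd rfl hne
        · exact hsymm _ _ (hFA t' h2).2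
        · exact (hFA t h1).2
        · exact hFrel t h1 t' h2 hne
      · intro t ht
        rcases Finset.mem_insert.1 ht with rfl | ht
        · exact ⟨hxZ.2 hxI, hsρ y hyY x hx.1 hd⟩
        · exact hFψ t ht
      · intro t htA ht
        exact hFmax t ⟨htA, ht _ (Finset.mem_insert_self _ _)⟩
          fun f hf => ht f (Finset.mem_insert_of_mem hf)
    have hZle : ∀ y ∈ u, volume (Z y) ≤
        ENNReal.ofReal ((60 ^ n + 1) * c * 10) * volume (Metric.closedBall y (r y / 5)) := by
      intro y hyu
      have hyY := huY hyu
      have hr := hr0 y hyY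
      have hya := hyY.1.1
      have hyb := hyY.1.2
      have hlt : max a (y - 2 * r y) < min b (y + 2 * r y) :=
        max_lt (lt_min hab (by linarith)) (lt_min (by linarith) (by linarith))
      have hlen : min b (y + 2 * r y) - max a (y - 2 * r y) ≤ 4 * r y := by
        linarith [min_le_right b (y + 2 * r y), le_max_right a (y - 2 * r y)]
      have hA' : ∀ t ∈ A, ∃ x ∈ Set.Icc (max a (y - 2 * r y)) (min b (y + 2 * r y)),
          ρ ≤ ψ t x := by
        intro t ht
        obtain ⟨x, hx, hxy, hxρ⟩ := hr2 y hyY t ht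
        rw [abs_le] at hxy
        exact ⟨x, ⟨max_le hx.1 (by linarith), le_min hx.2 (by linarith)⟩, hxρ⟩
      have h1 := ih (D.erase (dim (s y)))
        (by rw [Finset.card_erase_of_mem (hAD _ (hsA y hyY)), hD]; rfl)
        {s' ∈ A | rel s' (s y)}
        (fun t ht => Finset.mem_erase.2 ⟨hdim _ _ ht.2, hAD t ht.1⟩)
        (fun t ht => hgood t ht.1) _ _ (ha.trans (le_max_left _ _)) hlt
        ((min_le_left _ _).trans hb) (fun t ht => hA' t ht.1)
      have h2 := hgood _ (hsA y hyY) _ _ (ha.trans (le_max_left a _)) hlt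
        ((min_le_left _ _).trans hb) (hA' _ (hsA y hyY))
      refine (measure_union_le _ _).trans ((add_le_add h1 h2).trans ?_)
      rw [Real.volume_closedBall, ← ENNReal.ofReal_mul (by positivity),
        ← ENNReal.ofReal_add (by have := sub_pos.2 hlt; positivity)
          (by have := sub_pos.2 hlt; positivity)]
      apply ENNReal.ofReal_le_ofReal
      have h60 : (0 : ℝ) ≤ (60 ^ n + 1) * c := by positivity
      nlinarith [mul_le_mul_of_nonneg_left hlen h60]
    calc volume Y ≤ volume (⋃ y ∈ u, Z y) := measure_mono hcover
      _ ≤ ∑' y : u, volume (Z y) := measure_biUnion_le _ hucount _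
      _ ≤ ∑' y : u, ENNReal.ofReal ((60 ^ n + 1) * c * 10) *
            volume (Metric.closedBall (y : ℝ) (r y / 5)) :=
          ENNReal.tsum_le_tsum fun y => hZle y y.2
      _ = ENNReal.ofReal ((60 ^ n + 1) * c * 10) *
            volume (⋃ y ∈ u, Metric.closedBall (y : ℝ) (r y / 5)) := by
          rw [ENNReal.tsum_mul_left, measure_biUnion hucount hudisj
            fun _ _ => Metric.isClosed_closedBall.measurableSet]
      _ ≤ ENNReal.ofReal ((60 ^ n + 1) * c * 10) *
            volume (Set.Icc (a - (b - a)) (b + (b - a))) := by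
          gcongr
          refine Set.iUnion₂_subset fun y hyu x hx => ?_
          have hyY := huY hyu
          rw [Metric.mem_closedBall, Real.dist_eq, abs_le] at hx
          constructor <;> linarith [hr0 y hyY, hrR y hyY, hyY.1.1, hyY.1.2]
      _ ≤ ENNReal.ofReal (60 ^ (n + 1) * c * (b - a)) := by
          rw [Real.volume_Icc, ← ENNReal.ofReal_mul (by positivity)]
          apply ENNReal.ofReal_le_ofReal
          have h1 : (1 : ℝ) ≤ 60 ^ n := one_le_pow₀ (by norm_num)
          have h2 : 0 ≤ c * (b - a) := mul_nonneg hc (sub_pos.2 hab).le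
          rw [pow_succ]
          nlinarith [mul_le_mul_of_nonneg_right h1 h2]

open Polynomial in
theorem Polynomial.iteratedDeriv_eval (p : ℝ[X]) (k : ℕ) :
    iteratedDeriv k (fun x => p.eval x) = fun x => (derivative^[k] p).eval x := by
  induction k generalizing p with
  | zero => simp
  | succ k ih =>
    have h : (deriv fun x => p.eval x) = fun x => (derivative p).eval x := by
      ext x
      exact p.deriv
    rw [iteratedDeriv_succ', h, ih, Function.iterate_succ_apply]

open Polynomial in
theorem Polynomial.iteratedDeriv_eval_of_natDegree_le {p : ℝ[X]} {k : ℕ} (hp : p.natDegree ≤ k)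
    (x : ℝ) : iteratedDeriv k (fun x => p.eval x) x = k.factorial * p.coeff k := by
  have h : (derivative^[k] p).natDegree = 0 := by
    have := natDegree_iterate_derivative p k
    omega
  rw [p.iteratedDeriv_eval, eq_C_of_natDegree_eq_zero h]
  simp only [eval_C]
  rw [coeff_iterate_derivative, zero_add,
    Nat.descFactorial_self, nsmul_eq_mul]

/-- **Rolle's theorem** for higher derivatives. -/
theorem exists_iteratedDeriv_eq_zero {a b : ℝ} (k : ℕ) {f : ℝ → ℝ} (hf : ∀ t, AnalyticAt ℝ f t)
    (x : Fin (k + 1) → ℝ) (hx : StrictMono x) (hxab : ∀ i, x i ∈ Set.Icc a b)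
    (hfx : ∀ i, f (x i) = 0) : ∃ ξ ∈ Set.Icc a b, iteratedDeriv k f ξ = 0 := by
  induction k generalizing f with
  | zero => exact ⟨x 0, hxab 0, by simpa using hfx 0⟩
  | succ k ih =>
    have h : ∀ i : Fin (k + 1), ∃ c ∈ Set.Ioo (x i.castSucc) (x i.succ), deriv f c = 0 := fun i =>
      exists_deriv_eq_zero (hx i.castSucc_lt_succ)
        (fun t _ => (hf t).continuousAt.continuousWithinAt) ((hfx _).trans (hfx _).symm)
    choose y hy hy' using h
    rw [iteratedDeriv_succ']
    refine ih (fun t => (hf t).deriv) y (fun i j hij => ?_) (fun i => ?_) hy'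
    · exact ((hy i).2.trans_le (hx.monotone (Fin.succ_le_castSucc_iff.2 hij))).trans (hy j).1
    · exact ⟨(hxab _).1.trans (hy i).1.le, (hy i).2.le.trans (hxab _).2⟩

/-- The error formula for Lagrange interpolation. -/
theorem exists_sub_eval_interpolate_eq {a b : ℝ} {f : ℝ → ℝ} (hf : ∀ t, AnalyticAt ℝ f t)
    (s : Finset ℝ) (hs : ∀ y ∈ s, y ∈ Set.Icc a b) {x : ℝ} (hx : x ∈ Set.Icc a b) :
    ∃ ξ ∈ Set.Icc a b, f x - (Lagrange.interpolate s id f).eval x =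
      iteratedDeriv s.card f ξ / s.card.factorial * ∏ y ∈ s, (x - y) := by
  by_cases hxs : x ∈ s
  · refine ⟨x, hx, ?_⟩
    have := Lagrange.eval_interpolate_at_node f (s := s) (v := id) (Set.injOn_id _) hxs
    rw [id] at this
    rw [this, Finset.prod_eq_zero hxs (sub_self x)]
    simp
  set P := Lagrange.interpolate s id f with hP
  have hW : ∏ y ∈ s, (x - y) ≠ 0 :=
    Finset.prod_ne_zero_iff.2 fun y hy => sub_ne_zero.2 fun h => hxs (h ▸ hy)
  set l := (f x - P.eval x) / ∏ y ∈ s, (x - y) with hl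
  set Q := P + Polynomial.C l * Lagrange.nodal s id with hQ
  have hPdeg : P.degree < s.card := Lagrange.degree_interpolate_lt f (Set.injOn_id _)
  have hQdeg : Q.natDegree ≤ s.card := by
    refine Polynomial.natDegree_add_le_of_degree_le ?_ ?_
    · exact Polynomial.natDegree_le_of_degree_le hPdeg.le
    · exact (Polynomial.natDegree_C_mul_le _ _).trans (by rw [Lagrange.natDegree_nodal])
  have hQc : Q.coeff s.card = l := by
    have h1 : (Lagrange.nodal s (id : ℝ → ℝ)).coeff s.card = 1 := by
      have := Lagrange.nodal_monic (s := s) (v := (id : ℝ → ℝ))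
      rwa [Polynomial.Monic, Polynomial.leadingCoeff, Lagrange.natDegree_nodal] at this
    rw [hQ, Polynomial.coeff_add, Polynomial.coeff_C_mul, h1,
      Polynomial.coeff_eq_zero_of_degree_lt hPdeg]
    ring
  have hQan : ∀ t, AnalyticAt ℝ (fun t => Q.eval t) t := fun t => by
    simpa using AnalyticAt.aeval_polynomial (analyticAt_id (𝕜 := ℝ) (z := t)) Q
  have hcard : (insert x s).card = s.card + 1 := Finset.card_insert_of_notMem hxs
  have hz : ∀ y ∈ insert x s, f y - Q.eval y = 0 := by
    intro y hy
    rcases Finset.mem_insert.1 hy with rfl | hy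
    · rw [hQ, Polynomial.eval_add, Polynomial.eval_mul, Polynomial.eval_C, Lagrange.eval_nodal, hl]
      simp only [id]
      field_simp
      ring
    · have h1 := Lagrange.eval_interpolate_at_node f (s := s) (v := id) (Set.injOn_id _) hy
      have h2 := Lagrange.eval_nodal_at_node (s := s) (v := (id : ℝ → ℝ)) hy
      rw [id] at h1 h2
      rw [hQ, Polynomial.eval_add, Polynomial.eval_mul, hP, h1, h2]
      ring
  obtain ⟨ξ, hξ, hξ0⟩ := exists_iteratedDeriv_eq_zero (a := a) (b := b) s.card
    (f := fun t => f t - Q.eval t) (fun t => (hf t).sub (hQan t))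
    ((insert x s).orderEmbOfFin hcard) ((insert x s).orderEmbOfFin hcard).strictMono
    (fun i => by
      rcases Finset.mem_insert.1 (Finset.orderEmbOfFin_mem _ hcard i) with h | h
      · rw [h]; exact hx
      · exact hs _ h)
    (fun i => hz _ (Finset.orderEmbOfFin_mem _ hcard i))
  refine ⟨ξ, hξ, ?_⟩
  rw [iteratedDeriv_fun_sub (hf ξ).contDiffAt (hQan ξ).contDiffAt,
    Polynomial.iteratedDeriv_eval_of_natDegree_le hQdeg, hQc, sub_eq_zero] at hξ0
  rw [hξ0, mul_div_cancel_left₀ _ (by positivity), hl, div_mul_cancel₀ _ hW]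

/-- A set of large outer measure contains many well-separated points. -/
theorem exists_finset_separated (E : Set ℝ) {g : ℝ} (hg : 0 < g) (k : ℕ)
    (hE : ENNReal.ofReal (2 * k * g) < volume E) :
    ∃ s : Finset ℝ, s.card = k + 1 ∧ (∀ y ∈ s, y ∈ E) ∧
      ∀ y ∈ s, ∀ z ∈ s, y ≠ z → g ≤ |y - z| := by
  induction k with
  | zero =>
    obtain ⟨x, hx⟩ := nonempty_of_measure_ne_zero (ne_bot_of_gt hE)
    exact ⟨{x}, by simp, by simpa, by simp⟩
  | succ k ih =>
    obtain ⟨s, hs, hsE, hsep⟩ :=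
      ih ((ENNReal.ofReal_le_ofReal (by push_cast; nlinarith)).trans_lt hE)
    have hlt : volume (⋃ y ∈ s, Set.Ioo (y - g) (y + g)) < volume E := by
      refine lt_of_le_of_lt ((measure_biUnion_finset_le _ _).trans ?_) hE
      have : ∀ y : ℝ, volume (Set.Ioo (y - g) (y + g)) = ENNReal.ofReal (2 * g) := fun y => by
        rw [Real.volume_Ioo]
        congr 1
        ring
      simp only [this]
      rw [Finset.sum_const, hs, nsmul_eq_mul, ← ENNReal.ofReal_natCast,
        ← ENNReal.ofReal_mul (by positivity)]
      exact ENNReal.ofReal_le_ofReal (by ring_nf; rfl)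
    obtain ⟨x, hxE, hx⟩ : ∃ x ∈ E, x ∉ ⋃ y ∈ s, Set.Ioo (y - g) (y + g) := by
      by_contra! h
      exact absurd (measure_mono h) (not_le.2 hlt)
    have hxs : ∀ y ∈ s, g ≤ |x - y| := by
      intro y hy
      by_contra! h
      rw [abs_lt] at h
      exact hx (Set.mem_biUnion hy ⟨by linarith, by linarith⟩)
    have hx' : x ∉ s := fun h => by
      have := hxs x h
      rw [sub_self, abs_zero] at this
      linarith
    refine ⟨insert x s, by rw [Finset.card_insert_of_notMem hx', hs], ?_, ?_⟩
    · intro y hy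
      rcases Finset.mem_insert.1 hy with rfl | hy
      exacts [hxE, hsE y hy]
    · intro y hy z hz hyz
      rcases Finset.mem_insert.1 hy with rfl | h1 <;> rcases Finset.mem_insert.1 hz with rfl | h2
      · exact absurd rfl hyz
      · exact hxs z h2
      · rw [abs_sub_comm]
        exact hxs y h1
      · exact hsep y h1 z h2 hyz

/-- `φ` is `(C, 1/D)`-good on `[α, β]` in the sense of Kleinbock and Margulis. -/
def GoodOn (φ : ℝ → ℝ) (α β C : ℝ) (D : ℕ) : Prop :=
  ∀ a b, α ≤ a → a < b → b ≤ β → ∀ ε, 0 < ε → ∀ x ∈ Set.Icc a b,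
    |φ x| * volume.real {y ∈ Set.Icc a b | |φ y| ≤ ε} ^ D ≤ C * ε * (b - a) ^ D

theorem measureReal_sep_Icc_le {a b : ℝ} (hab : a < b) (p : ℝ → Prop) :
    volume.real {y ∈ Set.Icc a b | p y} ≤ b - a := by
  have h := measureReal_mono (μ := volume) (Set.sep_subset (Set.Icc a b) p)
    (by simp [Real.volume_Icc])
  rwa [Real.volume_real_Icc_of_le hab.le] at h

theorem GoodOn.mono {φ : ℝ → ℝ} {α β C α' β' C' : ℝ} {D D' : ℕ} (h : GoodOn φ α β C D)
    (hα : α ≤ α') (hβ : β' ≤ β) (hC : C ≤ C') (hD : D ≤ D') : GoodOn φ α' β' C' D' := by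
  intro a b ha hab hb ε hε x hx
  have h1 := h a b (hα.trans ha) hab (hb.trans hβ) ε hε x hx
  have h2 := measureReal_sep_Icc_le hab fun y => |φ y| ≤ ε
  obtain ⟨d, rfl⟩ := Nat.exists_eq_add_of_le hD
  have hL := sub_pos.2 hab
  calc |φ x| * volume.real {y ∈ Set.Icc a b | |φ y| ≤ ε} ^ (D + d)
      = |φ x| * volume.real {y ∈ Set.Icc a b | |φ y| ≤ ε} ^ D *
          volume.real {y ∈ Set.Icc a b | |φ y| ≤ ε} ^ d := by rw [pow_add]; ring
    _ ≤ C * ε * (b - a) ^ D * (b - a) ^ d := by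
        gcongr
        exact le_trans (by positivity) h1
    _ ≤ C' * ε * (b - a) ^ D * (b - a) ^ d := by gcongr
    _ = C' * ε * (b - a) ^ (D + d) := by rw [pow_add]; ring

theorem GoodOn.const_mul {φ : ℝ → ℝ} {α β C : ℝ} {D : ℕ} (h : GoodOn φ α β C D) (hC : 0 ≤ C)
    (l : ℝ) : GoodOn (fun t => l * φ t) α β C D := by
  intro a b ha hab hb ε hε x hx
  have hL := sub_pos.2 hab
  rcases eq_or_ne l 0 with rfl | hl
  · simp only [zero_mul, abs_zero]
    positivity
  have hl' := abs_pos.2 hl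
  have h1 := h a b ha hab hb (ε / |l|) (by positivity) x hx
  have h2 : {y ∈ Set.Icc a b | |l * φ y| ≤ ε} = {y ∈ Set.Icc a b | |φ y| ≤ ε / |l|} := by
    ext y
    simp only [Set.mem_ofPred_eq, abs_mul, le_div_iff₀ hl', mul_comm]
  rw [h2, abs_mul, mul_assoc]
  calc _ ≤ |l| * (C * (ε / |l|) * (b - a) ^ D) := by gcongr
    _ = _ := by field_simp

theorem abs_eval_lagrange_basis_le {a b g : ℝ} (hg : 0 < g) (hgL : g ≤ b - a) {s : Finset ℝ}
    (hs : ∀ y ∈ s, y ∈ Set.Icc a b) (hsep : ∀ y ∈ s, ∀ z ∈ s, y ≠ z → g ≤ |y - z|) {i : ℝ}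
    (hi : i ∈ s) {x : ℝ} (hx : x ∈ Set.Icc a b) :
    |(Lagrange.basis s id i).eval x| ≤ ((b - a) / g) ^ s.card := by
  rw [Lagrange.basis, Polynomial.eval_prod, Finset.abs_prod]
  calc ∏ j ∈ s.erase i, |(Lagrange.basisDivisor (id i) (id j)).eval x|
      ≤ ∏ j ∈ s.erase i, (b - a) / g := by
        refine Finset.prod_le_prod (fun _ _ => abs_nonneg _) fun j hj => ?_
        have hj' := Finset.mem_erase.1 hj
        have h1 := hsep i hi j hj'.2 hj'.1.symm
        have h2 : |x - j| ≤ b - a := by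
          have := hs j hj'.2
          rw [abs_le]
          constructor <;> linarith [hx.1, hx.2, this.1, this.2]
        simp only [Lagrange.basisDivisor, id, Polynomial.eval_mul, Polynomial.eval_C,
          Polynomial.eval_sub, Polynomial.eval_X, abs_mul, abs_inv]
        rw [inv_mul_eq_div]
        exact div_le_div₀ (hg.le.trans hgL) h2 hg h1
    _ = ((b - a) / g) ^ (s.erase i).card := Finset.prod_const _
    _ ≤ ((b - a) / g) ^ s.card :=
        pow_le_pow_right₀ ((one_le_div hg).2 hgL) (Finset.card_erase_le)

theorem goodOn_of_iteratedDeriv {f : ℝ → ℝ} (hf : ∀ t, AnalyticAt ℝ f t) {α β A₁ A₂ : ℝ} {k : ℕ}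
    (hA₁ : 0 < A₁) (h₁ : ∀ t ∈ Set.Icc α β, A₁ ≤ |iteratedDeriv k f t|)
    (h₂ : ∀ t ∈ Set.Icc α β, |iteratedDeriv k f t| ≤ A₂) :
    GoodOn f α β ((k + A₂ / A₁ * (k + 1)) * (2 * k + 1) ^ (2 * k)) (2 * k + 1) := by
  intro a b ha hab hb ε hε x hx
  set E := {y ∈ Set.Icc a b | |f y| ≤ ε} with hE
  set μ := volume.real E with hμ
  have hL := sub_pos.2 hab
  have hμL : μ ≤ b - a := measureReal_sep_Icc_le hab _
  have hsub : Set.Icc a b ⊆ Set.Icc α β := Set.Icc_subset_Icc ha hb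
  have hA₂ : 0 ≤ A₂ := (abs_nonneg _).trans (h₂ x (hsub hx))
  have hμ' : 0 ≤ μ := measureReal_nonneg
  rcases hμ'.eq_or_lt with h0 | hμ0
  · rw [← h0, zero_pow (by omega), mul_zero]
    positivity
  set g := μ / (2 * k + 1) with hg
  have hg0 : 0 < g := by positivity
  have hgμ : g * (2 * k + 1) = μ := div_mul_cancel₀ _ (by positivity)
  have hgL : g ≤ b - a := le_trans (by rw [← hgμ]; nlinarith [(k.cast_nonneg : (0 : ℝ) ≤ k)]) hμL
  have hvol : ENNReal.ofReal (2 * k * g) < volume E := by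
    have hfin : volume E ≠ ⊤ := ne_top_of_le_ne_top (by simp [Real.volume_Icc])
      (measure_mono (Set.sep_subset (Set.Icc a b) _))
    rw [← ENNReal.ofReal_toReal hfin]
    exact (ENNReal.ofReal_lt_ofReal_iff hμ0).2 (show _ < μ by rw [← hgμ]; nlinarith)
  obtain ⟨s, hs, hsE, hsep⟩ := exists_finset_separated E hg0 k hvol
  obtain ⟨x₀, hx₀⟩ := Finset.card_pos.1 (by omega : 0 < s.card)
  set s' := s.erase x₀ with hs'
  have hcard : s'.card = k := by rw [Finset.card_erase_of_mem hx₀, hs]; rfl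
  have hs'E : ∀ y ∈ s', y ∈ E := fun y hy => hsE y (Finset.mem_of_mem_erase hy)
  set q := (b - a) / g with hq
  have hq1 : 1 ≤ q := (one_le_div hg0).2 hgL
  have hqk : 1 ≤ q ^ k := one_le_pow₀ hq1
  have hP : ∀ y ∈ Set.Icc a b, |(Lagrange.interpolate s' id f).eval y| ≤ k * (ε * q ^ k) := by
    intro y hy
    rw [Lagrange.interpolate_apply, Polynomial.eval_finsetSum]
    refine (Finset.abs_sum_le_sum_abs _ _).trans ?_
    rw [← hcard, ← nsmul_eq_mul, ← Finset.sum_const, hcard]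
    refine Finset.sum_le_sum fun i hi => ?_
    rw [Polynomial.eval_mul, Polynomial.eval_C, abs_mul]
    have := abs_eval_lagrange_basis_le hg0 hgL (fun y hy => (hs'E y hy).1)
      (fun y hy z hz => hsep y (Finset.mem_of_mem_erase hy) z (Finset.mem_of_mem_erase hz)) hi hy
    rw [hcard] at this
    exact mul_le_mul (hs'E i hi).2 this (abs_nonneg _) hε.le
  have key : A₁ / k.factorial * g ^ k ≤ (k + 1) * (ε * q ^ k) := by
    obtain ⟨ξ, hξ, h⟩ := exists_sub_eval_interpolate_eq hf s' (fun y hy => (hs'E y hy).1)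
      (hsE x₀ hx₀).1
    rw [hcard] at h
    have h3 : g ^ k ≤ |∏ y ∈ s', (x₀ - y)| := by
      rw [Finset.abs_prod, ← hcard, ← Finset.prod_const]
      exact Finset.prod_le_prod (fun _ _ => hg0.le) fun y hy =>
        hsep x₀ hx₀ y (Finset.mem_of_mem_erase hy) (Finset.ne_of_mem_erase hy).symm
    calc A₁ / k.factorial * g ^ k
        ≤ |iteratedDeriv k f ξ| / k.factorial * |∏ y ∈ s', (x₀ - y)| := by
          gcongr
          exact h₁ ξ (hsub hξ)
      _ = |f x₀ - (Lagrange.interpolate s' id f).eval x₀| := by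
          rw [h, abs_mul, abs_div, Nat.abs_cast]
      _ ≤ |f x₀| + |(Lagrange.interpolate s' id f).eval x₀| := abs_sub _ _
      _ ≤ ε * q ^ k + k * (ε * q ^ k) :=
          add_le_add ((hsE x₀ hx₀).2.trans (le_mul_of_one_le_right hε.le hqk))
            (hP x₀ (hsE x₀ hx₀).1)
      _ = _ := by ring
  have hfx : |f x| ≤ (k + A₂ / A₁ * (k + 1)) * ε * q ^ (2 * k) := by
    obtain ⟨ξ, hξ, h⟩ := exists_sub_eval_interpolate_eq hf s' (fun y hy => (hs'E y hy).1) hx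
    rw [hcard] at h
    have h3 : |∏ y ∈ s', (x - y)| ≤ (q * g) ^ k := by
      rw [Finset.abs_prod, ← hcard, ← Finset.prod_const]
      refine Finset.prod_le_prod (fun _ _ => abs_nonneg _) fun y hy => ?_
      have := (hs'E y hy).1
      rw [hq, div_mul_cancel₀ _ hg0.ne', abs_le]
      constructor <;> linarith [hx.1, hx.2, this.1, this.2]
    calc |f x| = |(Lagrange.interpolate s' id f).eval x +
          (f x - (Lagrange.interpolate s' id f).eval x)| := by congr 1; ring
      _ ≤ |(Lagrange.interpolate s' id f).eval x| +
          |f x - (Lagrange.interpolate s' id f).eval x| := abs_add_le _ _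
      _ ≤ k * (ε * q ^ k) + A₂ / k.factorial * (q * g) ^ k := by
          refine add_le_add (hP x hx) ?_
          rw [h, abs_mul, abs_div, Nat.abs_cast]
          gcongr
          exact h₂ ξ (hsub hξ)
      _ = k * (ε * q ^ k) + A₂ / A₁ * q ^ k * (A₁ / k.factorial * g ^ k) := by
          rw [mul_pow]
          field_simp
      _ ≤ k * (ε * (q ^ k * q ^ k)) + A₂ / A₁ * q ^ k * ((k + 1) * (ε * q ^ k)) := by
          gcongr
          exact le_mul_of_one_le_right (by positivity) hqk
      _ = _ := by rw [two_mul, pow_add]; ring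
  calc |f x| * μ ^ (2 * k + 1)
      ≤ (k + A₂ / A₁ * (k + 1)) * ε * q ^ (2 * k) * (μ ^ (2 * k) * (b - a)) := by
        rw [pow_succ]
        gcongr
    _ = (k + A₂ / A₁ * (k + 1)) * ε * (2 * k + 1) ^ (2 * k) * (q * g) ^ (2 * k) * (b - a) := by
        rw [← hgμ, mul_pow, mul_pow]
        ring
    _ = _ := by
        rw [hq, div_mul_cancel₀ _ hg0.ne', pow_succ]
        ring

theorem analyticAt_sum_const_mul {N : ℕ} {F : Fin N → ℝ → ℝ}
    (hF : ∀ i t, AnalyticAt ℝ (F i) t) (c : Fin N → ℝ) (t : ℝ) :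
    AnalyticAt ℝ (fun t => ∑ i, c i * F i t) t :=
  Finset.analyticAt_fun_sum _ fun i _ => analyticAt_const.fun_mul (hF i t)

theorem iteratedDeriv_sum_const_mul {N : ℕ} {F : Fin N → ℝ → ℝ}
    (hF : ∀ i t, AnalyticAt ℝ (F i) t) (c : Fin N → ℝ) (k : ℕ) (t : ℝ) :
    iteratedDeriv k (fun t => ∑ i, c i * F i t) t = ∑ i, c i * iteratedDeriv k (F i) t := by
  rw [iteratedDeriv_fun_sum fun i _ => (analyticAt_const.fun_mul (hF i t)).contDiffAt]
  exact Finset.sum_congr rfl fun i _ => iteratedDeriv_const_mul_field _ _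

theorem continuous_iteratedDeriv_of_analyticAt {f : ℝ → ℝ} (hf : ∀ t, AnalyticAt ℝ f t) (k : ℕ) :
    Continuous (iteratedDeriv k f) := by
  have h : ContDiff ℝ k f := contDiff_iff_contDiffAt.2 fun t => (hf t).contDiffAt
  exact h.continuous_iteratedDeriv k le_rfl

theorem exists_goodOn_sum {N : ℕ} {F : Fin N → ℝ → ℝ}
    (hF : ∀ i t, AnalyticAt ℝ (F i) t) (t₀ : ℝ)
    (h : ∀ c : Fin N → ℝ, c ≠ 0 → ∃ k, iteratedDeriv k (fun t => ∑ i, c i * F i t) t₀ ≠ 0) :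
    ∃ η > 0, ∃ C ≥ 0, ∃ D, ∀ c : Fin N → ℝ,
      GoodOn (fun t => ∑ i, c i * F i t) (t₀ - η) (t₀ + η) C D := by
  have key : ∃ η > 0, ∃ C ≥ 0, ∃ D, ∀ c ∈ Metric.sphere (0 : Fin N → ℝ) 1,
      GoodOn (fun t => ∑ i, c i * F i t) (t₀ - η) (t₀ + η) C D := by
    refine (isCompact_sphere (0 : Fin N → ℝ) 1).induction_on
      (p := fun s => ∃ η > 0, ∃ C ≥ 0, ∃ D, ∀ c ∈ s,
        GoodOn (fun t => ∑ i, c i * F i t) (t₀ - η) (t₀ + η) C D)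
      ⟨1, one_pos, 0, le_rfl, 0, by simp⟩ ?_ ?_ ?_
    · rintro s s' hs ⟨η, hη, C, hC, D, H⟩
      exact ⟨η, hη, C, hC, D, fun c hc => H c (hs hc)⟩
    · rintro s s' ⟨η, hη, C, hC, D, H⟩ ⟨η', hη', C', hC', D', H'⟩
      have e1 := min_le_left η η'
      have e2 := min_le_right η η'
      refine ⟨min η η', lt_min hη hη', max C C', le_max_of_le_left hC, max D D', ?_⟩
      rintro c (hc | hc)
      · exact (H c hc).mono (by linarith) (by linarith) (le_max_left _ _) (le_max_left _ _)
      · exact (H' c hc).mono (by linarith) (by linarith) (le_max_right _ _) (le_max_right _ _)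
    · intro c₀ hc₀
      have hc₀' : c₀ ≠ 0 := by
        rintro rfl
        simp at hc₀
      obtain ⟨k, hk⟩ := h c₀ hc₀'
      set Φ : (Fin N → ℝ) × ℝ → ℝ := fun p => |∑ i, p.1 i * iteratedDeriv k (F i) p.2| with hΦ
      have hΦc : Continuous Φ := by
        refine continuous_abs.comp (continuous_finsetSum _ fun i _ => ?_)
        exact ((continuous_apply i).comp continuous_fst).mul
          ((continuous_iteratedDeriv_of_analyticAt (hF i) k).comp continuous_snd)
      have hA : 0 < Φ (c₀, t₀) := by
        rw [iteratedDeriv_sum_const_mul hF] at hk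
        exact abs_pos.2 hk
      have hev : ∀ᶠ p in nhds (c₀, t₀), Φ (c₀, t₀) / 2 ≤ Φ p ∧ Φ p ≤ 2 * Φ (c₀, t₀) :=
        ((hΦc.continuousAt.eventually_const_le (half_lt_self hA))).and
          (hΦc.continuousAt.eventually_le_const (by linarith))
      obtain ⟨U, hU, V, hV, hUV⟩ := mem_nhds_prod_iff.1 hev
      obtain ⟨η, hη, hηV⟩ := Metric.nhds_basis_closedBall.mem_iff.1 hV
      rw [Real.closedBall_eq_Icc] at hηV
      refine ⟨U, mem_nhdsWithin_of_mem_nhds hU, η, hη, _, ?_, _, fun c hc =>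
        goodOn_of_iteratedDeriv (k := k) (A₁ := Φ (c₀, t₀) / 2) (A₂ := 2 * Φ (c₀, t₀))
        (analyticAt_sum_const_mul hF c)
        (half_pos hA) ?_ ?_⟩
      · positivity
      · intro t ht
        rw [iteratedDeriv_sum_const_mul hF]
        exact (hUV (Set.mk_mem_prod hc (hηV ht))).1
      · intro t ht
        rw [iteratedDeriv_sum_const_mul hF]
        exact (hUV (Set.mk_mem_prod hc (hηV ht))).2
  obtain ⟨η, hη, C, hC, D, H⟩ := key
  refine ⟨η, hη, C, hC, D, fun c => ?_⟩
  rcases eq_or_ne c 0 with rfl | hc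
  · intro a b _ hab _ ε hε x _
    have := sub_pos.2 hab
    simp only [Pi.zero_apply, zero_mul, Finset.sum_const_zero, abs_zero]
    positivity
  · have hc' := norm_ne_zero_iff.2 hc
    have := (H (‖c‖⁻¹ • c) (by simp [norm_smul, hc'])).const_mul hC ‖c‖
    convert! this using 2 with t
    rw [Finset.mul_sum]
    refine Finset.sum_congr rfl fun i _ => ?_
    rw [Pi.smul_apply, smul_eq_mul]
    field_simp

theorem exists_le_abs_sum {N : ℕ} {F : Fin N → ℝ → ℝ} {K : Set ℝ}
    (h : ∀ c : Fin N → ℝ, c ≠ 0 → ∃ t ∈ K, ∑ i, c i * F i t ≠ 0) :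
    ∃ κ > 0, ∀ c : Fin N → ℝ, c ≠ 0 → ∃ t ∈ K, κ * ‖c‖ ≤ |∑ i, c i * F i t| := by
  have key : ∃ κ > 0, ∀ c ∈ Metric.sphere (0 : Fin N → ℝ) 1,
      ∃ t ∈ K, κ ≤ |∑ i, c i * F i t| := by
    refine (isCompact_sphere (0 : Fin N → ℝ) 1).induction_on
      (p := fun s => ∃ κ > 0, ∀ c ∈ s, ∃ t ∈ K, κ ≤ |∑ i, c i * F i t|)
      ⟨1, one_pos, by simp⟩ ?_ ?_ ?_
    · rintro s s' hs ⟨κ, hκ, H⟩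
      exact ⟨κ, hκ, fun c hc => H c (hs hc)⟩
    · rintro s s' ⟨κ, hκ, H⟩ ⟨κ', hκ', H'⟩
      refine ⟨min κ κ', lt_min hκ hκ', ?_⟩
      rintro c (hc | hc)
      · obtain ⟨t, ht, h⟩ := H c hc
        exact ⟨t, ht, (min_le_left _ _).trans h⟩
      · obtain ⟨t, ht, h⟩ := H' c hc
        exact ⟨t, ht, (min_le_right _ _).trans h⟩
    · intro c₀ hc₀
      have hc₀' : c₀ ≠ 0 := by
        rintro rfl
        simp at hc₀
      obtain ⟨t, ht, hne⟩ := h c₀ hc₀'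
      have hA := abs_pos.2 hne
      have hcont : Continuous fun c : Fin N → ℝ => |∑ i, c i * F i t| := by fun_prop
      exact ⟨_, mem_nhdsWithin_of_mem_nhds
        (hcont.continuousAt.eventually_const_le (half_lt_self hA)), _, half_pos hA,
        fun c hc => ⟨t, ht, hc⟩⟩
  obtain ⟨κ, hκ, H⟩ := key
  refine ⟨κ, hκ, fun c hc => ?_⟩
  have hc' := norm_ne_zero_iff.2 hc
  obtain ⟨t, ht, h⟩ := H (‖c‖⁻¹ • c) (by simp [norm_smul, hc'])
  refine ⟨t, ht, ?_⟩
  simp only [Pi.smul_apply, smul_eq_mul, mul_assoc] at h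
  rw [← Finset.mul_sum, abs_mul, abs_inv, abs_norm, inv_mul_eq_div,
    le_div_iff₀ (norm_pos_iff.2 hc)] at h
  exact h

/-- A nontrivial linear combination has a nonvanishing derivative at each point, and does not
vanish identically on any neighbourhood. -/
theorem exists_iteratedDeriv_ne_zero {f : ℝ → ℝ} (hf : ∀ t, AnalyticAt ℝ f t)
    (h : ∃ t, f t ≠ 0) (t₀ : ℝ) : ∃ k, iteratedDeriv k f t₀ ≠ 0 := by
  by_contra! h0
  have htop : analyticOrderAt f t₀ = ⊤ := ENat.eq_top_iff_forall_ge.2 fun n =>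
    (natCast_le_analyticOrderAt_iff_iteratedDeriv_eq_zero (hf t₀)).2 fun i _ => h0 i
  obtain ⟨t, ht⟩ := h
  exact ht ((show AnalyticOnNhd ℝ f Set.univ from fun t _ =>
    hf t).eqOn_zero_of_preconnected_of_eventuallyEq_zero isPreconnected_univ (Set.mem_univ t₀)
    (analyticOrderAt_eq_top.1 htop) (Set.mem_univ t))

theorem exists_mem_Icc_ne_zero {f : ℝ → ℝ} (hf : ∀ t, AnalyticAt ℝ f t)
    (h : ∃ t, f t ≠ 0) (t₀ : ℝ) {η : ℝ} (hη : 0 < η) :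
    ∃ t ∈ Set.Icc (t₀ - η) (t₀ + η), f t ≠ 0 := by
  by_contra! h0
  obtain ⟨t, ht⟩ := h
  exact ht ((show AnalyticOnNhd ℝ f Set.univ from fun t _ =>
    hf t).eqOn_zero_of_preconnected_of_eventuallyEq_zero isPreconnected_univ (Set.mem_univ t₀)
    (Filter.eventually_of_mem (Icc_mem_nhds (by linarith) (by linarith)) h0) (Set.mem_univ t))

/-- Linearly independent functions have a nonsingular matrix of values. -/
theorem LinearIndependent.exists_det_ne_zero {X : Type*} {r : ℕ} {b : Fin r → X → ℝ}
    (hb : LinearIndependent ℝ b) :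
    ∃ I : Fin r → X, (Matrix.of fun j i => b i (I j)).det ≠ 0 := by
  induction r with
  | zero => exact ⟨Fin.elim0, by simp⟩
  | succ r ih =>
    obtain ⟨I, hI⟩ := ih (hb.comp Fin.succ (Fin.succ_injective r))
    by_contra! h
    refine hI ?_
    rw [Fintype.linearIndependent_iff] at hb
    have := hb (fun i => (-1) ^ (i : ℕ) *
      (Matrix.of fun (j : Fin r) (l : Fin r) => b (i.succAbove l) (I j)).det) (by
        ext x
        have hx := h (Fin.cons x I)
        rw [Matrix.det_succ_row_zero] at hx
        rw [Finset.sum_apply, Pi.zero_apply, ← hx]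
        refine Finset.sum_congr rfl fun i _ => ?_
        rw [Pi.smul_apply, smul_eq_mul, mul_right_comm]
        rfl) 0
    simpa using this

/-- The vector of maximal minors of the family `b`. -/
def minors {r N : ℕ} (b : Fin r → Fin N → ℝ) : (Fin r → Fin N) → ℝ :=
  fun I => (Matrix.of fun j i => b i (I j)).det

theorem minors_sum_smul {r N : ℕ} (b : Fin r → Fin N → ℝ) (U : Matrix (Fin r) (Fin r) ℝ) :
    minors (fun i => ∑ l, U i l • b l) = U.det • minors b := by
  ext I
  rw [Pi.smul_apply, smul_eq_mul, minors, minors, mul_comm, ← U.det_transpose, ← Matrix.det_mul]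
  congr 1
  ext j i
  simp [Matrix.mul_apply, Finset.sum_apply, mul_comm]

theorem norm_minors_cons_le {r N : ℕ} (v : Fin N → ℝ) (b : Fin r → Fin N → ℝ) :
    ‖minors (Fin.cons v b : Fin (r + 1) → Fin N → ℝ)‖ ≤ (r + 1) * (‖v‖ * ‖minors b‖) := by
  rw [pi_norm_le_iff_of_nonneg (by positivity)]
  intro I
  rw [minors, Matrix.det_succ_column_zero]
  refine (norm_sum_le _ _).trans ?_
  calc _ ≤ ∑ _j : Fin (r + 1), ‖v‖ * ‖minors b‖ := Finset.sum_le_sum fun j _ => by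
        rw [norm_mul, norm_mul, norm_pow, norm_neg, norm_one, one_pow, one_mul]
        exact mul_le_mul (norm_le_pi_norm v (I j))
          (norm_le_pi_norm (minors b) fun l => I (j.succAbove l)) (norm_nonneg _) (norm_nonneg _)
    _ = _ := by simp

theorem minors_eq_zero_of_not_injective {r N : ℕ} (b : Fin r → Fin N → ℝ) {I : Fin r → Fin N}
    (hI : ¬ Function.Injective I) : minors b I = 0 := by
  simp only [Function.Injective, not_forall] at hI
  obtain ⟨i, j, hij, hne⟩ := hI
  exact Matrix.det_zero_of_row_eq hne (by ext l; simp [hij])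

/-- The linear map `diag(τ^m, τ⁻¹, …, τ⁻¹) u_y`, sending `(p, q)` to
`(τ^m (p y₀ + q · y), τ⁻¹ q)`. -/
noncomputable def latticeMap (m : ℕ) (τ : ℝ) (y : Fin (m + 1) → ℝ) :
    (Fin (m + 1) → ℝ) →ₗ[ℝ] (Fin (m + 1) → ℝ) where
  toFun v k := if k = 0 then τ ^ m * ∑ l, v l * y l else τ⁻¹ * v k
  map_add' v w := by
    ext k
    simp only [Pi.add_apply]
    split_ifs
    · simp only [add_mul, Finset.sum_add_distrib, mul_add]
    · ring
  map_smul' a v := by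
    ext k
    simp only [Pi.smul_apply, smul_eq_mul, RingHom.id_apply]
    split_ifs
    · simp only [mul_assoc, ← Finset.mul_sum]
      ring
    · ring

theorem latticeMap_apply_zero (m : ℕ) (τ : ℝ) (y v : Fin (m + 1) → ℝ) :
    latticeMap m τ y v 0 = τ ^ m * ∑ l, v l * y l := by
  simp [latticeMap]

theorem latticeMap_apply_of_ne (m : ℕ) (τ : ℝ) (y v : Fin (m + 1) → ℝ) {k : Fin (m + 1)}
    (hk : k ≠ 0) : latticeMap m τ y v k = τ⁻¹ * v k := by
  simp [latticeMap, hk]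

theorem minors_latticeMap_of_forall_ne {m r : ℕ} (τ : ℝ) (y : Fin (m + 1) → ℝ)
    (b : Fin r → Fin (m + 1) → ℝ) {I : Fin r → Fin (m + 1)} (hI : ∀ j, I j ≠ 0) :
    minors (fun i => latticeMap m τ y (b i)) I = τ⁻¹ ^ r * minors b I := by
  have h : (Matrix.of fun j i => latticeMap m τ y (b i) (I j)) =
      τ⁻¹ • (Matrix.of fun j i => b i (I j)) := by
    ext j i
    simp [latticeMap_apply_of_ne _ _ _ _ (hI j)]
  rw [minors, h, Matrix.det_smul, Fintype.card_fin]
  rfl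

theorem minors_latticeMap_of_eq_zero {m r : ℕ} (τ : ℝ) (y : Fin (m + 1) → ℝ)
    (b : Fin (r + 1) → Fin (m + 1) → ℝ) {I : Fin (r + 1) → Fin (m + 1)} {j₀ : Fin (r + 1)}
    (h₀ : I j₀ = 0) (hI : ∀ j, j ≠ j₀ → I j ≠ 0) :
    minors (fun i => latticeMap m τ y (b i)) I =
      ∑ k, (τ ^ m * τ⁻¹ ^ r * minors b (Function.update I j₀ k)) * y k := by
  set d : Fin (r + 1) → ℝ := fun j => if j = j₀ then τ ^ m else τ⁻¹ with hd
  set R : Fin (r + 1) → Fin (r + 1) → ℝ := fun j i => b i (I j) with hR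
  have hprod : ∏ j, d j = τ ^ m * τ⁻¹ ^ r := by
    rw [← Finset.mul_prod_erase _ _ (Finset.mem_univ j₀)]
    congr 1
    · simp [hd]
    · rw [Finset.prod_congr rfl fun j hj => if_neg (Finset.ne_of_mem_erase hj)]
      simp
  have h1 : (fun j i => latticeMap m τ y (b i) (I j)) =
      fun j => d j • Function.update R j₀ (∑ k, y k • fun i => b i k) j := by
    ext j i
    by_cases hj : j = j₀
    · subst hj
      simp [hd, h₀, latticeMap_apply_zero, mul_comm]
    · simp [hd, hR, hj, latticeMap_apply_of_ne _ _ _ _ (hI j hj)]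
  have h2 : minors (fun i => latticeMap m τ y (b i)) I =
      Matrix.detRowAlternating (fun j i => latticeMap m τ y (b i) (I j)) := rfl
  have h3 := Matrix.detRowAlternating.toMultilinearMap.map_smul_univ d
    (Function.update R j₀ (∑ k, y k • fun i => b i k))
  rw [h2, h1]
  refine h3.trans ?_
  rw [hprod, smul_eq_mul]
  have h4 := Matrix.detRowAlternating.map_update_sum Finset.univ j₀
    (fun k => y k • fun i => b i k) R
  refine (congrArg (τ ^ m * τ⁻¹ ^ r * ·) h4).trans ?_
  simp only [Finset.mul_sum]
  refine Finset.sum_congr rfl fun k _ => ?_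
  rw [AlternatingMap.map_update_smul, smul_eq_mul]
  have h5 : Function.update R j₀ (fun i => b i k) = fun j i => b i (Function.update I j₀ k j) := by
    ext j i
    by_cases hj : j = j₀
    · subst hj
      simp
    · simp [hR, hj]
  rw [h5, mul_comm (y k), ← mul_assoc]
  rfl

theorem exists_minors_latticeMap_eq {m r : ℕ} (τ : ℝ) (b : Fin r → Fin (m + 1) → ℝ)
    (I : Fin r → Fin (m + 1)) : ∃ c : Fin (m + 1) → ℝ, ∀ y : Fin (m + 1) → ℝ, y 0 = 1 →
      minors (fun i => latticeMap m τ y (b i)) I = ∑ k, c k * y k := by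
  by_cases hinj : Function.Injective I
  · by_cases h : ∃ j₀, I j₀ = 0
    · obtain ⟨j₀, hj₀⟩ := h
      cases r with
      | zero => exact j₀.elim0
      | succ r =>
        exact ⟨_, fun y _ => minors_latticeMap_of_eq_zero τ y b hj₀
          fun j hj h => hj (hinj (h.trans hj₀.symm))⟩
    · push Not at h
      refine ⟨Pi.single 0 (τ⁻¹ ^ r * minors b I), fun y hy => ?_⟩
      rw [minors_latticeMap_of_forall_ne τ y b h]
      simp [Pi.single_apply, hy]
  · exact ⟨0, fun y _ => by rw [minors_eq_zero_of_not_injective _ hinj]; simp⟩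

theorem minors_intCast {r N : ℕ} (b : Fin r → Fin N → ℤ) (I : Fin r → Fin N) :
    minors (fun i k => (b i k : ℝ)) I = ((Matrix.of fun j i => b i (I j)).det : ℤ) := by
  rw [Int.cast_det]
  rfl

theorem exists_minors_latticeMap_eq_of_linearIndependent {m r : ℕ} (hr : 0 < r) {τ : ℝ}
    (hτ : 1 ≤ τ) {b : Fin r → Fin (m + 1) → ℤ}
    (hb : LinearIndependent ℝ fun i k => (b i k : ℝ)) :
    ∃ (I : Fin r → Fin (m + 1)) (c : Fin (m + 1) → ℝ), 1 ≤ ‖c‖ ∧ ∀ y : Fin (m + 1) → ℝ,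
      minors (fun i => latticeMap m τ y fun k => (b i k : ℝ)) I = ∑ k, c k * y k := by
  obtain ⟨I, hI⟩ := hb.exists_det_ne_zero
  change minors (fun i k => (b i k : ℝ)) I ≠ 0 at hI
  have hinj : Function.Injective I := by
    by_contra h
    exact hI (minors_eq_zero_of_not_injective _ h)
  have hI1 : 1 ≤ |minors (fun i k => (b i k : ℝ)) I| := by
    rw [minors_intCast] at hI ⊢
    rw [← Int.cast_abs]
    exact_mod_cast Int.one_le_abs (by exact_mod_cast hI)
  obtain ⟨r, rfl⟩ := Nat.exists_eq_succ_of_ne_zero hr.ne'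
  have hrm : r ≤ m := by simpa using Fintype.card_le_of_injective I hinj
  obtain ⟨j₀, hj₀⟩ : ∃ j₀, ∀ j, j ≠ j₀ → I j ≠ 0 := by
    by_cases h : ∃ j₀, I j₀ = 0
    · obtain ⟨j₀, hj₀⟩ := h
      exact ⟨j₀, fun j hj h => hj (hinj (h.trans hj₀.symm))⟩
    · push Not at h
      exact ⟨0, fun j _ => h j⟩
  refine ⟨Function.update I j₀ 0, _, ?_, fun y => minors_latticeMap_of_eq_zero τ y _
    (j₀ := j₀) (by simp) fun j hj => by simpa [hj] using hj₀ j hj⟩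
  refine le_trans ?_ (norm_le_pi_norm _ (I j₀))
  simp only [Function.update_idem, Function.update_eq_self, Real.norm_eq_abs, abs_mul]
  have hτ0 : 0 < τ := by linarith
  have h1 : 1 ≤ τ ^ m * τ⁻¹ ^ r := by
    rw [inv_pow, ← div_eq_mul_inv, one_le_div (by positivity)]
    exact pow_le_pow_right₀ hτ hrm
  rw [← abs_mul, abs_of_pos (by positivity)]
  exact one_le_mul_of_one_le_of_one_le h1 hI1

/-- `b` is a basis of the real subspace `L` consisting of integer vectors. -/
def IsIntBasis {N : ℕ} (L : Submodule ℝ (Fin N → ℝ)) (r : ℕ) (b : Fin r → Fin N → ℤ) : Prop :=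
  LinearIndependent ℝ (fun i k => (b i k : ℝ) : Fin r → Fin N → ℝ) ∧
    Submodule.span ℝ (Set.range (fun i k => (b i k : ℝ) : Fin r → Fin N → ℝ)) = L

theorem IsIntBasis.finrank_eq {N : ℕ} {L : Submodule ℝ (Fin N → ℝ)} {r : ℕ}
    {b : Fin r → Fin N → ℤ} (h : IsIntBasis L r b) : Module.finrank ℝ L = r := by
  rw [← h.2, finrank_span_eq_card h.1, Fintype.card_fin]

/-- A rational subspace has an integer basis of minimal covolume. -/
theorem exists_minimal_isIntBasis {N : ℕ} {L : Submodule ℝ (Fin N → ℝ)}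
    (hL : ∃ r b, IsIntBasis L r b) : ∃ r b, IsIntBasis L r b ∧ ∀ r' b', IsIntBasis L r' b' →
      ∀ T : (Fin N → ℝ) →ₗ[ℝ] (Fin N → ℝ), ‖minors (fun i => T fun k => (b i k : ℝ))‖ ≤
        ‖minors (fun i => T fun k => (b' i k : ℝ))‖ := by
  obtain ⟨r, b₀, hb₀⟩ := hL
  set h : (Fin r → Fin N → ℤ) → ℕ := fun b => ∑ I : Fin r → Fin N,
    (Matrix.of fun j i => b i (I j)).det.natAbs with hh
  have hcast : ∀ b, (h b : ℝ) = ∑ I, |minors (fun i k => (b i k : ℝ)) I| := fun b => by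
    rw [hh, Nat.cast_sum]
    refine Finset.sum_congr rfl fun I _ => ?_
    rw [minors_intCast, Nat.cast_natAbs, Int.cast_abs]
  obtain ⟨b, hb, hmin⟩ := WellFounded.has_min (measure h).wf {b | IsIntBasis L r b} ⟨b₀, hb₀⟩
  refine ⟨r, b, hb, fun r' b' hb' T => ?_⟩
  obtain rfl : r' = r := hb'.finrank_eq.symm.trans hb.finrank_eq
  have hmem : ∀ i, (fun k => (b' i k : ℝ)) ∈
      Submodule.span ℝ (Set.range fun i k => (b i k : ℝ)) := fun i => by
    rw [hb.2, ← hb'.2]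
    exact Submodule.subset_span (Set.mem_range_self i)
  simp only [Submodule.mem_span_range_iff_exists_fun] at hmem
  choose U hU using hmem
  have h1 : minors (fun i k => (b' i k : ℝ)) =
      (Matrix.of U).det • minors (fun i k => (b i k : ℝ)) := by
    rw [← minors_sum_smul]
    congr 1
    ext i : 1
    exact (hU i).symm
  have h2 : minors (fun i => T fun k => (b' i k : ℝ)) =
      (Matrix.of U).det • minors (fun i => T fun k => (b i k : ℝ)) := by
    rw [← minors_sum_smul]
    congr 1
    ext i : 1
    rw [← hU i]
    simp
  have h3 : (h b' : ℝ) = |(Matrix.of U).det| * h b := by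
    simp only [hcast, h1, Pi.smul_apply, smul_eq_mul, abs_mul, Finset.mul_sum]
  have hle : (h b : ℝ) ≤ h b' := by
    exact_mod_cast not_lt.1 (hmin b' hb')
  have hpos : 0 < (h b : ℝ) := by
    obtain ⟨I, hI⟩ := hb.1.exists_det_ne_zero
    rw [hcast]
    exact Finset.sum_pos' (fun _ _ => abs_nonneg _) ⟨I, Finset.mem_univ _, abs_pos.2 hI⟩
  rw [h2, norm_smul, Real.norm_eq_abs]
  refine le_mul_of_one_le_left (norm_nonneg _) ?_
  rw [h3] at hle
  exact one_le_of_le_mul_right₀ hpos hle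

/-- The nonzero subspaces of `ℝ^N` spanned by integer vectors. -/
abbrev RationalSubspace (N : ℕ) :=
  {L : Submodule ℝ (Fin N → ℝ) // L ≠ ⊥ ∧ ∃ r b, IsIntBasis L r b}

/-- The sup-norm covolume of the image under `T` of the integer points of `L`. -/
noncomputable def RationalSubspace.covolume {N : ℕ} (L : RationalSubspace N)
    (T : (Fin N → ℝ) →ₗ[ℝ] (Fin N → ℝ)) : ℝ :=
  ‖minors fun i => T fun k => ((exists_minimal_isIntBasis L.2.2).choose_spec.choose i k : ℝ)‖

theorem RationalSubspace.exists_covolume_eq {N : ℕ} (L : RationalSubspace N) :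
    ∃ r b, IsIntBasis L.1 r b ∧ ∀ T, L.covolume T = ‖minors fun i => T fun k => (b i k : ℝ)‖ :=
  ⟨_, _, (exists_minimal_isIntBasis L.2.2).choose_spec.choose_spec.1, fun _ => rfl⟩

theorem RationalSubspace.covolume_le {N : ℕ} (L : RationalSubspace N) {r : ℕ}
    {b : Fin r → Fin N → ℤ} (hb : IsIntBasis L.1 r b) (T : (Fin N → ℝ) →ₗ[ℝ] (Fin N → ℝ)) :
    L.covolume T ≤ ‖minors fun i => T fun k => (b i k : ℝ)‖ :=
  (exists_minimal_isIntBasis L.2.2).choose_spec.choose_spec.2 _ _ hb T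

theorem IsIntBasis.cons {N r : ℕ} {L : Submodule ℝ (Fin N → ℝ)} {b : Fin r → Fin N → ℤ}
    (hb : IsIntBasis L r b) {v : Fin N → ℤ} (hv : (fun k => (v k : ℝ)) ∉ L) :
    IsIntBasis (Submodule.span ℝ {fun k => (v k : ℝ)} ⊔ L) (r + 1)
      (Fin.cons v b : Fin (r + 1) → Fin N → ℤ) := by
  have h : (fun i k => ((Fin.cons v b : Fin (r + 1) → Fin N → ℤ) i k : ℝ)) =
      (Fin.cons (fun k => (v k : ℝ)) fun i k => (b i k : ℝ) : Fin (r + 1) → Fin N → ℝ) := by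
    ext i k
    refine Fin.cases ?_ (fun i => ?_) i <;> simp
  rw [IsIntBasis, h, linearIndependent_finCons, Fin.range_cons, Submodule.span_insert, hb.2]
  exact ⟨⟨hb.1, hv⟩, rfl⟩

theorem min_le_mul_norm_of_isMarked {N : ℕ} {T : ℝ → (Fin N → ℝ) →ₗ[ℝ] (Fin N → ℝ)}
    {ε ρ t : ℝ} (hρ : ρ ≤ 1)
    (h : IsMarked (fun L L' : RationalSubspace N => L < L' ∨ L' < L)
      (fun L t => L.covolume (T t)) ε ρ Set.univ t) {v : Fin N → ℤ} (hv : v ≠ 0) :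
    min ε ρ ≤ N * ‖T t fun k => (v k : ℝ)‖ := by
  classical
  obtain ⟨F, -, hF, hε, hA⟩ := h
  set w : Fin N → ℝ := fun k => (v k : ℝ) with hw
  have hw0 : w ≠ 0 := fun h => hv (by ext k; simpa [hw] using congrFun h k)
  obtain ⟨L', r, b, hb, hb1, hvL, hL'⟩ : ∃ (L' : Submodule ℝ (Fin N → ℝ)) (r : ℕ)
      (b : Fin r → Fin N → ℤ), IsIntBasis L' r b ∧
      ‖minors fun i => T t fun k => (b i k : ℝ)‖ ≤ 1 ∧ w ∉ L' ∧
      ∀ f ∈ F, f.1 ≤ L' ∨ w ∈ f.1 ∧ L' ≤ f.1 := by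
    by_cases hne : (F.filter fun f => w ∉ f.1).Nonempty
    · obtain ⟨L', hL'⟩ := Finset.exists_maximal hne
      have hL'F := Finset.mem_filter.1 hL'.1
      obtain ⟨r, b, hb, hcov⟩ := L'.exists_covolume_eq
      refine ⟨L'.1, r, b, hb, ?_, hL'F.2, fun f hf => ?_⟩
      · rw [← hcov]
        exact (hε L' hL'F.1).2.le.trans hρ
      · rcases eq_or_ne f L' with rfl | hne
        · exact Or.inl le_rfl
        · rcases hF f hf L' hL'F.1 hne with h | h
          · exact Or.inl h.le
          · refine Or.inr ⟨?_, h.le⟩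
            by_contra hwf
            exact h.not_ge (hL'.2 (Finset.mem_filter.2 ⟨hf, hwf⟩) h.le)
    · refine ⟨⊥, 0, Fin.elim0, ⟨linearIndependent_empty_type, by simp⟩, ?_, by simpa using hw0,
        fun f hf => Or.inr ⟨?_, bot_le⟩⟩
      · rw [pi_norm_le_iff_of_nonneg zero_le_one]
        intro I
        simp [minors]
      · by_contra hwf
        exact hne ⟨f, Finset.mem_filter.2 ⟨hf, hwf⟩⟩
  have hcons := hb.cons hvL
  have hwL : w ∈ Submodule.span ℝ {w} ⊔ L' :=
    Submodule.mem_sup_left (Submodule.mem_span_singleton_self w)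
  let L : RationalSubspace N := ⟨Submodule.span ℝ {w} ⊔ L',
    fun h => hw0 (by simpa [h] using hwL), _, _, hcons⟩
  have hrN : r + 1 ≤ N := by simpa using hcons.1.fintype_card_le_finrank
  have hcov : L.covolume (T t) ≤ N * ‖T t w‖ := by
    refine (L.covolume_le hcons (T t)).trans ?_
    have h : (fun i => T t fun k => ((Fin.cons v b : Fin (r + 1) → Fin N → ℤ) i k : ℝ)) =
        (Fin.cons (T t w) fun i => T t fun k => (b i k : ℝ) : Fin (r + 1) → Fin N → ℝ) := by
      ext i : 1
      refine Fin.cases ?_ (fun i => ?_) i <;> simp [hw]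
    rw [h]
    refine (norm_minors_cons_le _ _).trans ?_
    have : ((r : ℝ) + 1) ≤ N := by exact_mod_cast hrN
    gcongr
    exact mul_le_of_le_one_right (norm_nonneg _) hb1
  refine le_trans ?_ hcov
  by_cases hLF : L ∈ F
  · exact (min_le_left _ _).trans (hε L hLF).1
  · refine (min_le_right _ _).trans (hA L trivial fun f hf => ?_)
    have hne : f ≠ L := fun h => hLF (h ▸ hf)
    rcases hL' f hf with h | ⟨h1, h2⟩
    · exact Or.inr (lt_of_le_of_ne (h.trans le_sup_right : f.1 ≤ L.1) hne)
    · refine Or.inl (lt_of_le_of_ne ?_ hne.symm)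
      exact sup_le ((Submodule.span_singleton_le_iff_mem _ _).2 h1) h2

theorem exists_le_abs_of_le_norm {ι : Type*} [Fintype ι] {ρ : ℝ} (hρ : 0 < ρ) {f : ι → ℝ}
    (h : ρ ≤ ‖f‖) : ∃ i, ρ ≤ |f i| := by
  by_contra! hlt
  exact h.not_gt ((pi_norm_lt_iff hρ).2 hlt)

theorem GoodOn.measureReal_le {φ : ℝ → ℝ} {α β C ρ : ℝ} {D : ℕ} (h : GoodOn φ α β C D)
    (hC : 0 ≤ C) (hD : D ≠ 0) (hρ : 0 < ρ) {a b : ℝ} (ha : α ≤ a) (hab : a < b) (hb : b ≤ β)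
    {ε : ℝ} (hε : 0 < ε) {x : ℝ} (hx : x ∈ Set.Icc a b) (hφ : ρ ≤ |φ x|) :
    volume.real {y ∈ Set.Icc a b | |φ y| ≤ ε} ≤ (C * ε / ρ) ^ (D : ℝ)⁻¹ * (b - a) := by
  have h1 := h a b ha hab hb ε hε x hx
  set μ := volume.real {y ∈ Set.Icc a b | |φ y| ≤ ε} with hμ
  have hL := sub_pos.2 hab
  refine le_of_pow_le_pow_left₀ hD (by positivity) ?_
  rw [mul_pow, Real.rpow_inv_natCast_pow (by positivity) hD, div_mul_eq_mul_div, le_div_iff₀ hρ,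
    mul_comm]
  exact (mul_le_mul_of_nonneg_right hφ (by positivity)).trans h1

theorem exists_volume_exists_norm_latticeMap_le {m : ℕ} {F : Fin (m + 1) → ℝ → ℝ}
    (hF : ∀ i t, AnalyticAt ℝ (F i) t) (hF0 : ∀ t, F 0 t = 1)
    (hind : ∀ c : Fin (m + 1) → ℝ, c ≠ 0 → ∃ t, ∑ i, c i * F i t ≠ 0) (t₀ : ℝ) :
    ∃ η > 0, ∃ C ≥ 0, ∃ α : ℝ, 0 < α ∧ ∀ δ : ℝ, 0 < δ → ∀ τ : ℝ, 1 ≤ τ →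
      volume {t ∈ Set.Icc (t₀ - η) (t₀ + η) | ∃ v : Fin (m + 1) → ℤ, v ≠ 0 ∧
        ‖latticeMap m τ (fun i => F i t) fun k => (v k : ℝ)‖ ≤ δ} ≤
          ENNReal.ofReal (C * δ ^ α) := by
  have hana := analyticAt_sum_const_mul hF
  obtain ⟨η, hη, C₀, hC₀, D₀, hgood₀⟩ := exists_goodOn_sum hF t₀ fun c hc =>
    exists_iteratedDeriv_ne_zero (hana c) (hind c hc) t₀
  obtain ⟨κ, hκ, hκF⟩ := exists_le_abs_sum (F := F) (K := Set.Icc (t₀ - η) (t₀ + η)) fun c hc =>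
    exists_mem_Icc_ne_zero (hana c) (hind c hc) t₀ hη
  set ρ := min κ 1 with hρdef
  have hρ : 0 < ρ := lt_min hκ one_pos
  set C := C₀ + 1 with hCdef
  set D := D₀ + 1 with hDdef
  have hC : 1 ≤ C := by linarith
  have hgood : ∀ c : Fin (m + 1) → ℝ, GoodOn (fun t => ∑ i, c i * F i t) (t₀ - η) (t₀ + η) C D :=
    fun c => (hgood₀ c).mono le_rfl le_rfl (by linarith) (by omega)
  set α := (D : ℝ)⁻¹ with hα
  have hα0 : 0 < α := by positivity
  refine ⟨η, hη, 60 ^ (m + 2) * (C * (2 * (m + 1)) / ρ) ^ α * (2 * η), by positivity, α, hα0,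
    fun δ hδ τ hτ => ?_⟩
  set ε := 2 * (m + 1) * δ with hεdef
  have hε : 0 < ε := by positivity
  have hconst : 60 ^ (m + 2) * (C * (2 * (m + 1)) / ρ) ^ α * (2 * η) * δ ^ α =
      60 ^ (m + 2) * (C * ε / ρ) ^ α * (2 * η) := by
    have : C * ε / ρ = C * (2 * (m + 1)) / ρ * δ := by rw [hεdef]; ring
    rw [this, Real.mul_rpow (by positivity) hδ.le]
    ring
  rw [hconst]
  rcases le_or_gt ρ ε with hρε | hερ
  · refine (measure_mono (Set.sep_subset _ _)).trans ?_
    rw [Real.volume_Icc]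
    refine ENNReal.ofReal_le_ofReal ?_
    have h1 : 1 ≤ (C * ε / ρ) ^ α := by
      refine Real.one_le_rpow ?_ hα0.le
      rw [one_le_div hρ]
      nlinarith
    have h2 : (1 : ℝ) ≤ 60 ^ (m + 2) := one_le_pow₀ (by norm_num)
    have := one_le_mul_of_one_le_of_one_le h2 h1
    nlinarith
  set T : ℝ → (Fin (m + 1) → ℝ) →ₗ[ℝ] (Fin (m + 1) → ℝ) :=
    fun t => latticeMap m τ fun i => F i t with hT
  have hminor : ∀ {r : ℕ} (b : Fin r → Fin (m + 1) → ℝ) (I : Fin r → Fin (m + 1)),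
      ∃ c : Fin (m + 1) → ℝ, (fun t => minors (fun i => T t (b i)) I) =
        fun t => ∑ k, c k * F k t := fun b I => by
    obtain ⟨c, hc⟩ := exists_minors_latticeMap_eq τ b I
    exact ⟨c, funext fun t => hc _ (hF0 t)⟩
  have hcont : ∀ L : RationalSubspace (m + 1), Continuous fun t => L.covolume (T t) := fun L => by
    refine continuous_norm.comp (continuous_pi fun I => ?_)
    obtain ⟨c, hc⟩ := hminor _ I
    rw [hc]
    exact continuous_iff_continuousAt.2 fun t => (hana c t).continuousAt
  have key := volume_not_isMarked_le (rel := fun L L' : RationalSubspace (m + 1) => L < L' ∨ L' < L)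
    (fun _ _ h => h.symm) (dim := fun L => Module.finrank ℝ L.1)
    (fun L L' h => h.elim (fun h => (Submodule.finrank_lt_finrank_of_lt h).ne)
      fun h => (Submodule.finrank_lt_finrank_of_lt h).ne')
    hcont (ε := ε) (ρ := ρ) (c := (C * ε / ρ) ^ α) (a₀ := t₀ - η) (b₀ := t₀ + η) (by positivity)
    (m + 2) (Finset.range (m + 2)) (Finset.card_range _) Set.univ
    (fun L _ => Finset.mem_range.2 <| Nat.lt_succ_of_le <| by
      simpa using Submodule.finrank_le L.1) ?_ (t₀ - η) (t₀ + η) le_rfl (by linarith) le_rfl ?_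
  · rw [show t₀ + η - (t₀ - η) = 2 * η by ring] at key
    refine (measure_mono ?_).trans key
    rintro t ⟨ht, v, hv, hvδ⟩
    refine ⟨ht, fun hmark => ?_⟩
    have h := min_le_mul_norm_of_isMarked (min_le_right _ _) hmark hv
    rw [min_eq_left hερ.le] at h
    push_cast at h
    have := mul_le_mul_of_nonneg_left hvδ (by positivity : (0 : ℝ) ≤ m + 1)
    nlinarith
  · rintro L - a b ha hab hb ⟨x, hx, hρx⟩
    obtain ⟨r, β, -, hcov⟩ := L.exists_covolume_eq
    rw [hcov] at hρx
    obtain ⟨I, hI⟩ := exists_le_abs_of_le_norm hρ hρx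
    obtain ⟨c, hc⟩ := hminor (fun i k => (β i k : ℝ)) I
    have hIx := congrFun hc x
    rw [hIx] at hI
    have h := (hgood c).measureReal_le (by linarith) (by omega) hρ ha hab hb hε hx hI
    have hsub : {y ∈ Set.Icc a b | L.covolume (T y) < ε} ⊆
        {y ∈ Set.Icc a b | |∑ k, c k * F k y| ≤ ε} := by
      rintro y ⟨hy, hyε⟩
      refine ⟨hy, ?_⟩
      rw [hcov] at hyε
      have := (norm_le_pi_norm (minors fun i => T y fun k => (β i k : ℝ)) I).trans hyε.le
      have hcy := congrFun hc y
      rwa [hcy] at this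
    refine (measure_mono hsub).trans ?_
    rw [← ofReal_measureReal (measure_ne_top_of_subset (Set.sep_subset _ _) (by simp))]
    exact ENNReal.ofReal_le_ofReal h
  · rintro L -
    obtain ⟨r, β, hβ, hcov⟩ := L.exists_covolume_eq
    have hr : 0 < r := by
      rw [← hβ.finrank_eq, Module.finrank_pos_iff]
      exact Submodule.nontrivial_iff_ne_bot.2 L.2.1
    obtain ⟨I, c, hc1, hc⟩ := exists_minors_latticeMap_eq_of_linearIndependent hr hτ hβ.1
    obtain ⟨t, ht, hct⟩ := hκF c (by rintro rfl; simp at hc1; linarith)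
    refine ⟨t, ht, ?_⟩
    rw [hcov]
    refine le_trans ?_ (norm_le_pi_norm _ I)
    rw [hT, hc, Real.norm_eq_abs]
    exact (min_le_left _ _).trans ((le_mul_of_one_le_right hκ.le hc1).trans hct)

theorem norm_latticeMap_le {m : ℕ} {ε δ Q H : ℝ} (hε : 0 < ε) (hδ : 0 < δ) (hQ : 0 < Q)
    (hH : Q / 2 ≤ H) {y v : Fin (m + 1) → ℝ} (hv : ∀ k, k ≠ 0 → |v k| ≤ Q)
    (h : |∑ l, v l * y l| ≤ δ ^ (m + 1) / H ^ (m + ε)) :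
    ‖latticeMap m (Q ^ (1 + ε / (m + 1)) / δ) y v‖ ≤
      δ * 2 ^ (m + ε) * Q ^ (-(ε / (m + 1))) := by
  have h2 : (1 : ℝ) ≤ 2 ^ (m + ε) := Real.one_le_rpow one_le_two (by positivity)
  rw [pi_norm_le_iff_of_nonneg (by positivity)]
  intro k
  by_cases hk : k = 0
  · subst hk
    have hH' : δ ^ (m + 1) / H ^ (m + ε) ≤ δ ^ (m + 1) / (Q / 2) ^ (m + ε) := by gcongr
    rw [latticeMap_apply_zero, norm_mul, Real.norm_eq_abs, Real.norm_eq_abs,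
      abs_of_pos (by positivity)]
    refine (mul_le_mul_of_nonneg_left (h.trans hH') (by positivity)).trans_eq ?_
    have e1 : (Q ^ (1 + ε / (m + 1))) ^ m = Q ^ (-(ε / (m + 1))) * Q ^ (m + ε) := by
      rw [← Real.rpow_mul_natCast hQ.le, ← Real.rpow_add hQ]
      congr 1
      field_simp
      ring
    rw [div_pow, e1, Real.div_rpow hQ.le zero_le_two]
    field_simp
    exact pow_succ δ m
  · rw [latticeMap_apply_of_ne _ _ _ _ hk, norm_mul, Real.norm_eq_abs, Real.norm_eq_abs,
      abs_of_pos (by positivity), inv_div, Real.rpow_add hQ, Real.rpow_one, Real.rpow_neg hQ.le]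
    calc _ ≤ δ / (Q * Q ^ (ε / (m + 1))) * Q :=
          mul_le_mul_of_nonneg_left (hv k hk) (by positivity)
      _ = δ * 1 * (Q ^ (ε / (m + 1)))⁻¹ := by field_simp
      _ ≤ _ := by gcongr

theorem exists_volume_not_lt_abs_eq_zero {m : ℕ} {ε : ℝ} (hε : 0 < ε) {F : Fin (m + 1) → ℝ → ℝ}
    (hF : ∀ i t, AnalyticAt ℝ (F i) t) (hF0 : ∀ t, F 0 t = 1)
    (hind : ∀ c : Fin (m + 1) → ℝ, c ≠ 0 → ∃ t, ∑ i, c i * F i t ≠ 0) (t₀ : ℝ) :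
    ∃ η > 0, volume {t ∈ Set.Icc (t₀ - η) (t₀ + η) | ¬ ∃ κ : ℝ, 0 < κ ∧
      ∀ (p : ℤ) (q : Fin m → ℤ), q ≠ 0 →
        κ / ((Finset.univ.sup fun i => (q i).natAbs : ℕ) : ℝ) ^ ((m : ℝ) + ε) <
          |(p : ℝ) + ∑ k, (q k : ℝ) * F k.succ t|} = 0 := by
  obtain ⟨η, hη, C, hC, α, hα, hvol⟩ := exists_volume_exists_norm_latticeMap_le hF hF0 hind t₀
  refine ⟨η, hη, ?_⟩
  set B := {t ∈ Set.Icc (t₀ - η) (t₀ + η) | ¬ ∃ κ : ℝ, 0 < κ ∧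
      ∀ (p : ℤ) (q : Fin m → ℤ), q ≠ 0 →
        κ / ((Finset.univ.sup fun i => (q i).natAbs : ℕ) : ℝ) ^ ((m : ℝ) + ε) <
          |(p : ℝ) + ∑ k, (q k : ℝ) * F k.succ t|} with hB
  set β := ε / (m + 1) with hβ
  have hβ0 : 0 < β := by positivity
  set s : ℝ := (2 ^ (-β)) ^ α with hs
  have hs0 : 0 < s := by positivity
  have hs1 : s < 1 := Real.rpow_lt_one (by positivity)
    (Real.rpow_lt_one_of_one_lt_of_neg one_lt_two (by linarith)) hα
  set K : ℝ := 2 ^ (m + ε) with hK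
  have hbound : ∀ δ : ℝ, 0 < δ → δ < 1 →
      volume B ≤ ENNReal.ofReal (C * K ^ α * s * (1 - s)⁻¹ * δ ^ α) := fun δ hδ hδ1 => by
    have hcover : B ⊆ ⋃ j : ℕ, {t ∈ Set.Icc (t₀ - η) (t₀ + η) | ∃ v : Fin (m + 1) → ℤ, v ≠ 0 ∧
        ‖latticeMap m (((2 : ℝ) ^ (j + 1)) ^ (1 + β) / δ) (fun i => F i t) fun k => (v k : ℝ)‖ ≤
          δ * K * ((2 : ℝ) ^ (j + 1)) ^ (-β)} := by
      rintro t ⟨ht, hbad⟩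
      push Not at hbad
      obtain ⟨p, q, hq, hpq⟩ := hbad (δ ^ (m + 1)) (by positivity)
      set H := Finset.univ.sup fun i => (q i).natAbs with hH
      have hqH : ∀ i, (q i).natAbs ≤ H := fun i =>
        Finset.le_sup (f := fun i => (q i).natAbs) (Finset.mem_univ i)
      have hH0 : H ≠ 0 := fun h0 => hq <| funext fun i => by
        have := hqH i
        rw [h0] at this
        simpa using this
      refine Set.mem_iUnion.2 ⟨Nat.log 2 H, ht, Fin.cons p q, fun h => hq ?_, ?_⟩
      · ext i
        simpa using congrFun h i.succ
      have hlow := Nat.pow_log_le_self 2 hH0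
      have hup := (Nat.lt_pow_succ_log_self one_lt_two H).le
      refine norm_latticeMap_le (H := H) hε hδ (by positivity) ?_ ?_ ?_
      · rw [pow_succ, mul_div_cancel_right₀ _ two_ne_zero]
        exact_mod_cast hlow
      · intro k hk
        obtain ⟨i, rfl⟩ := Fin.exists_succ_eq.2 hk
        rw [Fin.cons_succ, ← Int.cast_abs, Int.abs_eq_natAbs]
        exact_mod_cast (hqH i).trans hup
      · simpa [Fin.sum_univ_succ, hF0] using hpq
    have hterm : ∀ j : ℕ, C * (δ * K * ((2 : ℝ) ^ (j + 1)) ^ (-β)) ^ α =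
        C * K ^ α * s * δ ^ α * s ^ j := fun j => by
      rw [Real.mul_rpow (by positivity) (by positivity), Real.mul_rpow hδ.le (by positivity),
        ← Real.rpow_pow_comm zero_le_two, ← Real.rpow_pow_comm (by positivity), ← hs, pow_succ]
      ring
    calc volume B ≤ ∑' j : ℕ, ENNReal.ofReal (C * K ^ α * s * δ ^ α * s ^ j) := by
          refine (measure_mono hcover).trans ((measure_iUnion_le _).trans ?_)
          refine ENNReal.tsum_le_tsum fun j => ?_
          rw [← hterm]
          refine hvol _ (by positivity) _ ?_
          rw [le_div_iff₀ hδ, one_mul]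
          exact hδ1.le.trans (Real.one_le_rpow (one_le_pow₀ one_le_two) (by positivity))
      _ = _ := by
          rw [← ENNReal.ofReal_tsum_of_nonneg (fun j => by positivity)
            ((summable_geometric_of_lt_one hs0.le hs1).mul_left _), tsum_mul_left,
            tsum_geometric_of_lt_one hs0.le hs1]
          congr 1
          ring
  have hlim : Filter.Tendsto (fun δ : ℝ => ENNReal.ofReal (C * K ^ α * s * (1 - s)⁻¹ * δ ^ α))
      (nhdsWithin 0 (Set.Ioi 0)) (nhds 0) := by
    have h : Filter.Tendsto (fun δ : ℝ => C * K ^ α * s * (1 - s)⁻¹ * δ ^ α) (nhds 0) (nhds 0) := by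
      have := (Real.continuousAt_rpow_const 0 α (Or.inr hα.le)).tendsto.const_mul
        (C * K ^ α * s * (1 - s)⁻¹)
      rwa [Real.zero_rpow hα.ne', mul_zero] at this
    have := ENNReal.tendsto_ofReal (h.mono_left (nhdsWithin_le_nhds (s := Set.Ioi 0)))
    rwa [ENNReal.ofReal_zero] at this
  refine le_antisymm (ge_of_tendsto hlim ?_) bot_le
  filter_upwards [Ioo_mem_nhdsGT one_pos] with δ hδ using hbound δ hδ.1 hδ.2

theorem ae_exists_forall_lt_abs {m : ℕ} {ε : ℝ} (hε : 0 < ε) {F : Fin (m + 1) → ℝ → ℝ}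
    (hF : ∀ i t, AnalyticAt ℝ (F i) t) (hF0 : ∀ t, F 0 t = 1)
    (hind : ∀ c : Fin (m + 1) → ℝ, c ≠ 0 → ∃ t, ∑ i, c i * F i t ≠ 0) :
    ∀ᵐ t : ℝ, ∃ κ : ℝ, 0 < κ ∧ ∀ (p : ℤ) (q : Fin m → ℤ), q ≠ 0 →
      κ / ((Finset.univ.sup fun i => (q i).natAbs : ℕ) : ℝ) ^ ((m : ℝ) + ε) <
        |(p : ℝ) + ∑ k, (q k : ℝ) * F k.succ t| := by
  rw [ae_iff]
  refine measure_null_of_locally_null _ fun t₀ _ => ?_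
  obtain ⟨η, hη, h⟩ := exists_volume_not_lt_abs_eq_zero hε hF hF0 hind t₀
  refine ⟨_, inter_mem_nhdsWithin _ (Icc_mem_nhds (by linarith : t₀ - η < t₀)
    (by linarith : t₀ < t₀ + η)), ?_⟩
  rw [Set.inter_comm]
  exact h

theorem exists_analyticAt_eq {n N : ℕ} (Y : Fin N → Fin n → ℝ) :
    ∃ γ : ℝ → Fin n → ℝ, (∀ t, AnalyticAt ℝ γ t) ∧ ∀ j : Fin N, γ (j : ℕ) = Y j := by
  refine ⟨fun t k => (Lagrange.interpolate Finset.univ (fun j : Fin N => ((j : ℕ) : ℝ))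
    fun j => Y j k).eval t, fun t => analyticAt_pi_iff.2 fun k => ?_, fun j => ?_⟩
  · exact AnalyticOnNhd.eval_polynomial _ t trivial
  · ext k
    exact Lagrange.eval_interpolate_at_node (fun j => Y j k)
      (Nat.cast_injective.comp Fin.val_injective).injOn (Finset.mem_univ j)

theorem exists_sum_mul_ne_zero_of_det_ne_zero {N : ℕ} {F : Fin N → ℝ → ℝ} {x : Fin N → ℝ}
    (h : (Matrix.of fun j i => F i (x j)).det ≠ 0) {c : Fin N → ℝ} (hc : c ≠ 0) :
    ∃ t, ∑ i, c i * F i t ≠ 0 := by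
  by_contra! h0
  refine h (Matrix.exists_mulVec_eq_zero_iff.1 ⟨c, hc, ?_⟩)
  ext j
  simpa [Matrix.mulVec, dotProduct, mul_comm] using h0 (x j)

theorem measurableSet_exists_forall_lt_abs {X : Type*} [MeasurableSpace X] {m : ℕ} {e : ℝ}
    {g : Fin m → X → ℝ} (hg : ∀ k, Measurable (g k)) :
    MeasurableSet {x | ∃ κ : ℝ, 0 < κ ∧ ∀ (p : ℤ) (q : Fin m → ℤ), q ≠ 0 →
      κ / ((Finset.univ.sup fun i => (q i).natAbs : ℕ) : ℝ) ^ e <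
        |(p : ℝ) + ∑ k, (q k : ℝ) * g k x|} := by
  have h : {x | ∃ κ : ℝ, 0 < κ ∧ ∀ (p : ℤ) (q : Fin m → ℤ), q ≠ 0 →
      κ / ((Finset.univ.sup fun i => (q i).natAbs : ℕ) : ℝ) ^ e <
        |(p : ℝ) + ∑ k, (q k : ℝ) * g k x|} =
      ⋃ N : ℕ, ⋂ (p : ℤ) (q : Fin m → ℤ) (_ : q ≠ 0), {x |
        1 / ((N : ℝ) + 1) / ((Finset.univ.sup fun i => (q i).natAbs : ℕ) : ℝ) ^ e <
          |(p : ℝ) + ∑ k, (q k : ℝ) * g k x|} := by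
    ext x
    simp only [Set.mem_iUnion, Set.mem_iInter, Set.mem_ofPred_eq]
    constructor
    · rintro ⟨κ, hκ, h⟩
      obtain ⟨N, hN⟩ := exists_nat_one_div_lt hκ
      exact ⟨N, fun p q hq => (div_le_div_of_nonneg_right hN.le (by positivity)).trans_lt
        (h p q hq)⟩
    · rintro ⟨N, h⟩
      exact ⟨_, Nat.one_div_pos_of_nat, h⟩
  rw [h]
  refine MeasurableSet.iUnion fun N => MeasurableSet.iInter fun p => MeasurableSet.iInter fun q =>
    MeasurableSet.iInter fun _ => measurableSet_lt measurable_const ?_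
  fun_prop

theorem exists_nhds_ae_exists_forall_lt_abs {n m : ℕ} {ε : ℝ} (hε : 0 < ε)
    {g : Fin m → (Fin n → ℝ) → ℝ} (hg : ∀ k x, AnalyticAt ℝ (g k) x)
    (hindep : LinearIndependent ℝ
      (Fin.cons (fun _ => (1 : ℝ)) g : Fin (m + 1) → (Fin n → ℝ) → ℝ)) (v₀ : Fin n → ℝ) :
    ∃ U ∈ nhds v₀, ∀ᵐ v : Fin n → ℝ, v ∈ U → ∃ κ : ℝ, 0 < κ ∧
      ∀ (p : ℤ) (q : Fin m → ℤ), q ≠ 0 →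
        κ / ((Finset.univ.sup fun i => (q i).natAbs : ℕ) : ℝ) ^ ((m : ℝ) + ε) <
          |(p : ℝ) + ∑ k, (q k : ℝ) * g k v| := by
  set f : Fin (m + 1) → (Fin n → ℝ) → ℝ := Fin.cons (fun _ => (1 : ℝ)) g with hf
  have hfana : ∀ i x, AnalyticAt ℝ (f i) x := fun i x => by
    refine Fin.cases ?_ (fun i => ?_) i
    · exact analyticAt_const
    · exact hg i x
  have hfcont : ∀ i, Continuous (f i) := fun i =>
    continuous_iff_continuousAt.2 fun x => (hfana i x).continuousAt
  obtain ⟨x, hx⟩ := hindep.exists_det_ne_zero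
  obtain ⟨γ, hγ, hγx⟩ := exists_analyticAt_eq (Fin.snoc x v₀ : Fin (m + 2) → Fin n → ℝ)
  have hγcont : Continuous γ := continuous_iff_continuousAt.2 fun t => (hγ t).continuousAt
  obtain ⟨r, hr, hdet⟩ : ∃ r > 0, ∀ w ∈ Metric.ball (0 : Fin n → ℝ) r,
      (Matrix.of fun j i => f i (w + x j)).det ≠ 0 := by
    have hcont : Continuous fun w => (Matrix.of fun j i => f i (w + x j)).det :=
      Continuous.matrix_det (continuous_matrix fun j i =>
        (hfcont i).comp (continuous_id.add continuous_const))
    exact Metric.mem_nhds_iff.1 (hcont.continuousAt.eventually_ne (x := 0) (by simpa using hx))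
  set G := {v : Fin n → ℝ | ∃ κ : ℝ, 0 < κ ∧ ∀ (p : ℤ) (q : Fin m → ℤ), q ≠ 0 →
    κ / ((Finset.univ.sup fun i => (q i).natAbs : ℕ) : ℝ) ^ ((m : ℝ) + ε) <
      |(p : ℝ) + ∑ k, (q k : ℝ) * g k v|} with hG
  have hGmeas : MeasurableSet G :=
    measurableSet_exists_forall_lt_abs fun k => (hfcont k.succ).measurable
  have hline : ∀ᵐ w ∂volume.restrict (Metric.ball (0 : Fin n → ℝ) r), ∀ᵐ t : ℝ, w + γ t ∈ G := by
    refine ae_restrict_of_forall_mem Metric.isOpen_ball.measurableSet fun w hw => ?_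
    refine ae_exists_forall_lt_abs hε (F := fun i t => f i (w + γ t))
      (fun i t => (hfana i _).comp (analyticAt_const.add (hγ t))) (fun t => rfl) fun c hc => ?_
    refine exists_sum_mul_ne_zero_of_det_ne_zero (x := fun j => ((j : ℕ) : ℝ)) ?_ hc
    have h : ∀ j : Fin (m + 1), γ (j : ℕ) = x j := fun j => by
      simpa using hγx j.castSucc
    simpa only [h] using hdet w hw
  have hcomm := (Measure.ae_ae_comm (μ := volume.restrict (Metric.ball (0 : Fin n → ℝ) r))
    (ν := (volume : Measure ℝ)) (p := fun w t => w + γ t ∈ G) (hGmeas.preimage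
      (by fun_prop : Measurable fun z : (Fin n → ℝ) × ℝ => z.1 + γ z.2))).1 hline
  obtain ⟨t, ht, htr⟩ := (Measure.dense_of_ae hcomm).exists_mem_open
    ((Metric.isOpen_ball (x := (0 : Fin n → ℝ)) (ε := r)).preimage
      (continuous_const.sub hγcont : Continuous fun t => v₀ - γ t)) ⟨((m + 1 : ℕ) : ℝ), by
        have := hγx (Fin.last (m + 1))
        simp only [Fin.val_last, Fin.snoc_last] at this
        simpa [-Nat.cast_add, this] using hr⟩
  refine ⟨(fun v => v - γ t) ⁻¹' Metric.ball 0 r,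
    (Metric.isOpen_ball.preimage (continuous_id.sub continuous_const)).mem_nhds htr, ?_⟩
  rw [Set.mem_ofPred_eq, ae_restrict_iff' Metric.isOpen_ball.measurableSet] at ht
  filter_upwards [(measurePreserving_sub_right volume (γ t)).quasiMeasurePreserving.ae ht]
    with v hv hvU
  have hvG := hv hvU
  rwa [sub_add_cancel] at hvG

/-- Constant-form corollary of the Khintchine–Groshev theorem for analytic
non-degenerate manifolds, with `ψ(q) = 1/q^(m+ε)`: for almost every `v ∈ ℝ^n`
there is `κ > 0` such that `|p + ∑ qₖ gₖ(v)| > κ / (‖q‖_∞)^(m+ε)` for every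
`p ∈ ℤ` and every nonzero `q ∈ ℤ^m`. -/
theorem khintchine_groshev_manifold_constant_form (n m : ℕ) (hn : 1 ≤ n)
    (hnm : n ≤ m) (ε : ℝ) (hε : 0 < ε)
    (g : Fin m → (Fin n → ℝ) → ℝ)
    (hanalytic : ∀ (k : Fin m) (x : Fin n → ℝ), AnalyticAt ℝ (g k) x)
    (hindep : LinearIndependent ℝ
      (Fin.cons (fun _ => (1 : ℝ)) g : Fin (m + 1) → (Fin n → ℝ) → ℝ)) :
    ∀ᵐ v : Fin n → ℝ, ∃ κ : ℝ, 0 < κ ∧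
      ∀ (p : ℤ) (q : Fin m → ℤ), q ≠ 0 →
        κ / ((Finset.univ.sup fun i => (q i).natAbs : ℕ) : ℝ) ^ ((m : ℝ) + ε) <
          |(p : ℝ) + ∑ k, (q k : ℝ) * g k v| := by
  rw [ae_iff]
  refine measure_null_of_locally_null _ fun v₀ _ => ?_
  obtain ⟨U, hU, h⟩ := exists_nhds_ae_exists_forall_lt_abs hε hanalytic hindep v₀
  refine ⟨_, inter_mem_nhdsWithin _ hU, measure_mono_null (fun v hv => ?_) (ae_iff.1 h)⟩
  exact fun hgood => hv.1 (hgood hv.2)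
end
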